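/- Fix δ₀ > 0. Then there exist k ∈ ℕ and ε₂ > 0, depending only on δ₀, such that the following holds: for every C₀ > 0 there exists a constant C₁ > 0, depending only on C₀ and δ₀, such that for all finite Borel measures μ₁, …, μ_k on ℝ supported in [C₀^{-1}, C₀] with μ_j(ℝ) ≤ C₀ for each j, and every η ∈ ℝ with |η| ≥ 1, if for every σ ∈ [C₀|η|^{-1}, C₀^{-1}|η|^{-ε₂}] and every j = 1, …, k one has (μ_j × μ_j)({(x,y) ∈ ℝ² : |x − y| ≤ σ}) ≤ C₀ σ^{δ₀}, then |∫ exp(2πi η x₁⋯x_k) dμ₁(x₁) ⋯ dμ_k(x_k)| ≤ C₁ |η|^{-ε₂}. -/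

import Mathlib

open MeasureTheory Set Real

noncomputable section

section
open MeasureTheory Set Real

/-! ## Part I : the ring theorem -/

/-- A filtration of subsets of `ℝ` by ring complexity. -/
structure RF (G : ℕ → Set ℝ) : Prop where
  mono : ∀ m, G m ⊆ G (m+1)
  add : ∀ m a b, a ∈ G m → b ∈ G m → a + b ∈ G (m+1)
  sub : ∀ m a b, a ∈ G m → b ∈ G m → a - b ∈ G (m+1)
  mul : ∀ m a b, a ∈ G m → b ∈ G m → a * b ∈ G (m+1)
  one : (1:ℝ) ∈ G 0

def SepBy (Y : Finset ℝ) (σ : ℝ) : Prop := ∀ x ∈ Y, ∀ y ∈ Y, x ≠ y → σ ≤ |x - y|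

lemma RF.le {G : ℕ → Set ℝ} (h : RF G) {m m' : ℕ} (hm : m ≤ m') : G m ⊆ G m' := by
  induction hm with
  | refl => exact subset_rfl
  | step _ ih => exact ih.trans (h.mono _)

lemma RF.pow {G : ℕ → Set ℝ} (h : RF G) {θ : ℝ} (hθ : θ ∈ G 0) (j : ℕ) : θ ^ j ∈ G j := by
  induction j with
  | zero => simpa using h.one
  | succ j ih =>
    rw [pow_succ]
    exact h.mul _ _ _ ih (h.le (Nat.zero_le j) hθ)

/-- A finite set that is not `s`-dense has a point `q` with `(q+b)/2` far from the set. -/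
lemma gap_lemma (Q : Finset ℝ) (h0 : (0:ℝ) ∈ Q) (s : ℝ) (hs0 : 0 < s) (hs : s ≤ 1)
    (hnd : ∃ t ∈ Icc (0:ℝ) 1, ∀ q ∈ Q, s < |t - q|) :
    ∃ q ∈ Q, |q| ≤ 3 ∧ ∃ b : ℝ, (b = 0 ∨ b = 1) ∧ ∀ q' ∈ Q, s / 2 < |(q + b) / 2 - q'| := by
  by_contra hcon
  push Not at hcon
  have key : ∀ n : ℕ, ∀ t ∈ Icc (0:ℝ) 1, ∃ q ∈ Q, |t - q| ≤ s + (1/2)^n := by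
    intro n
    induction n with
    | zero =>
      intro t ht
      refine ⟨0, h0, ?_⟩
      rw [sub_zero, abs_of_nonneg ht.1]
      simp
      linarith [ht.2]
    | succ n ih =>
      intro t ht
      obtain ⟨b, hb, hbt⟩ : ∃ b : ℝ, (b = 0 ∨ b = 1) ∧ 2 * t - b ∈ Icc (0:ℝ) 1 := by
        by_cases h : t ≤ 1/2
        · exact ⟨0, Or.inl rfl, by constructor <;> linarith [ht.1]⟩
        · exact ⟨1, Or.inr rfl, by constructor <;> linarith [ht.2]⟩
      obtain ⟨q, hq, hqt⟩ := ih _ hbt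
      have hp : (1/2:ℝ)^n ≤ 1 := pow_le_one₀ (by norm_num) (by norm_num)
      have hq3 : |q| ≤ 3 := by
        rw [abs_le] at hqt ⊢
        constructor <;> linarith [hbt.1, hbt.2]
      obtain ⟨q', hq', hqq⟩ := hcon q hq hq3 b hb
      refine ⟨q', hq', ?_⟩
      have : (1/2:ℝ)^(n+1) = (1/2)^n / 2 := by rw [pow_succ]; ring
      rw [this]
      rw [abs_le] at hqt hqq ⊢
      constructor <;> linarith [hqt.1, hqt.2, hqq.1, hqq.2]
  obtain ⟨t, ht, hq⟩ := hnd
  obtain ⟨q0, hq0, hmin⟩ := Finset.exists_min_image Q (fun q => |t - q|) ⟨0, h0⟩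
  have hpos : 0 < |t - q0| - s := by linarith [hq q0 hq0]
  obtain ⟨n, hn⟩ := exists_pow_lt_of_lt_one hpos (by norm_num : (1/2:ℝ) < 1)
  obtain ⟨q, hqQ, hqt⟩ := key n t ht
  have := hmin q hqQ
  linarith

/-- Stacking. -/
lemma stack (X : Finset ℝ) (B : ℝ) (hB : 1 ≤ B) (n : ℕ) (θ : ℝ) (hθ : 0 < θ) (hθB : 64 * B * θ ≤ 1)
    (hX : ∀ x ∈ X, |x| ≤ 3 * B) (hsep : SepBy X (θ^n / 2)) (T : ℕ)
    (Gd : ℕ → Set ℝ) (w : ℝ) (hG0 : ∀ t, (0:ℝ) ∈ Gd t)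
    (hG : ∀ t, ∀ x ∈ X, ∀ z, w * z ∈ Gd t → w * (x + θ^(n+1) * z) ∈ Gd (t+1)) :
    ∃ Z : Finset ℝ, (∀ z ∈ Z, |z| ≤ 6 * B ∧ w * z ∈ Gd T) ∧ SepBy Z (θ^((n+1)*T)) ∧
      Z.card = X.card ^ T := by
  have hθ1 : θ ≤ 1/64 := by nlinarith
  have hl0 : 0 < θ^n := pow_pos hθ n
  induction T with
  | zero =>
    refine ⟨{0}, ?_, ?_, by simp⟩
    · intro z hz
      rw [Finset.mem_singleton] at hz
      subst hz
      simp only [abs_zero, mul_zero]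
      exact ⟨by linarith, hG0 0⟩
    · intro x hx y hy hxy
      rw [Finset.mem_singleton] at hx hy
      exact absurd (hx.trans hy.symm) hxy
  | succ T ih =>
    obtain ⟨Z, hZ, hZs, hZc⟩ := ih
    have hlam : 0 < θ^(n+1) := pow_pos hθ _
    have hlam' : θ^(n+1) = θ^n * θ := pow_succ _ _
    have hlam1 : θ^(n+1) ≤ θ := by
      rw [hlam']; have : θ^n ≤ 1 := pow_le_one₀ hθ.le (by linarith)
      nlinarith
    have main : ∀ x ∈ X, ∀ x' ∈ X, ∀ z ∈ Z, ∀ z' ∈ Z, (x, z) ≠ (x', z') →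
        θ^((n+1)*(T+1)) ≤ |(x + θ^(n+1) * z) - (x' + θ^(n+1) * z')| := by
      intro x hx x' hx' z hz z' hz' hne
      have e : θ^((n+1)*(T+1)) = θ^(n+1) * θ^((n+1)*T) := by rw [← pow_add]; ring_nf
      rw [e]
      by_cases hxx : x = x'
      · have hzz : z ≠ z' := by
          rintro rfl; exact hne (by rw [hxx])
        have := hZs z hz z' hz' hzz
        have e2 : (x + θ^(n+1) * z) - (x' + θ^(n+1) * z') = θ^(n+1) * (z - z') := by
          rw [hxx]; ring
        rw [e2, abs_mul, abs_of_pos hlam]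
        exact mul_le_mul_of_nonneg_left this hlam.le
      · have h1 := hsep x hx x' hx' hxx
        have h2 : |z - z'| ≤ 12 * B := by
          have := (hZ z hz).1
          have := (hZ z' hz').1
          calc |z - z'| ≤ |z| + |z'| := abs_sub _ _
            _ ≤ _ := by linarith
        have h3 : |x - x'| - θ^(n+1) * |z - z'| ≤ |(x + θ^(n+1) * z) - (x' + θ^(n+1) * z')| := by
          have e2 : (x + θ^(n+1) * z) - (x' + θ^(n+1) * z') = (x - x') - (- (θ^(n+1) * (z - z'))) := by
            ring
          rw [e2]
          have := abs_sub_abs_le_abs_sub (x - x') (-(θ^(n+1) * (z - z')))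
          rw [abs_neg, abs_mul, abs_of_pos hlam] at this
          exact this
        have h4 : θ^(n+1) * |z - z'| ≤ θ^n / 4 := by
          calc θ^(n+1) * |z - z'| ≤ θ^(n+1) * (12 * B) := mul_le_mul_of_nonneg_left h2 hlam.le
            _ = θ^n * (12 * (B * θ)) := by rw [hlam']; ring
            _ ≤ θ^n * (1/4) := by
              apply mul_le_mul_of_nonneg_left _ hl0.le
              linarith
            _ = _ := by ring
        have h5 : θ^(n+1) * θ^((n+1)*T) ≤ θ^n / 4 := by
          have : θ^((n+1)*T) ≤ 1 := pow_le_one₀ hθ.le (by linarith)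
          calc θ^(n+1) * θ^((n+1)*T) ≤ θ^(n+1) * 1 := mul_le_mul_of_nonneg_left this hlam.le
            _ = θ^n * θ := by rw [mul_one, hlam']
            _ ≤ θ^n * (1/4) := mul_le_mul_of_nonneg_left (by linarith) hl0.le
            _ = _ := by ring
        linarith
    refine ⟨(X ×ˢ Z).image (fun q => q.1 + θ^(n+1) * q.2), ?_, ?_, ?_⟩
    · intro y hy
      rw [Finset.mem_image] at hy
      obtain ⟨⟨x, z⟩, hxz, rfl⟩ := hy
      rw [Finset.mem_product] at hxz
      refine ⟨?_, hG T x hxz.1 z (hZ z hxz.2).2⟩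
      have a1 := hX x hxz.1
      have a2 := (hZ z hxz.2).1
      simp only at a1 a2 ⊢
      calc |x + θ^(n+1) * z| ≤ |x| + |θ^(n+1) * z| := abs_add_le _ _
        _ = |x| + θ^(n+1) * |z| := by rw [abs_mul, abs_of_pos hlam]
        _ ≤ 3 * B + (1/64) * (6 * B) := by
          apply add_le_add a1
          apply mul_le_mul (by linarith) a2 (abs_nonneg _) (by norm_num)
        _ ≤ 6 * B := by linarith
    · intro y hy y' hy' hne
      rw [Finset.mem_image] at hy hy'
      obtain ⟨⟨x, z⟩, hxz, rfl⟩ := hy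
      obtain ⟨⟨x', z'⟩, hxz', rfl⟩ := hy'
      rw [Finset.mem_product] at hxz hxz'
      apply main x hxz.1 x' hxz'.1 z hxz.2 z' hxz'.2
      rintro h
      apply hne
      rw [h]
    · rw [Finset.card_image_of_injOn, Finset.card_product, hZc, pow_succ, mul_comm]
      rintro ⟨x, z⟩ hxz ⟨x', z'⟩ hxz' heq
      rw [Finset.mem_coe, Finset.mem_product] at hxz hxz'
      by_contra hne
      have := main x hxz.1 x' hxz'.1 z hxz.2 z' hxz'.2 hne
      simp only at heq
      rw [heq, sub_self, abs_zero] at this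
      exact absurd this (not_le.mpr (pow_pos hθ _))

def Dens (G : ℕ → Set ℝ) (θ : ℝ) (A p m : ℕ) : Prop :=
  ∀ t ∈ Icc (0:ℝ) 1, ∃ z1 ∈ G m, ∃ z2 ∈ G m, θ^p ≤ |z2| ∧ |t * z2 - z1| ≤ θ^(p*A) * |z2|

lemma ring_step {G : ℕ → Set ℝ} (hG : RF G) {θ B : ℝ} (hθG : θ ∈ G 0) (hθ : 0 < θ) (hB : 1 ≤ B)
    (hθB : 64 * B * θ ≤ 1) (A p m : ℕ) (Y1 Y2 : Finset ℝ)
    (hY1 : ∀ y ∈ Y1, y ∈ G m ∧ |y| ≤ B) (hY2 : ∀ y ∈ Y2, y ∈ G 0 ∧ |y| ≤ B)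
    (hs1 : SepBy Y1 (θ^(p*(A+1)))) (hs2 : SepBy Y2 (θ^p)) (hc1 : Y1.Nonempty) (hc2 : 2 ≤ Y2.card)
    (hnd : ¬ Dens G θ A p (m+1)) (T : ℕ) :
    ∃ Z : Finset ℝ, (∀ y ∈ Z, y ∈ G (m + p*(A+1) + 10 + 3*T) ∧ |y| ≤ B) ∧
      SepBy Z (θ^((p*(A+1)+1)*T + p + 1)) ∧ Z.card = (Y1.card * Y2.card)^T := by
  classical
  have hθ1 : θ ≤ 1/64 := by nlinarith
  set n := p*(A+1) with hn
  set s := θ^(p*A) with hs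
  have hs0 : 0 < s := pow_pos hθ _
  have hsn : θ^n = s * θ^p := by rw [hs, ← pow_add, hn]; ring_nf
  have hρ0 : 0 < θ^p := pow_pos hθ _
  obtain ⟨c0, hc0, d0, hd0, hcd0⟩ := Finset.one_lt_card.mp hc2
  obtain ⟨a0, ha0⟩ := hc1
  set Q : Finset ℝ := ((Y1 ×ˢ Y1) ×ˢ ((Y2 ×ˢ Y2).filter (fun u => u.1 ≠ u.2))).image
    (fun u => (u.1.1 - u.1.2) / (u.2.1 - u.2.2)) with hQ
  have memQ : ∀ a ∈ Y1, ∀ b ∈ Y1, ∀ c ∈ Y2, ∀ d ∈ Y2, c ≠ d → (a - b) / (c - d) ∈ Q := by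
    intro a ha b hb c hc d hd hcd
    rw [hQ, Finset.mem_image]
    exact ⟨((a,b),(c,d)), by simp [ha, hb, hc, hd, hcd], rfl⟩
  have h0Q : (0:ℝ) ∈ Q := by
    have := memQ a0 ha0 a0 ha0 c0 hc0 d0 hd0 hcd0
    simpa using this
  have hnd' : ∃ t ∈ Icc (0:ℝ) 1, ∀ q ∈ Q, s < |t - q| := by
    by_contra hcon
    push Not at hcon
    apply hnd
    intro t ht
    obtain ⟨q, hq, hqt⟩ := hcon t ht
    rw [hQ, Finset.mem_image] at hq
    obtain ⟨⟨⟨a,b⟩,⟨c,d⟩⟩, hu, rfl⟩ := hq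
    simp only [Finset.mem_product, Finset.mem_filter] at hu
    obtain ⟨⟨ha, hb⟩, ⟨hc, hd⟩, hcd⟩ := hu
    have hcd' : c - d ≠ 0 := sub_ne_zero.mpr hcd
    refine ⟨a - b, hG.sub _ _ _ (hY1 a ha).1 (hY1 b hb).1, c - d, hG.sub _ _ _ (hG.le (Nat.zero_le m) (hY2 c hc).1) (hG.le (Nat.zero_le m) (hY2 d hd).1), hs2 c hc d hd hcd, ?_⟩
    have : t * (c - d) - (a - b) = (t - (a - b)/(c-d)) * (c - d) := by field_simp
    rw [this, abs_mul]
    exact mul_le_mul_of_nonneg_right hqt (abs_nonneg _)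
  obtain ⟨q, hq, hq3, b, hb, hfar⟩ := gap_lemma Q h0Q s hs0 (pow_le_one₀ hθ.le (by linarith)) hnd'
  set q' := (q + b)/2 with hq'
  have hq'2 : |q'| ≤ 2 := by
    rw [abs_le] at hq3 ⊢
    rcases hb with rfl | rfl <;> constructor <;> linarith [hq3.1, hq3.2]
  rw [hQ, Finset.mem_image] at hq
  obtain ⟨⟨⟨a,a'⟩,⟨c,d⟩⟩, hu, hqe⟩ := hq
  simp only [Finset.mem_product, Finset.mem_filter] at hu
  obtain ⟨⟨ha, ha'⟩, ⟨hc, hd⟩, hcd⟩ := hu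
  simp only at hqe
  have hcd' : c - d ≠ 0 := sub_ne_zero.mpr hcd
  -- separation of the block
  have hsepB : ∀ y1 ∈ Y1, ∀ y1' ∈ Y1, ∀ y2 ∈ Y2, ∀ y2' ∈ Y2, (y1,y2) ≠ (y1',y2') →
      θ^n / 2 ≤ |(y1 + q' * y2) - (y1' + q' * y2')| := by
    intro y1 h1 y1' h1' y2 h2 y2' h2' hne
    by_cases h : y2 = y2'
    · subst h
      have hyy : y1 ≠ y1' := by rintro rfl; exact hne rfl
      have := hs1 y1 h1 y1' h1' hyy
      have e : (y1 + q' * y2) - (y1' + q' * y2) = y1 - y1' := by ring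
      rw [e]
      have := pow_pos hθ n
      linarith
    · have h' : y2 - y2' ≠ 0 := sub_ne_zero.mpr h
      have e : (y1 + q' * y2) - (y1' + q' * y2') = (q' - (y1' - y1)/(y2 - y2')) * (y2 - y2') := by
        field_simp; ring
      rw [e, abs_mul, hsn]
      have f1 := (hfar _ (memQ y1' h1' y1 h1 y2 h2 y2' h2' h)).le
      have f2 := hs2 y2 h2 y2' h2' h
      calc s * θ^p / 2 = (s/2) * θ^p := by ring
        _ ≤ _ := mul_le_mul f1 f2 hρ0.le (abs_nonneg _)
  set X := (Y1 ×ˢ Y2).image (fun u => u.1 + q' * u.2) with hX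
  have hXc : X.card = Y1.card * Y2.card := by
    rw [hX, Finset.card_image_of_injOn, Finset.card_product]
    rintro ⟨x, z⟩ hxz ⟨x', z'⟩ hxz' heq
    rw [Finset.mem_coe, Finset.mem_product] at hxz hxz'
    by_contra hne
    have := hsepB x hxz.1 x' hxz'.1 z hxz.2 z' hxz'.2 hne
    simp only at heq
    rw [heq, sub_self, abs_zero] at this
    have := pow_pos hθ n
    linarith
  set w := 2 * (c - d) with hw
  have g0 : ∀ {x}, x ∈ G 0 → x ∈ G m := fun h => hG.le (Nat.zero_le m) h
  have hcdG : c - d ∈ G (m+1) := hG.sub _ _ _ (g0 (hY2 c hc).1) (g0 (hY2 d hd).1)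
  have hbG : b ∈ G (m+1) := by
    rcases hb with rfl | rfl
    · have := hG.sub m 1 1 (g0 hG.one) (g0 hG.one)
      simpa using this
    · exact hG.mono _ (g0 hG.one)
  have hwG : w ∈ G (m+2) := by
    rw [hw, two_mul]; exact hG.add _ _ _ hcdG hcdG
  have hvG : w * q' ∈ G (m+3) := by
    have : w * q' = (a - a') + b * (c - d) := by
      rw [hw, hq', ← hqe]; field_simp
    rw [this]
    exact hG.add _ _ _ (hG.mono _ (hG.sub _ _ _ (hY1 a ha).1 (hY1 a' ha').1)) (hG.mul _ _ _ hbG hcdG)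
  have hxG : ∀ x ∈ X, w * x ∈ G (m+5) := by
    intro x hx
    rw [hX, Finset.mem_image] at hx
    obtain ⟨⟨y1,y2⟩, hy, rfl⟩ := hx
    rw [Finset.mem_product] at hy
    have : w * (y1 + q' * y2) = w * y1 + (w * q') * y2 := by ring
    rw [this]
    apply hG.add
    · exact hG.mul _ _ _ (hG.mono _ hwG) (hG.le (by omega) (hY1 y1 hy.1).1)
    · exact hG.mul _ _ _ hvG (hG.le (by omega) (hY2 y2 hy.2).1)
  obtain ⟨Z, hZ, hZs, hZc⟩ := stack X B hB n θ hθ hθB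
    (by
      intro x hx
      rw [hX, Finset.mem_image] at hx
      obtain ⟨⟨y1,y2⟩, hy, rfl⟩ := hx
      rw [Finset.mem_product] at hy
      calc |y1 + q' * y2| ≤ |y1| + |q' * y2| := abs_add_le _ _
        _ = |y1| + |q'| * |y2| := by rw [abs_mul]
        _ ≤ B + 2 * B := add_le_add (hY1 y1 hy.1).2 (mul_le_mul hq'2 (hY2 y2 hy.2).2 (abs_nonneg _) (by norm_num))
        _ = _ := by ring)
    (by
      intro x hx y hy hxy
      rw [hX, Finset.mem_image] at hx hy
      obtain ⟨⟨y1,y2⟩, hh, rfl⟩ := hx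
      obtain ⟨⟨y1',y2'⟩, hh', rfl⟩ := hy
      rw [Finset.mem_product] at hh hh'
      apply hsepB _ hh.1 _ hh'.1 _ hh.2 _ hh'.2
      intro h
      apply hxy
      simp only [Prod.mk.injEq] at h
      simp [h.1, h.2])
    T (fun t => G (m + n + 7 + 3*t)) w
    (by
      intro t
      have := hG.sub m 1 1 (g0 hG.one) (g0 hG.one)
      rw [sub_self] at this
      exact hG.le (by omega) this)
    (by
      intro t x hx z hz
      have : w * (x + θ^(n+1) * z) = w * x + θ^(n+1) * (w * z) := by ring
      rw [this]
      apply hG.le (show (m+n+7+3*t)+1+1 ≤ m + n + 7 + 3*(t+1) by omega)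
      apply hG.add
      · exact hG.le (by omega) (hxG x hx)
      · apply hG.mul _ _ _ _ hz
        exact hG.le (by omega) (hG.pow hθG (n+1)))
  have hw2 : |w| = 2 * |c - d| := by rw [hw, abs_mul, abs_two]
  have hwlow : θ^p ≤ |w| := by
    have := hs2 c hc d hd hcd
    rw [hw2]; linarith
  have hwup : |w| ≤ 4 * B := by
    rw [hw2]
    have : |c - d| ≤ |c| + |d| := abs_sub _ _
    linarith [(hY2 c hc).2, (hY2 d hd).2]
  have hinj : ∀ x y : ℝ, |θ * (w * x) - θ * (w * y)| = θ * |w| * |x - y| := by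
    intro x y
    rw [← mul_sub, ← mul_sub, abs_mul, abs_mul, abs_of_pos hθ]; ring
  have hwpos : 0 < |w| := lt_of_lt_of_le hρ0 hwlow
  refine ⟨Z.image (fun z => θ * (w * z)), ?_, ?_, ?_⟩
  · intro y hy
    rw [Finset.mem_image] at hy
    obtain ⟨z, hz, rfl⟩ := hy
    constructor
    · apply hG.le (show (m+n+7+3*T)+1 ≤ m + n + 10 + 3*T by omega)
      exact hG.mul _ _ _ (hG.le (Nat.zero_le _) hθG) (hZ z hz).2
    · rw [abs_mul, abs_mul, abs_of_pos hθ]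
      calc θ * (|w| * |z|) ≤ θ * (4 * B * (6 * B)) := by
            apply mul_le_mul_of_nonneg_left _ hθ.le
            exact mul_le_mul hwup (hZ z hz).1 (abs_nonneg _) (by linarith)
        _ = (24 * (B * θ)) * B := by ring
        _ ≤ 1 * B := mul_le_mul_of_nonneg_right (by linarith) (by linarith)
        _ = B := one_mul B
  · intro x hx y hy hxy
    rw [Finset.mem_image] at hx hy
    obtain ⟨z, hz, rfl⟩ := hx
    obtain ⟨z', hz', rfl⟩ := hy
    have hzz : z ≠ z' := by rintro rfl; exact hxy rfl
    rw [hinj, show (n+1)*T + p + 1 = 1 + p + (n+1)*T by ring, pow_add, pow_add, pow_one]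
    apply mul_le_mul _ (hZs z hz z' hz' hzz) (pow_pos hθ _).le (by positivity)
    exact mul_le_mul_of_nonneg_left hwlow hθ.le
  · rw [Finset.card_image_of_injective, hZc, hXc]
    intro x y hxy
    simp only at hxy
    have := hinj x y
    rw [hxy, sub_self, abs_zero] at this
    by_contra hne
    have h3 : 0 < |x - y| := abs_pos.mpr (sub_ne_zero.mpr hne)
    have : 0 < θ * |w| * |x - y| := by positivity
    linarith
end

section
open MeasureTheory Set Real

lemma sep_card_le (Y : Finset ℝ) (σ B : ℝ) (hσ : 0 < σ) (hB : 0 ≤ B) (hs : SepBy Y σ)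
    (hY : ∀ y ∈ Y, |y| ≤ B) : (Y.card : ℝ) ≤ 2 * B / σ + 1 := by
  have h1 : Y.card ≤ (Finset.Icc (0:ℤ) ⌊2 * B / σ⌋).card := by
    apply Finset.card_le_card_of_injOn (fun y => ⌊(y + B) / σ⌋)
    · intro y hy
      have := abs_le.mp (hY y hy)
      rw [Finset.mem_coe, Finset.mem_Icc]
      constructor
      · apply Int.floor_nonneg.mpr
        apply div_nonneg _ hσ.le
        linarith
      · apply Int.floor_le_floor
        apply div_le_div_of_nonneg_right _ hσ.le
        linarith
    · intro x hx y hy hxy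
      by_contra hne
      have h := hs x hx y hy hne
      have h2 := Int.abs_sub_lt_one_of_floor_eq_floor hxy
      rw [← sub_div, abs_div, abs_of_pos hσ, div_lt_one hσ] at h2
      have : x + B - (y + B) = x - y := by ring
      rw [this] at h2
      linarith
  rw [Int.card_Icc] at h1
  have h0 : 0 ≤ ⌊2 * B / σ⌋ := Int.floor_nonneg.mpr (by positivity)
  have h2 : ((⌊2 * B / σ⌋ + 1 - 0).toNat : ℝ) ≤ 2 * B / σ + 1 := by
    have : (((⌊2 * B / σ⌋ + 1 - 0).toNat : ℤ) : ℝ) = ((⌊2 * B / σ⌋ + 1 : ℤ) : ℝ) := by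
      rw [Int.toNat_of_nonneg (by omega)]; simp
    have h3 := Int.floor_le (2 * B / σ)
    push_cast at this
    rw [this]
    linarith
  calc (Y.card : ℝ) ≤ _ := by exact_mod_cast h1
    _ ≤ _ := h2

structure RHyp (G : ℕ → Set ℝ) (θ B δ : ℝ) (P : ℕ) : Prop where
  rf : RF G
  mem : θ ∈ G 0
  pos : 0 < θ
  one_le : 1 ≤ B
  small : 64 * B * θ ≤ 1
  sets : ∀ p : ℕ, 1 ≤ p → p ≤ P → ∃ Y : Finset ℝ, (∀ y ∈ Y, y ∈ G 0 ∧ |y| ≤ B) ∧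
    SepBy Y (θ^p) ∧ Real.exp (δ * p * (-Real.log θ)) ≤ Y.card

lemma RHyp.mono {G : ℕ → Set ℝ} {θ B δ : ℝ} {P P' : ℕ} (h : RHyp G θ B δ P) (hP : P' ≤ P) :
    RHyp G θ B δ P' :=
  ⟨h.rf, h.mem, h.pos, h.one_le, h.small, fun p h1 h2 => h.sets p h1 (h2.trans hP)⟩

lemma Dens.mono {G : ℕ → Set ℝ} (hG : RF G) {θ : ℝ} {A p m m' : ℕ} (h : Dens G θ A p m)
    (hm : m ≤ m') : Dens G θ A p m' := by
  intro t ht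
  obtain ⟨z1, h1, z2, h2, h3⟩ := h t ht
  exact ⟨z1, hG.le hm h1, z2, hG.le hm h2, h3⟩

def Ach (δ : ℝ) (A : ℕ) (σ : ℝ) : Prop :=
  ∀ p0 : ℕ, ∃ p ≥ p0, ∃ M : ℕ, ∀ (G : ℕ → Set ℝ) (θ B : ℝ), RHyp G θ B δ M →
    (∃ p', 1 ≤ p' ∧ p' ≤ M ∧ Dens G θ A p' M) ∨
    ∃ Y : Finset ℝ, (∀ y ∈ Y, y ∈ G M ∧ |y| ≤ B) ∧ SepBy Y (θ^(p*(A+1))) ∧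
      Real.exp (σ * (p*(A+1)) * (-Real.log θ)) ≤ Y.card

lemma ach_zero (δ : ℝ) (A : ℕ) : Ach δ A 0 := by
  intro p0
  refine ⟨p0, le_rfl, 1, fun G θ B h => Or.inr ⟨{0}, ?_, ?_, by simp⟩⟩
  · intro y hy
    rw [Finset.mem_singleton] at hy
    subst hy
    have := h.rf.sub 0 1 1 h.rf.one h.rf.one
    rw [sub_self] at this
    exact ⟨this, by simpa using (by linarith [h.one_le] : (0:ℝ) ≤ B)⟩
  · intro x hx y hy hxy
    rw [Finset.mem_singleton] at hx hy
    exact absurd (hx.trans hy.symm) hxy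

lemma RHyp.log_ge {G : ℕ → Set ℝ} {θ B δ : ℝ} {P : ℕ} (h : RHyp G θ B δ P) :
    1 ≤ -Real.log θ := by
  have h1 := h.one_le
  have h2 := h.small
  have h3 := h.pos
  have h64 : θ ≤ 1/64 := by nlinarith
  have h4 : θ ≤ Real.exp (-1) := by
    have := Real.exp_one_lt_d9
    rw [Real.exp_neg, ← one_div]
    calc θ ≤ 1/64 := h64
      _ ≤ 1 / Real.exp 1 := one_div_le_one_div_of_le (Real.exp_pos _) (by linarith)
  have := Real.log_le_log h3 h4
  rw [Real.log_exp] at this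
  linarith

lemma RHyp.le_one {G : ℕ → Set ℝ} {θ B δ : ℝ} {P : ℕ} (h : RHyp G θ B δ P) : θ ≤ 1 := by
  have h1 := h.one_le
  have h2 := h.small
  have h3 := h.pos
  nlinarith

lemma ach_succ (δ : ℝ) (hδ : 0 < δ) (A : ℕ) (σ : ℝ) (hσ : 0 ≤ σ) (h : Ach δ A σ) :
    Ach δ A (σ + δ / (2 * (A+1))) := by
  intro p0
  set σ' := σ + δ / (2 * (A+1)) with hσ'
  have hσ'0 : 0 ≤ σ' := by positivity
  obtain ⟨p1, hp1⟩ := exists_nat_ge ((4 * σ' + 1) / δ)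
  obtain ⟨p, hp, M, hM⟩ := h (p1 + 1)
  have hp' : 4 * σ' + 1 ≤ δ * p := by
    have : (p1:ℝ) ≤ p := by exact_mod_cast (by omega : p1 ≤ p)
    rw [div_le_iff₀ hδ] at hp1
    nlinarith
  set n := p * (A+1) with hn
  set T := p + 2 + A + p0 * (A+1) with hT
  set n' := (n+1)*T + p + 1 with hn'
  set p' := n' / (A+1) + 1 with hp'd
  have hp'1 : n' ≤ p' * (A+1) := by
    have := Nat.div_add_mod n' (A+1)
    have := Nat.mod_lt n' (Nat.succ_pos A)
    simp only [Nat.succ_eq_add_one] at this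
    rw [hp'd]; nlinarith
  have hp'2 : p' * (A+1) ≤ n' + A + 1 := by
    have := Nat.div_mul_le_self n' (A+1)
    rw [hp'd]; nlinarith
  have hp'0 : p0 ≤ p' := by
    have h1 : p0 * (A+1) ≤ n' := by
      rw [hn', hT]; nlinarith
    have := (Nat.le_div_iff_mul_le (Nat.succ_pos A)).mpr h1
    simp only [Nat.succ_eq_add_one] at this
    omega
  refine ⟨p', hp'0, M + n + 10 + 3 * T + p', ?_⟩
  intro G θ B hyp
  have hpn : p ≤ n := by rw [hn]; nlinarith
  rcases hM G θ B (hyp.mono (by omega)) with ⟨q, hq1, hq2, hq3⟩ | ⟨Y1, hY1, hs1, hc1⟩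
  · exact Or.inl ⟨q, hq1, by omega, hq3.mono hyp.rf (by omega)⟩
  by_cases hD : Dens G θ A p (M+1)
  · exact Or.inl ⟨p, by omega, by omega, hD.mono hyp.rf (by omega)⟩
  right
  obtain ⟨Y2, hY2, hs2, hc2⟩ := hyp.sets p (by omega) (by omega)
  have hlog := hyp.log_ge
  set Λ := -Real.log θ with hΛ
  have hc2' : 2 ≤ Y2.card := by
    have h1 : (2:ℝ) ≤ Real.exp (δ * p * Λ) := by
      have := Real.add_one_le_exp (δ * p * Λ)
      nlinarith
    exact_mod_cast h1.trans hc2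
  have hne : Y1.Nonempty := by
    rw [← Finset.card_pos]
    have := (Real.exp_pos _).trans_le hc1
    exact_mod_cast this
  obtain ⟨Z, hZ, hZs, hZc⟩ := ring_step hyp.rf hyp.mem hyp.pos hyp.one_le hyp.small A p M Y1 Y2
    hY1 hY2 hs1 hs2 hne hc2' hD T
  refine ⟨Z, ?_, ?_, ?_⟩
  · intro y hy
    exact ⟨hyp.rf.le (by omega) (hZ y hy).1, (hZ y hy).2⟩
  · intro x hx y hy hxy
    exact (pow_le_pow_of_le_one hyp.pos.le hyp.le_one hp'1).trans (hZs x hx y hy hxy)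
  · rw [hZc]
    push_cast
    have h1 : Real.exp (σ * (p*(A+1)) * Λ) * Real.exp (δ * p * Λ) ≤ (Y1.card:ℝ) * Y2.card :=
      mul_le_mul hc1 hc2 (Real.exp_pos _).le (by positivity)
    rw [← Real.exp_add] at h1
    have h2 := pow_le_pow_left₀ (Real.exp_pos _).le h1 T
    rw [← Real.exp_nat_mul] at h2
    refine le_trans (Real.exp_le_exp.mpr ?_) h2
    have e1 : (p':ℝ) * (A+1) ≤ n' + A + 1 := by exact_mod_cast hp'2
    have e2 : (n':ℝ) = (p * (A+1) + 1) * T + p + 1 := by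
      rw [hn', hn]; push_cast; ring
    have e3 : (p:ℝ) + 2 + A ≤ T := by
      have : p + 2 + A ≤ T := by rw [hT]; omega
      exact_mod_cast this
    have e4 : σ' * (p * (A+1)) = σ * (p*(A+1)) + δ * p / 2 := by
      rw [hσ']; field_simp
    have e5 : σ' * (p' * (A+1)) ≤ T * (σ * (p*(A+1)) + δ * p) := by
      calc σ' * (p' * (A+1)) ≤ σ' * (n' + A + 1) := mul_le_mul_of_nonneg_left e1 hσ'0
        _ = (σ' * (p * (A+1))) * T + σ' * (T + (p + 2 + A)) := by rw [e2]; ring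
        _ ≤ (σ' * (p * (A+1))) * T + σ' * (T + T) := by gcongr
        _ = T * (σ * (p*(A+1)) + δ * p / 2 + 2 * σ') := by rw [e4]; ring
        _ ≤ _ := by
          apply mul_le_mul_of_nonneg_left _ (by positivity)
          linarith
    calc σ' * (p' * (A+1)) * Λ ≤ T * (σ * (p*(A+1)) + δ * p) * Λ :=
          mul_le_mul_of_nonneg_right e5 (by linarith)
      _ = _ := by ring

theorem ring_dense (δ : ℝ) (hδ : 0 < δ) (A : ℕ) : ∃ M : ℕ, ∀ (G : ℕ → Set ℝ) (θ B : ℝ),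
    RHyp G θ B δ M → ∃ p', 1 ≤ p' ∧ p' ≤ M ∧ Dens G θ A p' M := by
  have hall : ∀ j : ℕ, Ach δ A (j * (δ / (2 * (A+1)))) := by
    intro j
    induction j with
    | zero => simpa using ach_zero δ A
    | succ j ih =>
      have := ach_succ δ hδ A _ (by positivity) ih
      push_cast
      rw [add_mul, one_mul]
      exact this
  have hpos : 0 < δ / (2 * (A+1)) := by positivity
  obtain ⟨j, hj⟩ := exists_nat_ge (2 / (δ / (2 * (A+1))))
  rw [div_le_iff₀ hpos] at hj
  obtain ⟨p, hp, M, hM⟩ := hall j 1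
  refine ⟨M, fun G θ B hyp => ?_⟩
  rcases hM G θ B hyp with h | ⟨Y, hY, hs, hc⟩
  · exact h
  exfalso
  have hB := hyp.one_le
  have hθ := hyp.pos
  have hlog := hyp.log_ge
  have h1 := sep_card_le Y _ B (pow_pos hθ _) (by linarith) hs (fun y hy => (hY y hy).2)
  set n := p * (A+1) with hn
  have hn1 : 1 ≤ n := by rw [hn]; nlinarith
  have h2 : Real.exp (2 * n * (-Real.log θ)) ≤ Y.card := by
    refine le_trans (Real.exp_le_exp.mpr ?_) hc
    have e : ((p:ℝ) * (A+1)) = n := by rw [hn]; push_cast; ring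
    rw [e]
    gcongr
  have h3 : Real.exp (2 * n * (-Real.log θ)) = (1/θ^n)^2 := by
    rw [show 2 * (n:ℝ) * (-Real.log θ) = ((2 * n : ℕ) : ℝ) * (-Real.log θ) by push_cast; ring,
      Real.exp_nat_mul, Real.exp_neg, Real.exp_log hθ, mul_comm, pow_mul, inv_pow, one_div]
  rw [h3] at h2
  set u := 1 / θ^n with hu
  have hu1 : 64 * B ≤ u := by
    rw [hu, le_div_iff₀ (pow_pos hθ _)]
    calc 64 * B * θ^n ≤ 64 * B * θ := by
          apply mul_le_mul_of_nonneg_left _ (by linarith)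
          calc θ^n ≤ θ^1 := pow_le_pow_of_le_one hθ.le hyp.le_one hn1
            _ = θ := pow_one θ
      _ ≤ 1 := hyp.small
  have h4 : 2 * B / θ^n = 2 * B * u := by rw [hu]; ring
  rw [h4] at h1
  nlinarith

/-- Strong density: iterate `Dens`. -/
lemma dens_iter {G : ℕ → Set ℝ} (hG : RF G) {θ : ℝ} (hθG : θ ∈ G 0) (hθ : 0 < θ)
    {A p M : ℕ} (hD : Dens G θ A p M) (m : ℕ) :
    ∀ t ∈ Icc (-1:ℝ) 1, ∃ z1 ∈ G (M + p*A + 2 + 4*m), ∃ z2 ∈ G (M + p*A + 2 + 4*m),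
      θ^(p*m) ≤ |z2| ∧ |t * z2 - z1| ≤ θ^(p*A*m) * |z2| := by
  have hD' : ∀ t ∈ Icc (-1:ℝ) 1, ∃ z1 ∈ G (M+2), ∃ z2 ∈ G (M+2), θ^p ≤ |z2| ∧
      |t * z2 - z1| ≤ θ^(p*A) * |z2| := by
    intro t ht
    by_cases h0 : 0 ≤ t
    · obtain ⟨z1, h1, z2, h2, h3⟩ := hD t ⟨h0, ht.2⟩
      exact ⟨z1, hG.le (by omega) h1, z2, hG.le (by omega) h2, h3⟩
    · obtain ⟨z1, h1, z2, h2, h3, h4⟩ := hD (-t) ⟨by linarith, by linarith [ht.1]⟩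
      refine ⟨z1, hG.le (by omega) h1, 0 - z2, ?_, ?_, ?_⟩
      · have hz : (0:ℝ) ∈ G (M+1) := by
          have := hG.sub M _ _ h1 h1
          rwa [sub_self] at this
        exact hG.sub _ _ _ hz (hG.mono _ h2)
      · rwa [zero_sub, abs_neg]
      · rw [zero_sub, abs_neg]
        rw [show t * -z2 - z1 = -t * z2 - z1 by ring]
        exact h4
  induction m with
  | zero =>
    intro t ht
    have h1 : (1:ℝ) ∈ G (M + p*A + 2 + 4*0) := hG.le (Nat.zero_le _) hG.one
    have h0 : (0:ℝ) ∈ G (M + p*A + 2 + 4*0) := by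
      have := hG.sub 0 _ _ hG.one hG.one
      rw [sub_self] at this
      exact hG.le (by omega) this
    refine ⟨0, h0, 1, h1, by simp, ?_⟩
    simp
    exact abs_le.mpr ⟨ht.1, ht.2⟩
  | succ m ih =>
    intro t ht
    obtain ⟨w1, hw1, w2, hw2, hw3, hw4⟩ := hD' t ht
    set s := θ^(p*A) with hs
    have hs0 : 0 < s := pow_pos hθ _
    have hw2p : 0 < |w2| := (pow_pos hθ _).trans_le hw3
    have hw2n : w2 ≠ 0 := abs_pos.mp hw2p
    set t' := (t * w2 - w1) / (s * w2) with ht'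
    have ht1 : |t'| ≤ 1 := by
      rw [ht', abs_div, abs_mul, abs_of_pos hs0]
      exact div_le_one_of_le₀ hw4 (by positivity)
    obtain ⟨z1, hz1, z2, hz2, hz3, hz4⟩ := ih t' (abs_le.mp ht1)
    set K := M + p*A + 2 + 4*m with hK
    have up : ∀ {x}, x ∈ G (M+2) → x ∈ G K := fun h => hG.le (by omega) h
    have hsG : s ∈ G K := hG.le (by omega) (hG.pow hθG (p*A))
    refine ⟨w1 * z2 + s * z1 * w2, ?_, w2 * z2, ?_, ?_, ?_⟩
    · apply hG.le (show K + 1 + 1 + 1 ≤ M + p*A + 2 + 4*(m+1) by omega)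
      apply hG.add
      · exact hG.mono _ (hG.mul _ _ _ (up hw1) hz2)
      · exact hG.mul _ _ _ (hG.mul _ _ _ hsG hz1) (hG.mono _ (up hw2))
    · apply hG.le (show K + 1 ≤ M + p*A + 2 + 4*(m+1) by omega)
      exact hG.mul _ _ _ (up hw2) hz2
    · rw [abs_mul, show p * (m+1) = p + p * m by ring, pow_add]
      exact mul_le_mul hw3 hz3 (pow_pos hθ _).le (abs_nonneg _)
    · have e : t * (w2 * z2) - (w1 * z2 + s * z1 * w2) = s * w2 * (t' * z2 - z1) := by
        rw [ht']; field_simp; ring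
      rw [e, abs_mul, abs_mul, abs_of_pos hs0, abs_mul, show p * A * (m+1) = p*A + p * A * m by ring,
        pow_add, ← hs]
      calc s * |w2| * |t' * z2 - z1| ≤ s * |w2| * (θ^(p*A*m) * |z2|) :=
            mul_le_mul_of_nonneg_left hz4 (by positivity)
        _ = _ := by ring
end

section
open MeasureTheory Set Real
open scoped Pointwise

/-! ## Part II : covering lemmas -/

lemma plr (A : Finset ℤ) (hA : A.Nonempty) (K : ℝ) (hK : ((A - A).card : ℝ) ≤ K * A.card) (m n : ℕ) :
    ((m • A - n • A).card : ℝ) ≤ K^(m+n) * A.card := by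
  have h := Finset.pluennecke_ruzsa_inequality_nsmul_sub_nsmul_sub hA A m n
  have h' : (((m • A - n • A).card : ℚ≥0) : ℝ) ≤ (((((A-A).card / A.card : ℚ≥0))^(m+n) * A.card : ℚ≥0) : ℝ) := by
    exact_mod_cast h
  push_cast at h'
  refine h'.trans ?_
  have hpos : (0:ℝ) < A.card := by exact_mod_cast hA.card_pos
  gcongr
  rw [div_le_iff₀ hpos]
  exact hK

lemma plr_cover4 (A : Finset ℤ) (hA : A.Nonempty) (K : ℝ) (hK : ((A - A).card : ℝ) ≤ K * A.card) :
    ∃ X : Finset ℤ, (X.card : ℝ) ≤ K^9 ∧ ∀ e1 ∈ A - A, ∀ e2 ∈ A - A, ∀ e3 ∈ A - A, ∀ e4 ∈ A - A,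
      ∃ x ∈ X, ∃ e ∈ A - A, e1 + e2 + e3 + e4 = x + e := by
  have e : 4 • A - 4 • A + A = 5 • A - 4 • A := by
    rw [sub_add_eq_add_sub, ← succ_nsmul]
  have h := plr A hA K hK 5 4
  rw [← e] at h
  obtain ⟨F, hF, hFc, hFA⟩ := Finset.ruzsa_covering_add (A := 4 • A - 4 • A) hA h
  refine ⟨F, hFc, ?_⟩
  intro e1 h1 e2 h2 e3 h3 e4 h4
  have : e1 + e2 + e3 + e4 ∈ 4 • A - 4 • A := by
    rw [Finset.mem_sub] at h1 h2 h3 h4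
    obtain ⟨a1, ha1, b1, hb1, rfl⟩ := h1
    obtain ⟨a2, ha2, b2, hb2, rfl⟩ := h2
    obtain ⟨a3, ha3, b3, hb3, rfl⟩ := h3
    obtain ⟨a4, ha4, b4, hb4, rfl⟩ := h4
    rw [Finset.mem_sub]
    refine ⟨a1 + a2 + a3 + a4, ?_, b1 + b2 + b3 + b4, ?_, by ring⟩
    · rw [show 4 • A = A + A + A + A by rw [succ_nsmul, succ_nsmul, two_nsmul]]
      exact Finset.add_mem_add (Finset.add_mem_add (Finset.add_mem_add ha1 ha2) ha3) ha4
    · rw [show 4 • A = A + A + A + A by rw [succ_nsmul, succ_nsmul, two_nsmul]]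
      exact Finset.add_mem_add (Finset.add_mem_add (Finset.add_mem_add hb1 hb2) hb3) hb4
  obtain ⟨x, hx, e, he, h⟩ := Finset.mem_add.mp (hFA this)
  exact ⟨x, hx, e, he, h.symm⟩

lemma plr_cover_sub (A B : Finset ℤ) (hBA : B ⊆ A) (hB : B.Nonempty) (K : ℝ)
    (hK : ((A - A).card : ℝ) ≤ K * A.card) (hBc : (A.card : ℝ) ≤ K * B.card) :
    ∃ X : Finset ℤ, (X.card : ℝ) ≤ K^3 ∧ ∀ a ∈ A, ∃ x ∈ X, ∃ b ∈ B, ∃ b' ∈ B, a = x + (b - b') := by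
  have hA : A.Nonempty := hB.mono hBA
  have hK0 : 0 ≤ K := by
    by_contra h
    push Not at h
    have : (0:ℝ) < A.card := by exact_mod_cast hA.card_pos
    have h2 : (0:ℝ) ≤ (A-A).card := by positivity
    nlinarith
  have h := plr A hA K hK 2 0
  rw [zero_nsmul, sub_zero, two_nsmul] at h
  have h2 : ((A + B).card : ℝ) ≤ K^3 * B.card := by
    calc ((A + B).card : ℝ) ≤ (A + A).card := by
          exact_mod_cast Finset.card_le_card (Finset.add_subset_add_left hBA)
      _ ≤ K^2 * A.card := h
      _ ≤ K^2 * (K * B.card) := by gcongr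
      _ = _ := by ring
  obtain ⟨F, hF, hFc, hFA⟩ := Finset.ruzsa_covering_add hB h2
  refine ⟨F, hFc, fun a ha => ?_⟩
  obtain ⟨x, hx, e, he, h⟩ := Finset.mem_add.mp (hFA ha)
  obtain ⟨b, hb, b', hb', h'⟩ := Finset.mem_sub.mp he
  exact ⟨x, hx, b, hb, b', hb', by rw [h', h]⟩

lemma plr_cover_U (A U : Finset ℤ) (hA : A.Nonempty) (hU : U.Nonempty) (K : ℝ)
    (hK : ((A - A).card : ℝ) ≤ K * A.card) (hUE : U ⊆ (A - A) + (A - A)) :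
    ∃ X : Finset ℤ, (X.card : ℝ) * U.card ≤ K^5 * A.card ∧
      ∀ a ∈ A, ∃ x ∈ X, ∃ b ∈ U, ∃ b' ∈ U, a = x + (b - b') := by
  have h := plr A hA K hK 3 2
  have e : A + ((A - A) + (A - A)) = 3 • A - 2 • A := by
    rw [succ_nsmul, two_nsmul]
    rw [sub_add_sub_comm, add_sub_assoc', add_comm A]
  have hpos : (0:ℝ) < U.card := by exact_mod_cast hU.card_pos
  have h2 : ((A + U).card : ℝ) ≤ (K^5 * A.card / U.card) * U.card := by
    rw [div_mul_cancel₀ _ hpos.ne']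
    refine le_trans ?_ h
    rw [← e]
    exact_mod_cast Finset.card_le_card (Finset.add_subset_add_left hUE)
  obtain ⟨F, hF, hFc, hFA⟩ := Finset.ruzsa_covering_add hU h2
  refine ⟨F, ?_, fun a ha => ?_⟩
  · rwa [le_div_iff₀ hpos] at hFc
  obtain ⟨x, hx, e, he, h⟩ := Finset.mem_add.mp (hFA ha)
  obtain ⟨b, hb, b', hb', h'⟩ := Finset.mem_sub.mp he
  exact ⟨x, hx, b, hb, b', hb', by rw [h', h]⟩

/-- `V` is covered by at most `K` translates of `H`. -/
def CovS (V H : Set ℝ) (K : ℝ) : Prop :=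
  ∃ T : Finset ℝ, (T.card : ℝ) ≤ K ∧ ∀ v ∈ V, ∃ t ∈ T, v - t ∈ H

lemma CovS.mono {V H : Set ℝ} {K K' : ℝ} (h : CovS V H K) (hK : K ≤ K') : CovS V H K' := by
  obtain ⟨T, h1, h2⟩ := h
  exact ⟨T, h1.trans hK, h2⟩

lemma cov_of_label {ι : Type} (V H : Set ℝ) (F : Finset ι) (Rel : ℝ → ι → Prop)
    (h1 : ∀ v ∈ V, ∃ l ∈ F, Rel v l) 
    (h2 : ∀ v ∈ V, ∀ v' ∈ V, ∀ l ∈ F, Rel v l → Rel v' l → v - v' ∈ H) :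
    CovS V H F.card := by
  classical
  refine ⟨F.image (fun l => if h : ∃ v ∈ V, Rel v l then h.choose else 0), ?_, ?_⟩
  · exact_mod_cast Finset.card_image_le
  · intro v hv
    obtain ⟨l, hl, hr⟩ := h1 v hv
    have hex : ∃ v ∈ V, Rel v l := ⟨v, hv, hr⟩
    refine ⟨_, Finset.mem_image_of_mem _ hl, ?_⟩
    rw [dif_pos hex]
    exact h2 v hv _ hex.choose_spec.1 l hl hr hex.choose_spec.2

def goodG (H : Set ℝ) (K : ℝ) (m : ℕ) : Set ℝ := {z | CovS ((fun h => z * h) '' H) H (K^(3^m))}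

lemma goodG_mem {H : Set ℝ} {K : ℝ} {m : ℕ} {z : ℝ} : z ∈ goodG H K m ↔
    ∃ T : Finset ℝ, (T.card : ℝ) ≤ K^(3^m) ∧ ∀ v ∈ H, ∃ t ∈ T, z * v - t ∈ H := by
  unfold goodG CovS
  simp

lemma goodG_rf (H : Set ℝ) (K : ℝ) (hK : 1 ≤ K) (hsymm : ∀ h ∈ H, -h ∈ H)
    (hadd : ∃ X : Finset ℝ, (X.card : ℝ) ≤ K ∧ ∀ h ∈ H, ∀ h' ∈ H, ∃ x ∈ X, h + h' - x ∈ H) :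
    RF (goodG H K) := by
  classical
  obtain ⟨X, hXc, hX⟩ := hadd
  have hK3 : ∀ m : ℕ, K^(3^m) * K^(3^m) * K ≤ K^(3^(m+1)) := by
    intro m
    have : K ≤ K^(3^m) := by
      calc K = K^1 := (pow_one K).symm
        _ ≤ _ := pow_le_pow_right₀ hK (Nat.one_le_pow _ _ (by norm_num))
    calc K^(3^m) * K^(3^m) * K ≤ K^(3^m) * K^(3^m) * K^(3^m) := by gcongr
      _ = _ := by rw [← pow_add, ← pow_add]; ring_nf
  have hone : ∀ m : ℕ, 1 ≤ K^(3^m) := fun m => one_le_pow₀ hK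
  have key : ∀ m a b, a ∈ goodG H K m → (∃ T : Finset ℝ, (T.card : ℝ) ≤ K^(3^m) ∧ ∀ v ∈ H, ∃ t ∈ T, b * v - t ∈ H) → a + b ∈ goodG H K (m+1) := by
    intro m a b ha hb
    rw [goodG_mem] at ha
    obtain ⟨T, hT, hTH⟩ := ha
    obtain ⟨S, hS, hSH⟩ := hb
    rw [goodG_mem]
    refine ⟨(T ×ˢ S ×ˢ X).image (fun u => u.1 + u.2.1 + u.2.2), ?_, ?_⟩
    · calc (((T ×ˢ S ×ˢ X).image (fun u => u.1 + u.2.1 + u.2.2)).card : ℝ) ≤ (T ×ˢ S ×ˢ X).card := by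
            exact_mod_cast Finset.card_image_le
        _ = T.card * (S.card * X.card) := by rw [Finset.card_product, Finset.card_product]; push_cast; ring
        _ ≤ K^(3^m) * (K^(3^m) * K) := by gcongr
        _ ≤ _ := by rw [← mul_assoc]; exact hK3 m
    · intro v hv
      obtain ⟨t, ht, h1⟩ := hTH v hv
      obtain ⟨s, hs, h2⟩ := hSH v hv
      obtain ⟨x, hx, h3⟩ := hX _ h1 _ h2
      refine ⟨t + s + x, Finset.mem_image.mpr ⟨(t,s,x), by simp [ht,hs,hx], rfl⟩, ?_⟩
      convert h3 using 1
      ring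
  refine ⟨?_, ?_, ?_, ?_, ?_⟩
  · intro m z hz
    rw [goodG_mem] at hz ⊢
    obtain ⟨T, hT, hTH⟩ := hz
    refine ⟨T, hT.trans ?_, hTH⟩
    exact pow_le_pow_right₀ hK (Nat.pow_le_pow_right (by norm_num) (by omega))
  · intro m a b ha hb
    exact key m a b ha (goodG_mem.mp hb)
  · intro m a b ha hb
    rw [sub_eq_add_neg]
    apply key m a (-b) ha
    obtain ⟨T, hT, hTH⟩ := goodG_mem.mp hb
    refine ⟨T.image (fun t => -t), ?_, ?_⟩
    · refine le_trans ?_ hT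
      exact_mod_cast Finset.card_image_le
    · intro v hv
      obtain ⟨t, ht, h⟩ := hTH v hv
      refine ⟨-t, Finset.mem_image_of_mem _ ht, ?_⟩
      have := hsymm _ h
      convert this using 1
      ring
  · intro m a b ha hb
    obtain ⟨T, hT, hTH⟩ := goodG_mem.mp ha
    obtain ⟨S, hS, hSH⟩ := goodG_mem.mp hb
    rw [goodG_mem]
    refine ⟨(T ×ˢ S).image (fun u => a * u.2 + u.1), ?_, ?_⟩
    · calc (((T ×ˢ S).image (fun u => a * u.2 + u.1)).card : ℝ) ≤ (T ×ˢ S).card := by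
            exact_mod_cast Finset.card_image_le
        _ = T.card * S.card * 1 := by rw [Finset.card_product]; push_cast; ring
        _ ≤ K^(3^m) * K^(3^m) * K := by
            have := hone m
            gcongr
        _ ≤ _ := hK3 m
    · intro v hv
      obtain ⟨s, hs, h2⟩ := hSH v hv
      obtain ⟨t, ht, h1⟩ := hTH _ h2
      refine ⟨a * s + t, Finset.mem_image.mpr ⟨(t,s), by simp [ht,hs], rfl⟩, ?_⟩
      convert h1 using 1
      ring
  · rw [goodG_mem]
    refine ⟨{0}, by simpa using hK, ?_⟩
    intro v hv
    exact ⟨0, by simp, by simpa using hv⟩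

/-- The doubled set cut to an interval. -/
def FR (A : Finset ℤ) (R : ℕ) : Finset ℤ := ((A - A) + (A - A)).filter (fun e => |e| ≤ (R:ℤ))

def HR (A : Finset ℤ) (R : ℕ) : Set ℝ := {x | ∃ e ∈ FR A R, |x - (e:ℝ)| ≤ 1}

lemma FR_mem {A : Finset ℤ} {R : ℕ} {e : ℤ} : e ∈ FR A R ↔
    (∃ e1 ∈ A - A, ∃ e2 ∈ A - A, e = e1 + e2) ∧ |e| ≤ (R:ℤ) := by
  unfold FR
  rw [Finset.mem_filter, Finset.mem_add]
  constructor
  · rintro ⟨⟨a, ha, b, hb, h⟩, h2⟩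
    exact ⟨⟨a, ha, b, hb, h.symm⟩, h2⟩
  · rintro ⟨⟨a, ha, b, hb, h⟩, h2⟩
    exact ⟨⟨a, ha, b, hb, h.symm⟩, h2⟩

lemma neg_mem_E {A : Finset ℤ} {e : ℤ} (h : e ∈ A - A) : -e ∈ A - A := by
  obtain ⟨a, ha, b, hb, h⟩ := Finset.mem_sub.mp h
  exact Finset.mem_sub.mpr ⟨b, hb, a, ha, by omega⟩

lemma FR_neg {A : Finset ℤ} {R : ℕ} {e : ℤ} (h : e ∈ FR A R) : -e ∈ FR A R := by
  rw [FR_mem] at h ⊢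
  obtain ⟨⟨a, ha, b, hb, h⟩, h2⟩ := h
  exact ⟨⟨-a, neg_mem_E ha, -b, neg_mem_E hb, by omega⟩, by rwa [abs_neg]⟩

lemma HR_neg {A : Finset ℤ} {R : ℕ} (h : ℝ) (hh : h ∈ HR A R) : -h ∈ HR A R := by
  obtain ⟨e, he, h1⟩ := hh
  refine ⟨-e, FR_neg he, ?_⟩
  push_cast
  rw [show -h - -(e:ℝ) = -(h - e) by ring, abs_neg]
  exact h1

lemma L1 (A : Finset ℤ) (R : ℕ) (hR : 1 ≤ R) (X : Finset ℝ) (m r : ℕ) (V : Set ℝ)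
    (hV : ∀ v ∈ V, |v| ≤ r * R ∧ ∃ x ∈ X, ∃ e ∈ A - A, |v - x - (e:ℝ)| ≤ m) :
    CovS V (HR A R) (X.card * ((2*m+1) * (2*r+1))) := by
  classical
  have hR0 : (0:ℝ) < R := by exact_mod_cast hR
  have h := cov_of_label V (HR A R) (X ×ˢ (Finset.Icc (-m:ℤ) m) ×ˢ (Finset.Icc (-r:ℤ) r))
    (fun v l => ⌊v / R⌋ = l.2.2 ∧ ∃ e ∈ A - A, ⌊v - l.1 - (e:ℝ)⌋ = l.2.1) ?_ ?_
  · refine h.mono (le_of_eq ?_)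
    rw [Finset.card_product, Finset.card_product, Int.card_Icc, Int.card_Icc]
    have e1 : ((m:ℤ) + 1 - -m).toNat = 2*m+1 := by omega
    have e2 : ((r:ℤ) + 1 - -r).toNat = 2*r+1 := by omega
    rw [e1, e2]; push_cast; ring
  · intro v hv
    obtain ⟨h1, x, hx, e, he, h2⟩ := hV v hv
    refine ⟨(x, ⌊v - x - (e:ℝ)⌋, ⌊v / R⌋), ?_, rfl, e, he, rfl⟩
    rw [Finset.mem_product, Finset.mem_product, Finset.mem_Icc, Finset.mem_Icc]
    rw [abs_le] at h1 h2
    refine ⟨hx, ⟨?_, ?_⟩, ?_, ?_⟩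
    · rw [Int.le_floor]; push_cast; exact h2.1
    · have : ((⌊v - x - (e:ℝ)⌋ : ℤ) : ℝ) ≤ m := (Int.floor_le _).trans h2.2
      exact_mod_cast this
    · rw [Int.le_floor, le_div_iff₀ hR0]; push_cast; linarith
    · have : ((⌊v / R⌋ : ℤ) : ℝ) ≤ r := (Int.floor_le _).trans (by rw [div_le_iff₀ hR0]; exact h1.2)
      exact_mod_cast this
  · rintro v hv v' hv' ⟨x, i, j⟩ hl ⟨h1, e, he, h2⟩ ⟨h1', e', he', h2'⟩
    simp only at h1 h2 h1' h2'
    have d1 := Int.abs_sub_lt_one_of_floor_eq_floor (h1.trans h1'.symm)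
    have d2 := Int.abs_sub_lt_one_of_floor_eq_floor (h2.trans h2'.symm)
    rw [← sub_div, abs_div, abs_of_pos hR0, div_lt_one hR0] at d1
    refine ⟨e - e', ?_, ?_⟩
    · rw [FR_mem]
      refine ⟨⟨e, he, -e', neg_mem_E he', by ring⟩, ?_⟩
      have : |((e - e' : ℤ) : ℝ)| < ((R + 1 : ℤ) : ℝ) := by
        push_cast
        rw [abs_lt] at d1 d2 ⊢
        constructor <;> linarith [d1.1, d1.2, d2.1, d2.2]
      have h3 : |e - e'| < (R:ℤ) + 1 := by exact_mod_cast this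
      omega
    · push_cast
      rw [abs_lt] at d2
      rw [abs_le]
      constructor <;> linarith [d2.1, d2.2]
end

section
open MeasureTheory Set Real
open scoped Pointwise

lemma HR_bd {A : Finset ℤ} {R : ℕ} (hR : 1 ≤ R) {h : ℝ} (hh : h ∈ HR A R) : |h| ≤ 2 * R := by
  obtain ⟨e, he, h1⟩ := hh
  have h2 := (FR_mem.mp he).2
  have h3 : |(e:ℝ)| ≤ R := by exact_mod_cast h2
  have h4 : (1:ℝ) ≤ R := by exact_mod_cast hR
  rw [abs_le] at h1 h3 ⊢
  constructor <;> linarith [h1.1, h1.2, h3.1, h3.2]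

lemma HR_add (A : Finset ℤ) (hA : A.Nonempty) (K : ℝ) (hK : ((A - A).card : ℝ) ≤ K * A.card)
    (R : ℕ) (hR : 1 ≤ R) : ∃ X : Finset ℝ, (X.card : ℝ) ≤ 45 * K^9 ∧
      ∀ h ∈ HR A R, ∀ h' ∈ HR A R, ∃ x ∈ X, h + h' - x ∈ HR A R := by
  classical
  obtain ⟨X, hXc, hX⟩ := plr_cover4 A hA K hK
  have hL := L1 A R hR (X.image (fun x : ℤ => (x:ℝ))) 2 4
    {v | ∃ h ∈ HR A R, ∃ h' ∈ HR A R, v = h + h'} ?_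
  · obtain ⟨T, hTc, hT⟩ := hL
    refine ⟨T, ?_, fun h hh h' hh' => hT _ ⟨h, hh, h', hh', rfl⟩⟩
    refine hTc.trans ?_
    have : (((X.image (fun x : ℤ => (x:ℝ))).card : ℝ)) ≤ X.card := by exact_mod_cast Finset.card_image_le
    push_cast
    linarith
  · rintro v ⟨h, hh, h', hh', rfl⟩
    constructor
    · have := HR_bd hR hh
      have := HR_bd hR hh'
      have := abs_add_le h h'
      push_cast
      linarith
    · obtain ⟨e, he, h1⟩ := hh
      obtain ⟨e', he', h1'⟩ := hh'
      obtain ⟨⟨e1, he1, e2, he2, r1⟩, -⟩ := FR_mem.mp he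
      obtain ⟨⟨e3, he3, e4, he4, r2⟩, -⟩ := FR_mem.mp he'
      obtain ⟨x, hx, e0, he0, r3⟩ := hX e1 he1 e2 he2 e3 he3 e4 he4
      refine ⟨x, Finset.mem_image_of_mem _ hx, e0, he0, ?_⟩
      have : (e:ℝ) + e' = x + e0 := by
        have : e + e' = x + e0 := by omega
        exact_mod_cast this
      push_cast
      rw [abs_le] at h1 h1' ⊢
      constructor <;> linarith [h1.1, h1.2, h1'.1, h1'.2]

lemma good_mult (A B : Finset ℤ) (hBA : B ⊆ A) (hB : B.Nonempty) (K : ℝ)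
    (hK : ((A - A).card : ℝ) ≤ K * A.card) (hBc : (A.card : ℝ) ≤ K * B.card)
    (R : ℕ) (hR : 1 ≤ R) (y : ℝ) (C : ℕ) (hC : 1 ≤ C) (hy : |y| ≤ C)
    (hBy : ∀ b ∈ B, ∃ a ∈ A, |y * b - a| ≤ C) :
    CovS ((fun h => y * h) '' (HR A R)) (HR A R) (100 * C^2 * K^21) := by
  classical
  have hA : A.Nonempty := hB.mono hBA
  obtain ⟨X, hXc, hX⟩ := plr_cover4 A hA K hK
  obtain ⟨S, hSc, hS⟩ := plr_cover_sub A B hBA hB K hK hBc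
  have hC' : (1:ℝ) ≤ C := by exact_mod_cast hC
  have hA2 : ∀ a ∈ A, ∃ s ∈ S, ∃ e ∈ A - A, |y * a - y * s - e| ≤ 2 * C := by
    intro a ha
    obtain ⟨s, hs, b, hb, b', hb', r⟩ := hS a ha
    obtain ⟨a1, ha1, h1⟩ := hBy b hb
    obtain ⟨a2, ha2, h2⟩ := hBy b' hb'
    refine ⟨s, hs, a1 - a2, Finset.sub_mem_sub ha1 ha2, ?_⟩
    rw [r]
    push_cast
    rw [abs_le] at h1 h2 ⊢
    constructor <;> linarith [h1.1, h1.2, h2.1, h2.2]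
  set X' : Finset ℝ := ((S ×ˢ S) ×ˢ (S ×ˢ S) ×ˢ X).image
    (fun u => y * (u.1.1 : ℝ) - y * u.1.2 + (y * u.2.1.1 - y * u.2.1.2) + u.2.2) with hX'
  have hX'c : (X'.card : ℝ) ≤ K^21 := by
    calc (X'.card : ℝ) ≤ ((S ×ˢ S) ×ˢ (S ×ˢ S) ×ˢ X).card := by exact_mod_cast Finset.card_image_le
      _ = S.card^4 * X.card := by simp only [Finset.card_product]; push_cast; ring
      _ ≤ (K^3)^4 * K^9 := by gcongr
      _ = _ := by ring
  have h := L1 A R hR X' (9*C) (2*C) ((fun h => y * h) '' (HR A R)) ?_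
  · refine h.mono ?_
    push_cast
    have hk : 0 ≤ K^21 := (Nat.cast_nonneg _).trans hX'c
    calc (X'.card:ℝ) * ((2 * (9 * C) + 1) * (2 * (2 * C) + 1)) ≤ K^21 * ((19 * C) * (5 * C)) := by
          gcongr <;> linarith
      _ ≤ _ := by nlinarith [sq_nonneg (C:ℝ)]
  · rintro v ⟨h, hh, rfl⟩
    constructor
    · have := HR_bd hR hh
      simp only
      rw [abs_mul]
      push_cast
      calc |y| * |h| ≤ C * (2 * R) := by gcongr
        _ = _ := by ring
    · obtain ⟨e, he, h1⟩ := hh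
      obtain ⟨⟨d1, hd1, d2, hd2, r1⟩, -⟩ := FR_mem.mp he
      obtain ⟨a1, ha1, a2, ha2, r2⟩ := Finset.mem_sub.mp hd1
      obtain ⟨a3, ha3, a4, ha4, r3⟩ := Finset.mem_sub.mp hd2
      obtain ⟨s1, hs1, e1, he1, g1⟩ := hA2 a1 ha1
      obtain ⟨s2, hs2, e2, he2, g2⟩ := hA2 a2 ha2
      obtain ⟨s3, hs3, e3, he3, g3⟩ := hA2 a3 ha3
      obtain ⟨s4, hs4, e4, he4, g4⟩ := hA2 a4 ha4
      obtain ⟨x, hx, e0, he0, r4⟩ := hX e1 he1 (-e2) (neg_mem_E he2) e3 he3 (-e4) (neg_mem_E he4)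
      refine ⟨y * s1 - y * s2 + (y * s3 - y * s4) + x, ?_, e0, he0, ?_⟩
      · rw [hX', Finset.mem_image]
        exact ⟨((s1,s2),(s3,s4),x), by simp [hs1,hs2,hs3,hs4,hx], rfl⟩
      · have q1 : (e1:ℝ) + -e2 + e3 + -e4 = x + e0 := by exact_mod_cast r4
        have q2 : (e:ℝ) = (a1 - a2) + (a3 - a4) := by
          have : e = (a1 - a2) + (a3 - a4) := by omega
          exact_mod_cast this
        have q3 : |y * (h - e)| ≤ C := by
          rw [abs_mul]
          calc |y| * |h - e| ≤ C * 1 := by gcongr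
            _ = C := mul_one _
        have q4 : y * h = y * (h - e) + (y * a1 - y * a2 + (y * a3 - y * a4)) := by rw [q2]; ring
        push_cast
        rw [q4]
        rw [abs_le] at g1 g2 g3 g4 q3 ⊢
        constructor <;> linarith [g1.1, g1.2, g2.1, g2.2, g3.1, g3.2, g4.1, g4.2, q3.1, q3.2]

lemma int_card_le (S : Finset ℤ) (w : ℝ) (hw : 0 ≤ w) (h : ∀ x ∈ S, ∀ y ∈ S, |(x:ℝ) - y| ≤ w) :
    (S.card : ℝ) ≤ w + 1 := by
  rcases S.eq_empty_or_nonempty with rfl | hS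
  · simp; linarith
  set a := S.min' hS with ha
  have h1 : S ⊆ Finset.Icc a (a + ⌊w⌋) := by
    intro x hx
    have hax := S.min'_le x hx
    rw [Finset.mem_Icc]
    refine ⟨hax, ?_⟩
    have h2 := h x hx a (S.min'_mem hS)
    have h3 := (abs_le.mp h2).2
    have : x - a ≤ ⌊w⌋ := by
      rw [Int.le_floor]; push_cast; exact h3
    omega
  have h2 := Finset.card_le_card h1
  rw [Int.card_Icc] at h2
  have h0 : 0 ≤ ⌊w⌋ := Int.floor_nonneg.mpr hw
  have h3 : (S.card : ℤ) ≤ ⌊w⌋ + 1 := by omega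
  have h4 : (S.card : ℝ) ≤ (⌊w⌋:ℝ) + 1 := by exact_mod_cast h3
  linarith [Int.floor_le w]

/-- nonconcentration, raw form -/
lemma conc_raw (A : Finset ℤ) (hA : A.Nonempty) (K : ℝ) (hK : ((A - A).card : ℝ) ≤ K * A.card)
    (R r : ℕ) (hr : 1 ≤ r) (x : ℤ) :
    (((FR A R).filter (fun y => |y - x| ≤ (r:ℤ))).card : ℝ) ≤ 15 * K^9 * (FR A r).card := by
  classical
  obtain ⟨X, hXc, hX⟩ := plr_cover4 A hA K hK
  set S := (FR A R).filter (fun y => |y - x| ≤ (r:ℤ)) with hS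
  rcases S.eq_empty_or_nonempty with h | ⟨e0, he0⟩
  · rw [h]; simp
    have : 0 ≤ K^9 := (Nat.cast_nonneg _).trans hXc
    positivity
  have hr0 : (0:ℝ) < r := by exact_mod_cast hr
  obtain ⟨hz1, hz2⟩ := Finset.mem_filter.mp he0
  obtain ⟨⟨z1, hz1, z2, hz2', hz⟩, -⟩ := FR_mem.mp hz1
  -- label
  have hlab : ∀ y ∈ S, ∃ l ∈ X ×ˢ Finset.Icc (-1:ℤ) 1, ∃ e ∈ A - A, y - e0 = l.1 + e ∧ (y - x) / (r:ℤ) = l.2 := by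
    intro y hy
    obtain ⟨h1, h2⟩ := Finset.mem_filter.mp hy
    obtain ⟨⟨d1, hd1, d2, hd2, hd⟩, -⟩ := FR_mem.mp h1
    obtain ⟨x0, hx0, e, he, r4⟩ := hX d1 hd1 d2 hd2 (-z1) (neg_mem_E hz1) (-z2) (neg_mem_E hz2')
    refine ⟨(x0, (y-x)/r), ?_, e, he, by simp only; omega, rfl⟩
    rw [Finset.mem_product, Finset.mem_Icc]
    refine ⟨hx0, ?_, ?_⟩
    · simp only
      rw [Int.le_ediv_iff_mul_le (by exact_mod_cast hr)]
      have := (abs_le.mp h2).1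
      omega
    · simp only
      apply Int.ediv_le_of_le_mul (by exact_mod_cast hr)
      have := (abs_le.mp h2).2
      omega
  choose! l hl e he hle using hlab
  have h1 : S.card ≤ (FR A r).card * (X ×ˢ Finset.Icc (-1:ℤ) 1).card := by
    apply Finset.card_le_mul_card_image_of_maps_to (f := l) (fun y hy => hl y hy)
    intro b hb
    rcases (S.filter (fun y => l y = b)).eq_empty_or_nonempty with h | ⟨y0, hy0⟩
    · rw [h]; simp
    obtain ⟨hy0S, hy0b⟩ := Finset.mem_filter.mp hy0
    apply Finset.card_le_card_of_injOn (fun y => y - y0)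
    · intro y hy
      rw [Finset.mem_coe] at hy
      obtain ⟨hyS, hyb⟩ := Finset.mem_filter.mp hy
      have a1 := hle y hyS
      have a2 := hle y0 hy0S
      rw [hyb] at a1
      rw [hy0b] at a2
      rw [Finset.mem_coe, FR_mem]
      refine ⟨⟨e y, he y hyS, - e y0, neg_mem_E (he y0 hy0S), by simp only; omega⟩, ?_⟩
      have m1 := Int.mul_ediv_add_emod (y - x) r
      have m2 := Int.mul_ediv_add_emod (y0 - x) r
      have n1 := Int.emod_nonneg (y - x) (b := (r:ℤ)) (by omega)
      have n2 := Int.emod_nonneg (y0 - x) (b := (r:ℤ)) (by omega)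
      have l1 := Int.emod_lt_of_pos (y - x) (b := (r:ℤ)) (by omega)
      have l2 := Int.emod_lt_of_pos (y0 - x) (b := (r:ℤ)) (by omega)
      rw [a1.2] at m1
      rw [a2.2] at m2
      simp only
      rw [abs_le]
      constructor <;> omega
    · intro y _ y' _ h
      simp only at h
      omega
  have h2 : ((X ×ˢ Finset.Icc (-1:ℤ) 1).card : ℝ) ≤ K^9 * 3 := by
    rw [Finset.card_product]
    have : (Finset.Icc (-1:ℤ) 1).card = 3 := by simp
    rw [this]; push_cast
    linarith
  calc (S.card : ℝ) ≤ (FR A r).card * (X ×ˢ Finset.Icc (-1:ℤ) 1).card := by exact_mod_cast h1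
    _ ≤ (FR A r).card * (K^9 * 3) := by gcongr
    _ ≤ _ := by
      have : 0 ≤ K^9 := (Nat.cast_nonneg _).trans hXc
      have : 0 ≤ K^9 * (FR A r).card := by positivity
      nlinarith
end

section
open MeasureTheory Set Real
open scoped Pointwise

lemma card_fib {α β : Type} [DecidableEq β] (s : Finset α) (t : Finset β) (f : α → β)
    (hf : ∀ a ∈ s, f a ∈ t) (w : ℝ) (hw : ∀ b ∈ t, ((s.filter (fun a => f a = b)).card : ℝ) ≤ w) :
    (s.card : ℝ) ≤ w * t.card := by
  rw [Finset.card_eq_sum_card_fiberwise (f := f) (t := t) hf]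
  push_cast
  calc ∑ b ∈ t, ((s.filter (fun a => f a = b)).card : ℝ) ≤ ∑ b ∈ t, w := Finset.sum_le_sum hw
    _ = _ := by rw [Finset.sum_const, nsmul_eq_mul, mul_comm]

lemma zero_mem_FR {A : Finset ℤ} (hA : A.Nonempty) (R : ℕ) : (0:ℤ) ∈ FR A R := by
  obtain ⟨a, ha⟩ := hA
  rw [FR_mem]
  refine ⟨⟨0, Finset.mem_sub.mpr ⟨a, ha, a, ha, by ring⟩, 0, Finset.mem_sub.mpr ⟨a, ha, a, ha, by ring⟩, by ring⟩, by simp⟩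

lemma choose_R (A : Finset ℤ) (β : ℝ) (Rmax : ℕ) (hR : 1 ≤ Rmax) :
    ∃ R : ℕ, 1 ≤ R ∧ R ≤ Rmax ∧ ∀ r : ℕ, 1 ≤ r → r ≤ Rmax →
      ((FR A r).card : ℝ) * (R:ℝ)^β ≤ (FR A R).card * (r:ℝ)^β := by
  obtain ⟨R, hRm, hmax⟩ := Finset.exists_max_image (Finset.Icc 1 Rmax)
    (fun r : ℕ => ((FR A r).card : ℝ) / (r:ℝ)^β) ⟨1, by simp [hR]⟩
  rw [Finset.mem_Icc] at hRm
  refine ⟨R, hRm.1, hRm.2, fun r h1 h2 => ?_⟩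
  have := hmax r (Finset.mem_Icc.mpr ⟨h1, h2⟩)
  have p1 : 0 < (r:ℝ)^β := Real.rpow_pos_of_pos (by exact_mod_cast h1) _
  have p2 : 0 < (R:ℝ)^β := Real.rpow_pos_of_pos (by exact_mod_cast hRm.1) _
  rwa [div_le_div_iff₀ p1 p2] at this

lemma FR_upper (A : Finset ℤ) (hA : A.Nonempty) (K : ℝ) (hK : ((A - A).card : ℝ) ≤ K * A.card)
    (R : ℕ) (W : ℝ) (hW : ∀ x : ℤ, ((A.filter (fun a => |a - x| ≤ 2 * (R:ℤ))).card : ℝ) ≤ W) :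
    ((FR A R).card : ℝ) ≤ K^5 * W := by
  classical
  have hU : (FR A R).Nonempty := ⟨0, zero_mem_FR hA R⟩
  obtain ⟨X, hXc, hX⟩ := plr_cover_U A (FR A R) hA hU K hK (Finset.filter_subset _ _)
  choose! f hf b hb b' hb' hab using hX
  have h1 : (A.card : ℝ) ≤ W * X.card := by
    apply card_fib A X f hf
    intro x hx
    refine le_trans ?_ (hW x)
    have : (A.filter (fun a => f a = x)) ⊆ A.filter (fun a => |a - x| ≤ 2 * (R:ℤ)) := by
      intro a ha
      rw [Finset.mem_filter] at ha ⊢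
      refine ⟨ha.1, ?_⟩
      have h1 := abs_le.mp (FR_mem.mp (hb a ha.1)).2
      have h2 := abs_le.mp (FR_mem.mp (hb' a ha.1)).2
      have h3 := hab a ha.1
      rw [abs_le]
      constructor <;> omega
    exact_mod_cast Finset.card_le_card this
  have hA0 : (0:ℝ) < A.card := by exact_mod_cast hA.card_pos
  have hW0 : 0 ≤ W := (Nat.cast_nonneg _).trans (hW 0)
  have : (A.card : ℝ) * (FR A R).card ≤ A.card * (K^5 * W) := by
    calc (A.card : ℝ) * (FR A R).card ≤ W * X.card * (FR A R).card := by gcongr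
      _ = W * (X.card * (FR A R).card) := by ring
      _ ≤ W * (K^5 * A.card) := by gcongr
      _ = _ := by ring
  exact le_of_mul_le_mul_left this hA0

set_option maxHeartbeats 1000000 in
lemma energy_contra (F : Finset ℤ) (hF : F.Nonempty) (Tn D κ : ℝ) (hD : 1 ≤ D) (r : ℕ) (hr : 1 ≤ r)
    (hconc : ∀ x ∈ F, ((F.filter (fun y => |y - x| ≤ (r:ℤ))).card : ℝ) ≤ κ * F.card)
    (hcov : ∀ t ∈ Icc (0:ℝ) 1, ∃ (S : Finset (ℝ × ℤ)) (g : ℤ × ℤ → ℝ × ℤ), (S.card : ℝ) ≤ Tn * F.card ∧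
      (∀ p ∈ F ×ˢ F, g p ∈ S) ∧ ∀ p ∈ F ×ˢ F, ∀ q ∈ F ×ˢ F, g p = g q →
        |((p.1:ℝ) + t * p.2) - (q.1 + t * q.2)| ≤ D) :
    1 ≤ Tn * (3 * F.card * D / r + 3 * D * κ) := by
  classical
  set n : ℝ := (F.card : ℝ) with hn
  have hn0 : 0 < n := by rw [hn]; exact_mod_cast hF.card_pos
  have hr0 : (0:ℝ) < r := by exact_mod_cast hr
  have hr1 : (1:ℝ) ≤ r := by exact_mod_cast hr
  set P := (F ×ˢ F) ×ˢ (F ×ˢ F) with hP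
  have hPc : (P.card : ℝ) = n^4 := by
    rw [hP]; simp only [Finset.card_product]; push_cast; ring
  let q (t : ℝ) : Finset ((ℤ × ℤ) × (ℤ × ℤ)) := P.filter (fun u => |((u.1.1:ℝ) + t * u.1.2) - (u.2.1 + t * u.2.2)| ≤ D)
  let P1 := P.filter (fun u => ¬ |u.2.2 - u.1.2| ≤ (r:ℤ))
  have hTn : 0 ≤ Tn := by
    obtain ⟨S, g, hS, -, -⟩ := hcov 0 ⟨le_rfl, zero_le_one⟩
    have : 0 ≤ Tn * n := (Nat.cast_nonneg _).trans hS
    exact nonneg_of_mul_nonneg_left this hn0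
  -- lower bound
  have hlow : ∀ t ∈ Icc (0:ℝ) 1, n^3 ≤ Tn * (q t).card := by
    intro t ht
    obtain ⟨S, g, hSc, hgS, hg⟩ := hcov t ht
    have h1 : ((F ×ˢ F).card : ℝ) = ∑ s ∈ S, (((F ×ˢ F).filter (fun p => g p = s)).card : ℝ) := by
      rw [Finset.card_eq_sum_card_fiberwise (f := g) (t := S) hgS]; push_cast; rfl
    have h2 := sq_sum_le_card_mul_sum_sq (s := S) (f := fun s => (((F ×ˢ F).filter (fun p => g p = s)).card : ℝ))
    rw [← h1] at h2
    have h3 : ∑ s ∈ S, (((F ×ˢ F).filter (fun p => g p = s)).card : ℝ)^2 ≤ (q t).card := by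
      have : ∀ s ∈ S, (((F ×ˢ F).filter (fun p => g p = s)).card : ℝ)^2 =
          (((q t).filter (fun u => g u.1 = g u.2 ∧ g u.1 = s)).card : ℝ) := by
        intro s hs
        rw [sq]
        norm_cast
        rw [← Finset.card_product]
        congr 1
        ext ⟨a, b⟩
        simp only [q, Finset.mem_product, Finset.mem_filter, hP]
        constructor
        · rintro ⟨⟨⟨h1, h2⟩, h3⟩, ⟨h4, h5⟩, h6⟩
          refine ⟨⟨⟨⟨h1, h2⟩, h4, h5⟩, ?_⟩, h3.trans h6.symm, h3⟩
          exact hg a (Finset.mem_product.mpr ⟨h1, h2⟩) b (Finset.mem_product.mpr ⟨h4, h5⟩) (h3.trans h6.symm)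
        · rintro ⟨⟨⟨⟨h1, h2⟩, h4, h5⟩, -⟩, h7, h8⟩
          exact ⟨⟨⟨h1, h2⟩, h8⟩, ⟨h4, h5⟩, h7 ▸ h8⟩
      rw [Finset.sum_congr rfl this]
      norm_cast
      rw [← Finset.card_biUnion]
      · apply Finset.card_le_card
        intro u hu
        rw [Finset.mem_biUnion] at hu
        obtain ⟨s, -, hs⟩ := hu
        exact (Finset.mem_filter.mp hs).1
      · intro s hs s' hs' hne
        rw [Function.onFun, Finset.disjoint_left]
        intro u hu hu'
        exact hne ((Finset.mem_filter.mp hu).2.2.symm.trans (Finset.mem_filter.mp hu').2.2)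
    have h4 : ((F ×ˢ F).card : ℝ)^2 = n^3 * n := by
      rw [Finset.card_product]; push_cast; ring
    rw [h4] at h2
    have h5 : n^3 * n ≤ (Tn * (q t).card) * n := by
      calc n^3 * n ≤ S.card * ∑ s ∈ S, (((F ×ˢ F).filter (fun p => g p = s)).card : ℝ)^2 := h2
        _ ≤ (Tn * n) * (q t).card := mul_le_mul hSc h3 (Finset.sum_nonneg (fun _ _ => sq_nonneg _)) (mul_nonneg hTn hn0.le)
        _ = _ := by ring
    exact le_of_mul_le_mul_right h5 hn0
  -- the part with small second difference
  have hsmall : ∀ t, (((q t).filter (fun u => |u.2.2 - u.1.2| ≤ (r:ℤ))).card : ℝ) ≤ 3 * D * κ * n^3 := by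
    intro t
    set W := (F ×ˢ F).filter (fun u => |u.2 - u.1| ≤ (r:ℤ)) with hW
    have hWc : (W.card : ℝ) ≤ κ * n * n := by
      apply card_fib W F (fun u => u.1)
      · intro u hu
        exact (Finset.mem_product.mp (Finset.mem_filter.mp hu).1).1
      · intro x hx
        refine le_trans ?_ (hconc x hx)
        norm_cast
        apply Finset.card_le_card_of_injOn (fun u => u.2)
        · rintro ⟨a, b⟩ hu
          simp only [hW, Finset.coe_filter, Finset.mem_filter, Finset.mem_product, mem_setOf_eq] at hu ⊢
          obtain ⟨⟨⟨h1, h2⟩, h3⟩, rfl⟩ := hu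
          exact ⟨h2, h3⟩
        · rintro ⟨a, b⟩ hu ⟨a', b'⟩ hu' h
          simp only [Finset.coe_filter, mem_setOf_eq] at hu hu' h
          rw [hu.2, hu'.2, h]
    have h1 := card_fib ((q t).filter (fun u => |u.2.2 - u.1.2| ≤ (r:ℤ))) (F ×ˢ W)
      (fun u => (u.1.1, (u.1.2, u.2.2))) ?_ (3 * D) ?_
    · refine h1.trans ?_
      rw [Finset.card_product]
      push_cast
      calc 3 * D * (n * W.card) ≤ 3 * D * (n * (κ * n * n)) := by gcongr
        _ = _ := by ring
    · rintro ⟨⟨a, b⟩, ⟨c, d⟩⟩ hu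
      simp only [q, hP, hW, Finset.mem_filter, Finset.mem_product] at hu ⊢
      exact ⟨hu.1.1.1.1, ⟨hu.1.1.1.2, hu.1.1.2.2⟩, hu.2⟩
    · rintro ⟨a, b, d⟩ -
      have hcard : (((q t).filter (fun u => |u.2.2 - u.1.2| ≤ (r:ℤ))).filter (fun u => (u.1.1, (u.1.2, u.2.2)) = (a, b, d))).card
          = ((((q t).filter (fun u => |u.2.2 - u.1.2| ≤ (r:ℤ))).filter (fun u => (u.1.1, (u.1.2, u.2.2)) = (a, b, d))).image (fun u => u.2.1)).card := by
        rw [Finset.card_image_of_injOn]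
        rintro ⟨⟨a1, b1⟩, ⟨c1, d1⟩⟩ hu ⟨⟨a2, b2⟩, ⟨c2, d2⟩⟩ hu' h
        simp only [Finset.coe_filter, mem_setOf_eq, Prod.mk.injEq] at hu hu' h ⊢
        obtain ⟨-, h1, h2, h3⟩ := hu
        obtain ⟨-, h4, h5, h6⟩ := hu'
        exact ⟨⟨h1.trans h4.symm, h2.trans h5.symm⟩, h, h3.trans h6.symm⟩
      rw [hcard]
      refine (int_card_le _ (2 * D) (by linarith) ?_).trans (by linarith)
      intro x hx y hy
      rw [Finset.mem_image] at hx hy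
      obtain ⟨⟨⟨a1, b1⟩, ⟨c1, d1⟩⟩, hu, rfl⟩ := hx
      obtain ⟨⟨⟨a2, b2⟩, ⟨c2, d2⟩⟩, hu', rfl⟩ := hy
      simp only [q, Finset.mem_filter, Prod.mk.injEq] at hu hu' ⊢
      obtain ⟨⟨⟨-, k1⟩, -⟩, rfl, rfl, rfl⟩ := hu
      obtain ⟨⟨⟨-, k2⟩, -⟩, rfl, rfl, rfl⟩ := hu'
      rw [abs_le] at k1 k2 ⊢
      constructor <;> linarith [k1.1, k1.2, k2.1, k2.2]
  -- the other part, on average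
  have hsplit : ∀ t, ((q t).card : ℝ) ≤ 3 * D * κ * n^3 + (P1.filter (fun u => |((u.1.1:ℝ) + t * u.1.2) - (u.2.1 + t * u.2.2)| ≤ D)).card := by
    intro t
    have := Finset.card_filter_add_card_filter_not (s := q t) (fun u => |u.2.2 - u.1.2| ≤ (r:ℤ))
    have h2 : (q t).filter (fun u => ¬ |u.2.2 - u.1.2| ≤ (r:ℤ)) = P1.filter (fun u => |((u.1.1:ℝ) + t * u.1.2) - (u.2.1 + t * u.2.2)| ≤ D) := by
      simp only [q, P1, Finset.filter_filter]
      congr 1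
      ext u
      tauto
    rw [h2] at this
    rw [← this]
    push_cast
    linarith [hsmall t]
  have havg : ∑ i ∈ Finset.range r, ((P1.filter (fun u => |((u.1.1:ℝ) + ((i:ℝ)/r) * u.1.2) - (u.2.1 + ((i:ℝ)/r) * u.2.2)| ≤ D)).card : ℝ) ≤ n^4 * (3 * D) := by
    have e1 : ∀ i : ℕ, ((P1.filter (fun u => |((u.1.1:ℝ) + ((i:ℝ)/r) * u.1.2) - (u.2.1 + ((i:ℝ)/r) * u.2.2)| ≤ D)).card : ℝ)
        = ∑ u ∈ P1, if |((u.1.1:ℝ) + ((i:ℝ)/r) * u.1.2) - (u.2.1 + ((i:ℝ)/r) * u.2.2)| ≤ D then (1:ℝ) else 0 := by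
      intro i
      rw [Finset.card_filter]; push_cast; rfl
    rw [Finset.sum_congr rfl (fun i _ => e1 i), Finset.sum_comm]
    calc _ ≤ ∑ u ∈ P1, (3 * D) := by
          apply Finset.sum_le_sum
          rintro ⟨⟨a, b⟩, ⟨c, d⟩⟩ hu
          simp only [P1, Finset.mem_filter] at hu
          have hv := hu.2
          push Not at hv
          have hv' : (r:ℝ) < |(d:ℝ) - b| := by exact_mod_cast hv
          rw [← Finset.sum_filter, Finset.sum_const, nsmul_eq_mul, mul_one]
          simp only
          have hcard : (((Finset.range r).filter (fun i : ℕ => |((a:ℝ) + ((i:ℝ)/r) * b) - (c + ((i:ℝ)/r) * d)| ≤ D)).card : ℝ)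
              = ((((Finset.range r).filter (fun i : ℕ => |((a:ℝ) + ((i:ℝ)/r) * b) - (c + ((i:ℝ)/r) * d)| ≤ D)).image (fun i : ℕ => (i:ℤ))).card : ℝ) := by
            rw [Finset.card_image_of_injective _ Nat.cast_injective]
          rw [hcard]
          refine (int_card_le _ (2 * D) (by linarith) ?_).trans (by linarith)
          intro x hx y hy
          rw [Finset.mem_image] at hx hy
          obtain ⟨i, hi, rfl⟩ := hx
          obtain ⟨j, hj, rfl⟩ := hy
          have k1 := (Finset.mem_filter.mp hi).2
          have k2 := (Finset.mem_filter.mp hj).2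
          push_cast
          have h5 : |(((i:ℝ) - j) / r) * ((d:ℝ) - b)| ≤ 2 * D := by
            have e : (((i:ℝ) - j) / r) * ((d:ℝ) - b) = (((a:ℝ) + ((j:ℝ)/r) * b) - (c + ((j:ℝ)/r) * d)) - (((a:ℝ) + ((i:ℝ)/r) * b) - (c + ((i:ℝ)/r) * d)) := by
              field_simp; ring
            rw [e]
            rw [abs_le] at k1 k2 ⊢
            constructor <;> linarith [k1.1, k1.2, k2.1, k2.2]
          rw [abs_mul, abs_div, abs_of_pos hr0] at h5
          calc |(i:ℝ) - j| = |(i:ℝ) - j| / r * r := by field_simp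
            _ ≤ |(i:ℝ) - j| / r * |(d:ℝ) - b| := by gcongr
            _ ≤ 2 * D := h5
      _ = P1.card * (3 * D) := by rw [Finset.sum_const, nsmul_eq_mul]
      _ ≤ P.card * (3 * D) := by
          gcongr
          exact Finset.filter_subset _ _
      _ = _ := by rw [hPc]
  have hfin : (r:ℝ) * n^3 ≤ Tn * (r * (3 * D * κ * n^3) + n^4 * (3 * D)) := by
    calc (r:ℝ) * n^3 = ∑ i ∈ Finset.range r, n^3 := by rw [Finset.sum_const, Finset.card_range, nsmul_eq_mul]
      _ ≤ ∑ i ∈ Finset.range r, Tn * (3 * D * κ * n^3 + (P1.filter (fun u => |((u.1.1:ℝ) + ((i:ℝ)/r) * u.1.2) - (u.2.1 + ((i:ℝ)/r) * u.2.2)| ≤ D)).card) := by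
          apply Finset.sum_le_sum
          intro i hi
          have hi' : (i:ℝ) ≤ r := by exact_mod_cast (Finset.mem_range.mp hi).le
          refine (hlow (i/r) ⟨by positivity, div_le_one_of_le₀ hi' hr0.le⟩).trans ?_
          exact mul_le_mul_of_nonneg_left (hsplit _) hTn
      _ = Tn * (r * (3 * D * κ * n^3) + ∑ i ∈ Finset.range r, ((P1.filter (fun u => |((u.1.1:ℝ) + ((i:ℝ)/r) * u.1.2) - (u.2.1 + ((i:ℝ)/r) * u.2.2)| ≤ D)).card : ℝ)) := by
          rw [← Finset.mul_sum, Finset.sum_add_distrib, Finset.sum_const, Finset.card_range, nsmul_eq_mul]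
      _ ≤ _ := by gcongr
  have hpos : 0 < (r:ℝ) * n^3 := by positivity
  have e : Tn * (r * (3 * D * κ * n^3) + n^4 * (3 * D)) = (Tn * (3 * n * D / r + 3 * D * κ)) * (r * n^3) := by
    field_simp; ring
  rw [e] at hfin
  by_contra hcon
  push Not at hcon
  have := mul_lt_mul_of_pos_right hcon hpos
  linarith
end

section
open MeasureTheory Set Real
open scoped Pointwise

lemma core_ineq (A : Finset ℤ) (hA : A.Nonempty) (K : ℝ) (hK : ((A - A).card : ℝ) ≤ K * A.card)
    (R : ℕ) (hR : 1 ≤ R) (K1 : ℝ) (hK1 : 1 ≤ K1) (hK45 : 45 * K^9 ≤ K1) (m : ℕ) (ρ : ℝ) (hρ : 0 < ρ) (hρ1 : ρ ≤ 1)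
    (hdens : ∀ t ∈ Icc (0:ℝ) 1, ∃ z1 ∈ goodG (HR A R) K1 m, ∃ z2 ∈ goodG (HR A R) K1 m,
      ρ ≤ |z2| ∧ |t * z2 - z1| ≤ |z2| / R) (κ : ℝ) (r : ℕ) (hr : 1 ≤ r)
    (hconc : ∀ x ∈ FR A R, (((FR A R).filter (fun y => |y - x| ≤ (r:ℤ))).card : ℝ) ≤ κ * (FR A R).card) :
    1 ≤ K1^(3^(m+1)) * (3 * (FR A R).card * (4/ρ) / r + 3 * (4/ρ) * κ) := by
  classical
  have hR0 : (0:ℝ) < R := by exact_mod_cast hR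
  apply energy_contra (FR A R) ⟨0, zero_mem_FR hA R⟩ _ (4/ρ) κ _ r hr hconc
  · intro t ht
    obtain ⟨z1, hz1, z2, hz2, hz, htz⟩ := hdens t ht
    obtain ⟨T1, hT1c, hT1⟩ := goodG_mem.mp hz1
    obtain ⟨T2, hT2c, hT2⟩ := goodG_mem.mp hz2
    obtain ⟨X, hXc, hX⟩ := HR_add A hA K hK R hR
    have hFH : ∀ a ∈ FR A R, (a:ℝ) ∈ HR A R := fun a ha => ⟨a, ha, by simp⟩
    have hex : ∀ p ∈ FR A R ×ˢ FR A R, ∃ s ∈ ((T1 ×ˢ T2 ×ˢ X).image (fun u => u.1 + u.2.1 + u.2.2)) ×ˢ FR A R,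
        |z2 * p.1 + z1 * p.2 - s.1 - s.2| ≤ 1 := by
      rintro ⟨a, b⟩ hp
      rw [Finset.mem_product] at hp
      obtain ⟨t2, ht2, h2⟩ := hT2 _ (hFH a hp.1)
      obtain ⟨t1, ht1, h1⟩ := hT1 _ (hFH b hp.2)
      obtain ⟨x, hx, e, he, h3⟩ := hX _ h2 _ h1
      refine ⟨(t1 + t2 + x, e), ?_, ?_⟩
      · rw [Finset.mem_product]
        exact ⟨Finset.mem_image.mpr ⟨(t1,t2,x), by simp [ht1,ht2,hx], rfl⟩, he⟩
      · simp only
        convert h3 using 2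
        ring
    choose! g hg1 hg2 using hex
    refine ⟨_, g, ?_, hg1, ?_⟩
    · rw [Finset.card_product]
      push_cast
      apply mul_le_mul_of_nonneg_right _ (by positivity)
      have hone : 1 ≤ K1^(3^m) := one_le_pow₀ hK1
      calc ((((T1 ×ˢ T2 ×ˢ X).image (fun u => u.1 + u.2.1 + u.2.2)).card : ℕ) : ℝ) ≤ (T1 ×ˢ T2 ×ˢ X).card := by
            exact_mod_cast Finset.card_image_le
        _ = T1.card * (T2.card * X.card) := by simp only [Finset.card_product]; push_cast; ring
        _ ≤ K1^(3^m) * (K1^(3^m) * K1^(3^m)) := by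
            have : (X.card:ℝ) ≤ K1^(3^m) := by
              calc (X.card:ℝ) ≤ K1^1 := by rw [pow_one]; linarith
                _ ≤ _ := pow_le_pow_right₀ hK1 (Nat.one_le_pow _ _ (by norm_num))
            gcongr
        _ = _ := by rw [← pow_add, ← pow_add]; ring_nf
    · rintro ⟨a, b⟩ hp ⟨a', b'⟩ hq hgpq
      have k1 := hg2 _ hp
      have k2 := hg2 _ hq
      rw [hgpq] at k1
      rw [Finset.mem_product] at hp hq
      simp only at k1 k2 ⊢
      have hz0 : 0 < |z2| := hρ.trans_le hz
      have hbb : ∀ b ∈ FR A R, |(t * z2 - z1) * b| ≤ |z2| := by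
        intro b hb
        have : |(b:ℝ)| ≤ R := by exact_mod_cast (FR_mem.mp hb).2
        rw [abs_mul]
        calc |t * z2 - z1| * |(b:ℝ)| ≤ (|z2| / R) * R := by gcongr
          _ = |z2| := by field_simp
      have k3 := hbb b hp.2
      have k4 := hbb b' hq.2
      have k5 : |z2 * (((a:ℝ) + t * b) - (a' + t * b'))| ≤ 2 + 2 * |z2| := by
        have e : z2 * (((a:ℝ) + t * b) - (a' + t * b')) =
          (z2 * a + z1 * b - (g (a',b')).1 - (g (a',b')).2) - (z2 * a' + z1 * b' - (g (a',b')).1 - (g (a',b')).2)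
            + ((t * z2 - z1) * b - (t * z2 - z1) * b') := by ring
        rw [e]
        rw [abs_le] at k1 k2 k3 k4 ⊢
        constructor <;> linarith [k1.1, k1.2, k2.1, k2.2, k3.1, k3.2, k4.1, k4.2]
      rw [abs_mul] at k5
      rw [le_div_iff₀ hρ]
      set w := |((a:ℝ) + t * b) - (a' + t * b')| with hw
      have hw0 : 0 ≤ w := abs_nonneg _
      by_cases hw2 : w ≤ 2
      · nlinarith
      · push Not at hw2
        have : (w - 2) * ρ ≤ (w - 2) * |z2| := by
          apply mul_le_mul_of_nonneg_left hz; linarith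
        nlinarith
  · rw [le_div_iff₀ hρ]; linarith

lemma ev_pow (c x : ℝ) (hx : 0 < x) : ∀ᶠ N : ℝ in Filter.atTop, c ≤ N^x :=
  (tendsto_rpow_atTop hx).eventually_ge_atTop c

lemma exists_theta (N C c c' δ κ : ℝ) (Y' : Finset ℝ) (hN : 1 < N) (hC : 0 ≤ C) 
    (hcc : c = c' * δ / 4) (hκ : κ ≤ c) (hc : 0 < c) (hbig : 2 * C + 2 ≤ N^(2*c))
    (hY : ∀ y ∈ Y', |y| ≤ C) (hs : SepBy Y' (N^(-c')))
    (hcard : N^(-κ) * (N^(-c'))^(-δ) ≤ Y'.card) :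
    ∃ x ∈ Y', ∃ y ∈ Y', N^(-c') ≤ x - y ∧ x - y ≤ N^(-c) := by
  have hN0 : 0 < N := by linarith
  by_contra hcon
  push Not at hcon
  have hsep : SepBy Y' (N^(-c)) := by
    intro x hx y hy hne
    have h1 := hs x hx y hy hne
    rcases lt_or_gt_of_ne hne with h | h
    · rw [abs_sub_comm, abs_of_pos (by linarith)] at h1 ⊢
      exact (hcon y hy x hx h1).le
    · rw [abs_of_pos (by linarith)] at h1 ⊢
      exact (hcon x hx y hy h1).le
  have h1 := sep_card_le Y' _ C (Real.rpow_pos_of_pos hN0 _) hC hsep hY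
  have h2 := hcard.trans h1
  rw [← Real.rpow_mul hN0.le, ← Real.rpow_add hN0, Real.rpow_neg hN0.le, div_inv_eq_mul] at h2
  have h3 : N^(3*c) ≤ N^(-κ + -c' * -δ) := by
    apply Real.rpow_le_rpow_of_exponent_le hN.le
    have : c' * δ = 4 * c := by rw [hcc]; ring
    nlinarith
  have h4 : N^(3*c) = N^(2*c) * N^c := by rw [← Real.rpow_add hN0]; ring_nf
  have h5 : 1 ≤ N^c := Real.one_le_rpow hN.le hc.le
  have h6 : (2 * C + 2) * N^c ≤ N^(2*c) * N^c := by gcongr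
  nlinarith
end

section
open MeasureTheory Set Real
open scoped Pointwise

lemma choose_R_num (N δ : ℝ) (hδ : 0 < δ) (hN : 3 ≤ N) (h3 : 3 ≤ N^(3*δ/16))
    (A : Finset ℤ) (hA : A.Nonempty) (hAN : ∀ a ∈ A, |(a:ℝ)| ≤ N^2) (hAc : N^(δ/2) ≤ A.card) :
    ∃ R : ℕ, 1 ≤ R ∧ N^(δ/8) ≤ R ∧ (R:ℝ) ≤ N^3 ∧ ∀ r : ℕ, 1 ≤ r → r ≤ R →
      ((FR A r).card : ℝ) * (R:ℝ)^(δ/16) ≤ (FR A R).card * (r:ℝ)^(δ/16) := by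
  have hN0 : 0 < N := by linarith
  set Rmax := ⌈2 * N^2⌉₊ with hRm
  have hRm1 : 2 * N^2 ≤ Rmax := Nat.le_ceil _
  have hRm2 : (Rmax:ℝ) ≤ N^3 := by
    have := (Nat.ceil_lt_add_one (show 0 ≤ 2 * N^2 by positivity)).le
    rw [← hRm] at this
    nlinarith [sq_nonneg N]
  have hRmax : 1 ≤ Rmax := by
    have : (1:ℝ) ≤ Rmax := by nlinarith
    exact_mod_cast this
  obtain ⟨R, hR1, hR2, hR3⟩ := choose_R A (δ/16) Rmax hRmax
  have hR1' : (1:ℝ) ≤ R := by exact_mod_cast hR1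
  refine ⟨R, hR1, ?_, ?_, fun r h1 h2 => hR3 r h1 (h2.trans hR2)⟩
  · have hF : (A.card : ℝ) ≤ (FR A Rmax).card := by
      obtain ⟨a0, ha0⟩ := hA
      norm_cast
      apply Finset.card_le_card_of_injOn (fun a => a - a0)
      · intro a ha
        rw [Finset.mem_coe, FR_mem]
        refine ⟨⟨a - a0, Finset.sub_mem_sub ha ha0, 0, Finset.mem_sub.mpr ⟨a0, ha0, a0, ha0, by ring⟩, by ring⟩, ?_⟩
        have h1 := hAN a ha
        have h2 := hAN a0 ha0
        have : |((a - a0 : ℤ) : ℝ)| ≤ ((Rmax : ℤ) : ℝ) := by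
          push_cast
          rw [abs_le] at h1 h2 ⊢
          constructor <;> linarith [h1.1, h1.2, h2.1, h2.2]
        exact_mod_cast this
      · intro a _ b _ h
        simp only at h
        omega
    have h1 := hR3 Rmax hRmax le_rfl
    have h2 : (1:ℝ) ≤ (R:ℝ)^(δ/16) := Real.one_le_rpow hR1' (by positivity)
    have h4 : ((FR A R).card : ℝ) ≤ 3 * R := by
      refine (int_card_le _ (2 * R) (by positivity) ?_).trans (by linarith)
      intro x hx y hy
      have a1 : |(x:ℝ)| ≤ R := by exact_mod_cast (FR_mem.mp hx).2
      have a2 : |(y:ℝ)| ≤ R := by exact_mod_cast (FR_mem.mp hy).2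
      rw [abs_le] at a1 a2 ⊢
      constructor <;> linarith [a1.1, a1.2, a2.1, a2.2]
    have h5 : (Rmax:ℝ)^(δ/16) ≤ N^(3*δ/16) := by
      calc (Rmax:ℝ)^(δ/16) ≤ (N^3)^(δ/16) := Real.rpow_le_rpow (by positivity) hRm2 (by positivity)
        _ = N^(3*δ/16) := by
          rw [← Real.rpow_natCast, ← Real.rpow_mul hN0.le]; congr 1; push_cast; ring
    have h6 : N^(δ/2) ≤ 3 * R * N^(3*δ/16) := by
      calc N^(δ/2) ≤ (FR A Rmax).card := hAc.trans hF
        _ ≤ (FR A Rmax).card * (R:ℝ)^(δ/16) := le_mul_of_one_le_right (by positivity) h2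
        _ ≤ (FR A R).card * (Rmax:ℝ)^(δ/16) := h1
        _ ≤ 3 * R * N^(3*δ/16) := by gcongr
    have h7 : N^(δ/2) = N^(δ/8) * N^(3*δ/16) * N^(3*δ/16) := by
      rw [← Real.rpow_add hN0, ← Real.rpow_add hN0]; congr 1; ring
    rw [h7] at h6
    have hp : 0 < N^(3*δ/16) := by positivity
    have h8 := le_of_mul_le_mul_right h6 hp
    have hp2 : 0 < N^(δ/8) := by positivity
    nlinarith
  · calc (R:ℝ) ≤ Rmax := by exact_mod_cast hR2
      _ ≤ _ := hRm2

lemma dens_m (θ N c : ℝ) (p A R : ℕ) (hp : 1 ≤ p) (hA : 1 ≤ A) (hN : 1 < N) (hc : 0 < c) (hθ : 0 < θ)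
    (hθN : θ ≤ N^(-c)) (hR : (1:ℝ) < R) (hRN : (R:ℝ) ≤ N^3) :
    ∃ m : ℕ, (m:ℝ) ≤ 3/c + 1 ∧ θ^(p*A*m) ≤ 1 / R ∧ θ^p * (R:ℝ)^(-(1/(A:ℝ))) ≤ θ^(p*m) := by
  classical
  have hN0 : 0 < N := by linarith
  have hθ1 : θ < 1 := hθN.trans_lt (Real.rpow_lt_one_of_one_lt_of_neg hN (by linarith))
  have hR0 : (0:ℝ) < R := by linarith
  have hpA : 1 ≤ p * A := Nat.mul_le_mul hp hA
  have hex : ∃ m : ℕ, θ^(p*A*m) ≤ 1 / R := by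
    obtain ⟨n, hn⟩ := exists_pow_lt_of_lt_one (show 0 < 1 / (R:ℝ) by positivity) hθ1
    refine ⟨n, (pow_le_pow_of_le_one hθ.le hθ1.le ?_).trans hn.le⟩
    nlinarith
  have hspec := Nat.find_spec hex
  have hmin : ∀ k < Nat.find hex, ¬ θ^(p*A*k) ≤ 1 / R := fun k hk => Nat.find_min hex hk
  set m := Nat.find hex with hm
  have hm0 : m ≠ 0 := by
    intro h
    rw [h] at hspec
    simp at hspec
    rw [le_inv_comm₀ (by norm_num) hR0] at hspec
    simp at hspec
    have : (R:ℝ) ≤ 1 := by exact_mod_cast hspec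
    linarith
  obtain ⟨k, hk⟩ := Nat.exists_eq_succ_of_ne_zero hm0
  have hk1 := hmin k (by omega)
  push Not at hk1
  refine ⟨m, ?_, hspec, ?_⟩
  · rw [hk]; push_cast
    have : (k:ℝ) ≤ 3 / c := by
      rw [le_div_iff₀ hc]
      by_contra hcon
      push Not at hcon
      have h1 : θ^(p*A*k) ≤ θ^k := pow_le_pow_of_le_one hθ.le hθ1.le (by nlinarith)
      have h2 : θ^k ≤ (N^(-c))^k := pow_le_pow_left₀ hθ.le hθN k
      have h3 : (N^(-c))^k = N^(-(c*k)) := by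
        rw [← Real.rpow_natCast, ← Real.rpow_mul hN0.le]; congr 1; ring
      have h4 : N^(-(c*k)) ≤ N^(-3:ℝ) := Real.rpow_le_rpow_of_exponent_le hN.le (by linarith)
      have h5 : N^(-3:ℝ) = 1 / N^3 := by
        rw [Real.rpow_neg hN0.le, one_div]; congr 1; norm_cast
      have h6 : 1 / N^3 ≤ 1 / (R:ℝ) := one_div_le_one_div_of_le hR0 hRN
      linarith
    linarith
  · rw [hk, Nat.succ_eq_add_one, mul_add, mul_one, pow_add, mul_comm]
    apply mul_le_mul_of_nonneg_right _ (by positivity)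
    have hA0 : (A:ℝ) ≠ 0 := by positivity
    have h1 : ((1:ℝ)/R)^(1/(A:ℝ)) ≤ (θ^(p*A*k))^(1/(A:ℝ)) :=
      Real.rpow_le_rpow (by positivity) hk1.le (by positivity)
    have h2 : (θ^(p*A*k))^(1/(A:ℝ)) = θ^(p*k) := by
      rw [← Real.rpow_natCast, ← Real.rpow_mul hθ.le, ← Real.rpow_natCast]
      congr 1
      push_cast
      field_simp
    rw [h2, one_div, Real.inv_rpow hR0.le, ← Real.rpow_neg hR0.le] at h1
    rw [one_div] at h1 ⊢
    exact h1

/-- numerical contradiction -/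
lemma final_num (N δ κ γ cM W0 : ℝ) (Ex Aq R n r : ℕ) (K1 ρ : ℝ) (hδ : 0 < δ) (hδ1 : δ ≤ 1) (hN : 1 < N)
    (hγ : γ = δ^3 / 1024) (hcM : cM ≤ γ) (hAq : 128 / δ^2 ≤ Aq) (hEx : 1 ≤ Ex)
    (hκ : 30 * Ex * κ ≤ γ) (hκ0 : 0 < κ) (hW0 : 1 ≤ W0)
    (hK1 : K1 = W0 * (N^κ)^21) (hbig : 456 * W0^Ex < N^γ)
    (hR1 : N^(δ/8) ≤ R) (hn : (n:ℝ) ≤ (N^κ)^5 * (N^κ * (2 * R)^(1-δ)))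
    (hr : (r:ℝ) ≤ (R:ℝ)^(1-δ/2)) (hr2 : (R:ℝ)^(1-δ/2) ≤ 2 * r)
    (hρ : N^(-cM) * (R:ℝ)^(-(1/(Aq:ℝ))) ≤ ρ) :
    K1^Ex * (3 * n * (4/ρ) / r + 3 * (4/ρ) * (15 * (N^κ)^9 * ((r:ℝ)/R)^(δ/16))) < 1 := by
  have hN0 : 0 < N := by linarith
  have hγ0 : 0 < γ := by rw [hγ]; positivity
  have hR0 : (1:ℝ) < R := lt_of_lt_of_le (Real.one_lt_rpow hN (by positivity)) hR1
  have hRp : (0:ℝ) < R := by linarith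
  have hA0 : (0:ℝ) < Aq := lt_of_lt_of_le (by positivity) hAq
  have hA1 : 1 / (Aq:ℝ) ≤ δ^2 / 128 := by
    rw [div_le_div_iff₀ hA0 (by norm_num)]
    rw [div_le_iff₀ (by positivity)] at hAq
    linarith
  have hρ0 : 0 < ρ := lt_of_lt_of_le (by positivity) hρ
  set Ra := (R:ℝ)^(1/(Aq:ℝ)) with hRa
  have hRa0 : 0 < Ra := by positivity
  have h1ρ : 1 / ρ ≤ N^γ * Ra := by
    calc 1 / ρ ≤ 1 / (N^(-cM) * (R:ℝ)^(-(1/(Aq:ℝ)))) := one_div_le_one_div_of_le (by positivity) hρ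
      _ = N^cM * Ra := by
        rw [Real.rpow_neg hN0.le, Real.rpow_neg hRp.le, ← hRa]
        field_simp
      _ ≤ N^γ * Ra := by
        gcongr
        exact hN.le
  have hr0 : (0:ℝ) < r := by
    have : (0:ℝ) < (R:ℝ)^(1-δ/2) := by positivity
    linarith
  have hK : ∀ j : ℕ, (N^κ)^j = N^(κ*j) := by
    intro j
    rw [← Real.rpow_natCast, ← Real.rpow_mul hN0.le]
  have hEx' : (1:ℝ) ≤ Ex := by exact_mod_cast hEx
  -- bound for K1^Ex times K^9
  have hKW : K1^Ex * (N^κ)^9 ≤ W0^Ex * N^γ := by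
    rw [hK1, mul_pow, ← pow_mul, mul_assoc, ← pow_add, hK]
    gcongr
    · exact hN.le
    · push_cast
      nlinarith
  have hKone : 1 ≤ N^κ := Real.one_le_rpow hN.le hκ0.le
  have hK10 : 0 ≤ K1^Ex := by rw [hK1]; positivity
  have hKW6 : K1^Ex * (N^κ)^6 ≤ W0^Ex * N^γ := by
    refine le_trans ?_ hKW
    gcongr
    norm_num
  -- key R decay
  have hRdec : Ra * (R:ℝ)^(-(δ^2/32)) ≤ N^(-(3*γ)) := by
    rw [hRa, ← Real.rpow_add hRp]
    calc (R:ℝ)^(1/(Aq:ℝ) + -(δ^2/32)) ≤ (R:ℝ)^(-(3*δ^2/128)) := by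
          apply Real.rpow_le_rpow_of_exponent_le hR0.le; linarith
      _ ≤ (N^(δ/8))^(-(3*δ^2/128)) := by
          apply Real.rpow_le_rpow_of_nonpos (by positivity) hR1
          have : 0 ≤ 3*δ^2/128 := by positivity
          linarith
      _ = N^(-(3*γ)) := by
          rw [← Real.rpow_mul hN0.le, hγ]; congr 1; ring
  have hNN : N^γ * N^γ * N^(-(3*γ)) = (N^γ)⁻¹ := by
    rw [← Real.rpow_neg hN0.le, ← Real.rpow_add hN0, ← Real.rpow_add hN0]; congr 1; ring
  have hT1 : K1^Ex * (3 * n * (4/ρ) / r) ≤ 48 * W0^Ex * (N^γ)⁻¹ := by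
    have hn' : (n:ℝ) ≤ (N^κ)^6 * (2 * (R:ℝ)^(1-δ)) := by
      refine hn.trans ?_
      rw [Real.mul_rpow (by norm_num) hRp.le, ← mul_assoc, ← pow_succ]
      gcongr
      calc (2:ℝ)^(1-δ) ≤ 2^(1:ℝ) := Real.rpow_le_rpow_of_exponent_le (by norm_num) (by linarith)
        _ = 2 := by norm_num
    have hrr : 1 / (r:ℝ) ≤ 2 * (R:ℝ)^(-(1-δ/2)) := by
      rw [Real.rpow_neg hRp.le, div_le_iff₀ hr0]
      have : (0:ℝ) < (R:ℝ)^(1-δ/2) := by positivity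
      rw [mul_assoc, inv_mul_eq_div, ← mul_div_assoc, le_div_iff₀ this]
      linarith
    have hRR : (R:ℝ)^(1-δ) * (R:ℝ)^(-(1-δ/2)) ≤ (R:ℝ)^(-(δ^2/32)) := by
      rw [← Real.rpow_add hRp]
      apply Real.rpow_le_rpow_of_exponent_le hR0.le
      nlinarith
    calc K1^Ex * (3 * n * (4/ρ) / r) = 12 * K1^Ex * n * (1/ρ) * (1/r) := by ring
      _ ≤ 12 * K1^Ex * ((N^κ)^6 * (2 * (R:ℝ)^(1-δ))) * (N^γ * Ra) * (2 * (R:ℝ)^(-(1-δ/2))) := by gcongr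
      _ = 48 * (K1^Ex * (N^κ)^6) * N^γ * (Ra * ((R:ℝ)^(1-δ) * (R:ℝ)^(-(1-δ/2)))) := by ring
      _ ≤ 48 * (W0^Ex * N^γ) * N^γ * (Ra * (R:ℝ)^(-(δ^2/32))) := by gcongr
      _ ≤ 48 * (W0^Ex * N^γ) * N^γ * N^(-(3*γ)) := by gcongr
      _ = 48 * W0^Ex * (N^γ * N^γ * N^(-(3*γ))) := by ring
      _ = _ := by rw [hNN]
  have hT2 : K1^Ex * (3 * (4/ρ) * (15 * (N^κ)^9 * ((r:ℝ)/R)^(δ/16))) ≤ 180 * W0^Ex * (N^γ)⁻¹ := by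
    have hrR : ((r:ℝ)/R)^(δ/16) ≤ (R:ℝ)^(-(δ^2/32)) := by
      calc ((r:ℝ)/R)^(δ/16) ≤ ((R:ℝ)^(-(δ/2)))^(δ/16) := by
            apply Real.rpow_le_rpow (by positivity) _ (by positivity)
            rw [div_le_iff₀ hRp]
            have e : (R:ℝ)^(-(δ/2)) * R = (R:ℝ)^(1-δ/2) := by
              rw [show (1-δ/2) = -(δ/2)+1 by ring, Real.rpow_add hRp, Real.rpow_one]
            rw [e]
            exact hr
        _ = _ := by rw [← Real.rpow_mul hRp.le]; congr 1; ring
    calc K1^Ex * (3 * (4/ρ) * (15 * (N^κ)^9 * ((r:ℝ)/R)^(δ/16)))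
        = 180 * (K1^Ex * (N^κ)^9) * (1/ρ) * ((r:ℝ)/R)^(δ/16) := by ring
      _ ≤ 180 * (W0^Ex * N^γ) * (N^γ * Ra) * (R:ℝ)^(-(δ^2/32)) := by gcongr
      _ = 180 * (W0^Ex * N^γ) * N^γ * (Ra * (R:ℝ)^(-(δ^2/32))) := by ring
      _ ≤ 180 * (W0^Ex * N^γ) * N^γ * N^(-(3*γ)) := by gcongr
      _ = 180 * W0^Ex * (N^γ * N^γ * N^(-(3*γ))) := by ring
      _ = _ := by rw [hNN]
  rw [mul_add]
  have hNγ : 0 < N^γ := by positivity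
  have : 228 * W0^Ex * (N^γ)⁻¹ < 1 := by
    rw [← div_eq_mul_inv, div_lt_one hNγ]
    have : 0 < W0^Ex := by positivity
    linarith
  linarith
end

section
open MeasureTheory Set Real
open scoped Pointwise

set_option maxHeartbeats 1000000 in
theorem thmX (δ : ℝ) (hδ : 0 < δ) (hδ1 : δ ≤ 1) : ∃ κ > (0:ℝ), ∀ C : ℕ, 1 ≤ C → ∀ᶠ N : ℝ in Filter.atTop,
    ∀ (A : Finset ℤ) (Y : Set ℝ), (∀ a ∈ A, |(a:ℝ)| ≤ N^2) → ((A - A).card : ℝ) ≤ N^κ * A.card →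
    N^(δ/2) ≤ A.card →
    (∀ (x : ℤ) (r : ℝ), N^(δ/8) ≤ r → r ≤ 2 * N^3 →
      ((A.filter (fun a : ℤ => |(a:ℝ) - x| ≤ r)).card : ℝ) ≤ N^κ * r^(1-δ)) →
    (∀ y ∈ Y, |y| ≤ C ∧ ∃ B ⊆ A, (A.card : ℝ) ≤ N^κ * B.card ∧ ∀ b ∈ B, ∃ a ∈ A, |y * b - a| ≤ C) →
    (∀ σ ∈ Icc (N^(-(1/2:ℝ))) (N^(-κ)), ∃ Y' : Finset ℝ, (∀ y ∈ Y', y ∈ Y) ∧ SepBy Y' σ ∧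
      N^(-κ) * σ^(-δ) ≤ Y'.card) → False := by
  set γ : ℝ := δ^3/1024 with hγ
  have hγ0 : 0 < γ := by positivity
  set Aq : ℕ := ⌈128/δ^2⌉₊ with hAq
  have hAq1 : 128/δ^2 ≤ (Aq:ℝ) := Nat.le_ceil _
  have hAqpos : 1 ≤ Aq := Nat.ceil_pos.mpr (by positivity)
  obtain ⟨M, hM⟩ := ring_dense (δ/2) (by positivity) Aq
  set c' : ℝ := γ/(M+1) with hc'
  have hc'0 : 0 < c' := by positivity
  have hc'M : c' * M ≤ γ := by
    rw [hc', div_mul_eq_mul_div, div_le_iff₀ (by positivity)]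
    nlinarith
  have hc'γ : c' ≤ γ := by
    rw [hc']; apply div_le_self hγ0.le; linarith [(Nat.cast_nonneg M : (0:ℝ) ≤ M)]
  have hγ12 : γ ≤ 1/2 := by
    rw [hγ]
    have : δ^3 ≤ 1 := pow_le_one₀ hδ.le hδ1
    linarith
  set c : ℝ := c'*δ/4 with hc
  have hc0 : 0 < c := by positivity
  have hcc' : c ≤ c' := by rw [hc]; nlinarith
  set m0 : ℕ := ⌈3/c⌉₊ + 1 with hm0
  set M' : ℕ := M + M*Aq + 3 + 4*m0 with hM'
  set Ex : ℕ := 3^(M'+1) with hEx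
  have hEx1 : 1 ≤ Ex := Nat.one_le_pow _ _ (by norm_num)
  have hEx0 : (0:ℝ) < Ex := by exact_mod_cast hEx1
  set κ : ℝ := min (γ/(30*Ex)) (c*δ/2) with hκ
  have hκ0 : 0 < κ := lt_min (by positivity) (by positivity)
  have hκ1 : 30 * Ex * κ ≤ γ := by
    have := min_le_left (γ/(30*(Ex:ℝ))) (c*δ/2)
    rw [← hκ, le_div_iff₀ (by positivity)] at this
    linarith
  have hκ2 : κ ≤ c*δ/2 := min_le_right _ _
  have hκc : κ ≤ c := by nlinarith
  refine ⟨κ, hκ0, fun C hC => ?_⟩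
  have hC' : (1:ℝ) ≤ C := by exact_mod_cast hC
  filter_upwards [Filter.eventually_ge_atTop 3, ev_pow 3 (3*δ/16) (by positivity), ev_pow (64*C) c hc0,
    ev_pow (2*C+2) (2*c) (by positivity), ev_pow (456*(100*C^2)^Ex + 1) γ hγ0]
    with N hN hN1 hN2 hN3 hN4 A Y hAN hAA hAc hInt hY hSep
  have hN0 : 0 < N := by linarith
  have hNone : 1 < N := by linarith
  have hAcpos : (0:ℝ) < A.card := lt_of_lt_of_le (by positivity) hAc
  have hA : A.Nonempty := Finset.card_pos.mp (by exact_mod_cast hAcpos)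
  obtain ⟨R, hR1, hR2, hR3, hR4⟩ := choose_R_num N δ hδ hN hN1 A hA hAN hAc
  have hRone : (1:ℝ) < R := lt_of_lt_of_le (Real.one_lt_rpow hNone (by positivity)) hR2
  have hRp : (0:ℝ) < R := by linarith
  have hK1 : 1 ≤ N^κ := Real.one_le_rpow hNone.le hκ0.le
  set K1 : ℝ := 100*C^2*(N^κ)^21 with hK1d
  have hCsq : (1:ℝ) ≤ C^2 := one_le_pow₀ hC'
  have hK11 : 1 ≤ K1 := by
    rw [hK1d]
    have : 1 ≤ (N^κ)^21 := one_le_pow₀ hK1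
    nlinarith
  have hK45 : 45 * (N^κ)^9 ≤ K1 := by
    rw [hK1d]
    have : (N^κ)^9 ≤ (N^κ)^21 := pow_le_pow_right₀ hK1 (by norm_num)
    have h21 : (1:ℝ) * (N^κ)^21 ≤ C^2 * (N^κ)^21 := by gcongr
    have h0 : 0 < (N^κ)^21 := by positivity
    rw [mul_assoc]
    linarith
  obtain ⟨X, hXc, hX⟩ := HR_add A hA (N^κ) hAA R hR1
  have hRF := goodG_rf (HR A R) K1 hK11 HR_neg ⟨X, hXc.trans hK45, hX⟩
  have hYG : ∀ y ∈ Y, y ∈ goodG (HR A R) K1 0 := by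
    intro y hy
    obtain ⟨h1, B, hBA, hBc, hB⟩ := hY y hy
    have hBne : B.Nonempty := by
      rw [Finset.nonempty_iff_ne_empty]
      rintro rfl
      simp at hBc
      rw [hBc] at hAcpos
      simp at hAcpos
    have := good_mult A B hBA hBne (N^κ) hAA hBc R hR1 y C hC h1 hB
    unfold goodG
    simpa using this
  set G' : ℕ → Set ℝ := fun m => goodG (HR A R) K1 (m+1) with hG'
  have hRF' : RF G' := ⟨fun m => hRF.mono _, fun m => hRF.add _, fun m => hRF.sub _, fun m => hRF.mul _, hRF.mono 0 hRF.one⟩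
  have hle : ∀ a b : ℝ, a ≤ b → N^a ≤ N^b := fun a b h => Real.rpow_le_rpow_of_exponent_le hNone.le h
  obtain ⟨Y0, hY0, hY0s, hY0c⟩ := hSep (N^(-c')) ⟨hle _ _ (by linarith), hle _ _ (by linarith)⟩
  obtain ⟨x, hx, y, hy, hxy1, hxy2⟩ := exists_theta N C c c' δ κ Y0 hNone (by positivity) hc hκc hc0 hN3
    (fun y hy => (hY y (hY0 y hy)).1) hY0s hY0c
  set θ := x - y with hθ
  have hθ0 : 0 < θ := lt_of_lt_of_le (by positivity) hxy1
  have hθ1 : θ ≤ 1 := hxy2.trans (by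
    have := hle (-c) 0 (by linarith)
    rwa [Real.rpow_zero] at this)
  have hθG : θ ∈ G' 0 := hRF.sub 0 x y (hYG x (hY0 x hx)) (hYG y (hY0 y hy))
  have hpowlow : ∀ p ≤ M, N^(-γ) ≤ θ^p := by
    intro p hp
    have h1 : (N^(-c'))^p = N^(-(c'*p)) := by
      rw [← Real.rpow_natCast, ← Real.rpow_mul hN0.le]; congr 1; ring
    calc N^(-γ) ≤ N^(-(c'*p)) := hle _ _ (by
            have : (p:ℝ) ≤ M := by exact_mod_cast hp
            nlinarith)
      _ ≤ θ^p := by rw [← h1]; exact pow_le_pow_left₀ (by positivity) hxy1 p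
  have hRH : RHyp G' θ C (δ/2) M := by
    refine ⟨hRF', hθG, hθ0, hC', ?_, ?_⟩
    · calc 64 * C * θ ≤ N^c * N^(-c) := by gcongr
        _ = 1 := by rw [← Real.rpow_add hN0]; simp
    · intro p hp1 hp2
      have hpc : θ^p ≤ N^(-c) := by
        calc θ^p ≤ θ^1 := pow_le_pow_of_le_one hθ0.le hθ1 hp1
          _ ≤ _ := by rw [pow_one]; exact hxy2
      obtain ⟨Y', h1, h2, h3⟩ := hSep (θ^p) ⟨(hle _ _ (by linarith)).trans (hpowlow p hp2), hpc.trans (hle _ _ (by linarith))⟩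
      refine ⟨Y', fun y hy => ⟨hRF.mono 0 (hYG y (h1 y hy)), (hY y (h1 y hy)).1⟩, h2, le_trans ?_ h3⟩
      have e1 : Real.exp (δ/2 * p * (-Real.log θ)) = (θ^p)^(-(δ/2)) := by
        rw [Real.rpow_def_of_pos (by positivity), Real.log_pow]; congr 1; ring
      rw [e1]
      have e2 : (θ^p)^(-δ) = (θ^p)^(-(δ/2)) * (θ^p)^(-(δ/2)) := by
        rw [← Real.rpow_add (by positivity)]; congr 1; ring
      have e3 : N^κ ≤ (θ^p)^(-(δ/2)) := by
        calc N^κ ≤ N^(c*δ/2) := hle _ _ hκ2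
          _ = (N^(-c))^(-(δ/2)) := by rw [← Real.rpow_mul hN0.le]; congr 1; ring
          _ ≤ _ := Real.rpow_le_rpow_of_nonpos (by positivity) hpc (by linarith)
      have e4 : N^(-κ) * N^κ = 1 := by rw [← Real.rpow_add hN0]; simp
      rw [e2]
      calc (θ^p)^(-(δ/2)) = N^(-κ) * (N^κ * (θ^p)^(-(δ/2))) := by rw [← mul_assoc, e4, one_mul]
        _ ≤ _ := by gcongr
  obtain ⟨p, hp1, hp2, hD⟩ := hM G' θ C hRH
  obtain ⟨m, hm1, hm2, hm3⟩ := dens_m θ N c p Aq R hp1 hAqpos hNone hc0 hθ0 hxy2 hRone hR3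
  have hmm0 : m ≤ m0 := by
    have : (m:ℝ) ≤ (m0:ℝ) := by
      rw [hm0]; push_cast
      linarith [Nat.le_ceil (3/c)]
    exact_mod_cast this
  have hlev : M + p*Aq + 2 + 4*m + 1 ≤ M' := by
    rw [hM']
    have := Nat.mul_le_mul_right Aq hp2
    omega
  have hdi := dens_iter hRF' hθG hθ0 hD m
  set r : ℕ := ⌊(R:ℝ)^(1-δ/2)⌋₊ with hr
  have hRr1 : 1 ≤ (R:ℝ)^(1-δ/2) := Real.one_le_rpow hRone.le (by linarith)
  have hr1 : 1 ≤ r := Nat.le_floor (by simpa using hRr1)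
  have hr1' : (1:ℝ) ≤ r := by exact_mod_cast hr1
  have hrle : (r:ℝ) ≤ (R:ℝ)^(1-δ/2) := Nat.floor_le (by positivity)
  have hrge : (R:ℝ)^(1-δ/2) ≤ 2 * r := by
    have := (Nat.lt_floor_add_one ((R:ℝ)^(1-δ/2))).le
    rw [← hr] at this
    linarith
  have hrR : r ≤ R := by
    have : (r:ℝ) ≤ R := hrle.trans (by
      have := Real.rpow_le_rpow_of_exponent_le hRone.le (show 1 - δ/2 ≤ 1 by linarith)
      rwa [Real.rpow_one] at this)
    exact_mod_cast this
  have hci := core_ineq A hA (N^κ) hAA R hR1 K1 hK11 hK45 M' (θ^(p*m)) (by positivity)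
    (pow_le_one₀ hθ0.le hθ1) ?_ (15 * (N^κ)^9 * ((r:ℝ)/R)^(δ/16)) r hr1 ?_
  · have hfin := final_num N δ κ γ γ (100*C^2) Ex Aq R (FR A R).card r K1 (θ^(p*m)) hδ hδ1 hNone hγ le_rfl hAq1 hEx1
      hκ1 hκ0 (by nlinarith) hK1d (by linarith) hR2 ?_ hrle hrge ?_
    · exact absurd hci (not_le.mpr hfin)
    · apply FR_upper A hA (N^κ) hAA R
      intro x
      have := hInt x (2*R) (hR2.trans (by linarith)) (by linarith)
      refine le_trans (le_of_eq ?_) this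
      congr 2
      ext a
      simp only [Finset.mem_filter]
      have : |a - x| ≤ 2 * (R:ℤ) ↔ |(a:ℝ) - x| ≤ 2 * R := by
        rw [← @Int.cast_le ℝ]; push_cast; rfl
      rw [this]
    · refine le_trans ?_ hm3
      gcongr
      exact hpowlow p hp2
  · intro t ht
    obtain ⟨z1, hz1, z2, hz2, h1, h2⟩ := hdi t ⟨by linarith [ht.1], ht.2⟩
    refine ⟨z1, hRF.le hlev hz1, z2, hRF.le hlev hz2, h1, h2.trans ?_⟩
    rw [div_eq_inv_mul, ← one_div]
    gcongr
  · intro x hx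
    refine (conc_raw A hA (N^κ) hAA R r hr1 x).trans ?_
    have h1 := hR4 r hr1 hrR
    have h2 : ((FR A r).card : ℝ) ≤ ((r:ℝ)/R)^(δ/16) * (FR A R).card := by
      rw [Real.div_rpow (by positivity) hRp.le, div_mul_eq_mul_div, le_div_iff₀ (by positivity)]
      linarith
    rw [mul_assoc (15 * (N^κ)^9)]
    exact mul_le_mul_of_nonneg_left h2 (by positivity)
end

section
open MeasureTheory Set Real
open scoped Pointwise

set_option maxHeartbeats 1000000 in
/-- Balog–Szemerédi–Gowers. -/
theorem bsg (S D : Finset ℤ) (hS : S.Nonempty) (K : ℝ) (hK : 1 ≤ K) (hD : (D.card : ℝ) ≤ K * S.card)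
    (hE : (S.card : ℝ)^2 ≤ K * ((S ×ˢ S).filter (fun p => p.1 - p.2 ∈ D)).card) :
    ∃ A ⊆ S, (S.card : ℝ) ≤ 3 * K * A.card ∧ ((A - A).card : ℝ) ≤ 4096 * K^9 * S.card := by
  classical
  set n : ℝ := (S.card : ℝ) with hn
  have hn0 : 0 < n := by rw [hn]; exact_mod_cast Finset.card_pos.mpr hS
  have hK0 : 0 < K := by linarith
  set Nb : ℤ → Finset ℤ := fun v => S.filter (fun a => a - v ∈ D) with hNb
  set cod : ℤ × ℤ → Finset ℤ := fun p => S.filter (fun v => p.1 - v ∈ D ∧ p.2 - v ∈ D) with hcod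
  set ε : ℝ := 1/(32*K^2) with hε
  have hε0 : 0 < ε := by positivity
  set Bad : Finset (ℤ × ℤ) := (S ×ˢ S).filter (fun p => ((cod p).card : ℝ) < ε * n) with hBad
  set bd : ℤ → Finset (ℤ × ℤ) := fun v => Bad.filter (fun p => p.1 - v ∈ D ∧ p.2 - v ∈ D) with hbd
  have h1 : n^2 / K ≤ ∑ v ∈ S, ((Nb v).card : ℝ) := by
    rw [div_le_iff₀ hK0]
    have : ((S ×ˢ S).filter (fun p => p.1 - p.2 ∈ D)).card = ∑ v ∈ S, (Nb v).card := by
      rw [Finset.card_filter, Finset.sum_product_right]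
      apply Finset.sum_congr rfl
      intro v _
      rw [hNb, Finset.card_filter]
    rw [this] at hE
    push_cast at hE
    linarith
  have h2 : n^3 / K^2 ≤ ∑ v ∈ S, ((Nb v).card : ℝ)^2 := by
    have hcs := sq_sum_le_card_mul_sum_sq (s := S) (f := fun v => ((Nb v).card : ℝ))
    have h3 : (n^2/K)^2 ≤ (∑ v ∈ S, ((Nb v).card : ℝ))^2 := pow_le_pow_left₀ (by positivity) h1 2
    have h4 := h3.trans hcs
    rw [← hn] at h4
    have : (n^2/K)^2 = n * (n^3/K^2) := by field_simp
    rw [this] at h4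
    exact le_of_mul_le_mul_left h4 hn0
  have h3 : ∑ v ∈ S, ((bd v).card : ℝ) ≤ ε * n^3 := by
    have e : ∑ v ∈ S, (bd v).card = ∑ p ∈ Bad, (cod p).card := by
      have := Finset.sum_card_bipartiteAbove_eq_sum_card_bipartiteBelow (s := S) (t := Bad)
        (fun v p => p.1 - v ∈ D ∧ p.2 - v ∈ D)
      simpa [Finset.bipartiteAbove, Finset.bipartiteBelow] using this
    have e' : ∑ v ∈ S, ((bd v).card : ℝ) = ∑ p ∈ Bad, ((cod p).card : ℝ) := by exact_mod_cast e
    rw [e']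
    calc ∑ p ∈ Bad, ((cod p).card : ℝ) ≤ ∑ p ∈ Bad, ε * n := by
          apply Finset.sum_le_sum
          intro p hp
          exact (Finset.mem_filter.mp hp).2.le
      _ = Bad.card * (ε * n) := by rw [Finset.sum_const, nsmul_eq_mul]
      _ ≤ (n * n) * (ε * n) := by
          gcongr
          have : (Bad.card : ℝ) ≤ ((S ×ˢ S).card : ℝ) := by exact_mod_cast Finset.card_filter_le _ _
          rw [Finset.card_product] at this
          push_cast at this
          exact this
      _ = _ := by ring
  obtain ⟨v, hv, hvv⟩ : ∃ v ∈ S, n^2/(2*K^2) ≤ ((Nb v).card : ℝ)^2 - 16 * (bd v).card := by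
    by_contra hcon
    push Not at hcon
    have := Finset.sum_lt_sum_of_nonempty hS hcon
    rw [Finset.sum_sub_distrib, ← Finset.mul_sum, Finset.sum_const, nsmul_eq_mul, ← hn] at this
    have e : n * (n^2/(2*K^2)) = n^3/K^2 - 16 * (ε * n^3) := by
      rw [hε]; field_simp; ring
    linarith
  set A' := Nb v with hA'
  set a : ℝ := (A'.card : ℝ) with ha
  have hbdn : (0:ℝ) ≤ (bd v).card := by positivity
  have ha1 : n ≤ 2 * K * a := by
    have h5 : n^2/(2*K^2) ≤ a^2 := by linarith
    rw [div_le_iff₀ (by positivity)] at h5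
    have ha0 : 0 ≤ a := by positivity
    apply le_of_sq_le_sq _ (by positivity)
    nlinarith [sq_nonneg (a*K)]
  have ha0 : 0 < a := by
    by_contra hcon
    have : K * a ≤ 0 := mul_nonpos_of_nonneg_of_nonpos hK0.le (by linarith)
    linarith
  have hbda : ((bd v).card : ℝ) ≤ a^2/16 := by
    have : 0 ≤ n^2/(2*K^2) := by positivity
    linarith
  set bp : ℤ → Finset ℤ := fun x => A'.filter (fun y => ((cod (x,y)).card : ℝ) < ε * n) with hbp
  set A := A'.filter (fun x => ((bp x).card : ℝ) ≤ a/4) with hA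
  have hA'S : A' ⊆ S := Finset.filter_subset _ _
  have hAA' : A ⊆ A' := Finset.filter_subset _ _
  have hAc : 3/4 * a ≤ A.card := by
    set Z := A'.filter (fun x => ¬ ((bp x).card : ℝ) ≤ a/4) with hZ
    have hsum : (A.card : ℝ) + Z.card = a := by
      have := Finset.card_filter_add_card_filter_not (s := A') (fun x => ((bp x).card : ℝ) ≤ a/4)
      rw [ha, ← this]; push_cast; rfl
    have hZb : ∑ x ∈ Z, ((bp x).card : ℝ) ≤ (bd v).card := by
      have : ∑ x ∈ Z, (bp x).card ≤ (bd v).card := by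
        rw [← Finset.card_sigma]
        apply Finset.card_le_card_of_injOn (fun q => (q.1, q.2))
        · rintro ⟨x, y⟩ hq
          simp only [Finset.coe_sigma, Set.mem_sigma_iff, Finset.mem_coe] at hq
          have hx := (Finset.mem_filter.mp hq.1).1
          have hy := Finset.mem_filter.mp hq.2
          have hx' := Finset.mem_filter.mp hx
          have hy' := Finset.mem_filter.mp hy.1
          simp only [hbd, hBad, Finset.coe_filter, Finset.mem_filter, Set.mem_ofPred_eq, Finset.mem_product]
          exact ⟨⟨⟨hx'.1, hy'.1⟩, hy.2⟩, hx'.2, hy'.2⟩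
        · rintro ⟨x, y⟩ _ ⟨x', y'⟩ _ h
          simp only [Prod.mk.injEq] at h
          obtain ⟨rfl, rfl⟩ := h
          rfl
      exact_mod_cast this
    have hZ2 : Z.card * (a/4) ≤ ∑ x ∈ Z, ((bp x).card : ℝ) := by
      rw [← nsmul_eq_mul]
      apply Finset.card_nsmul_le_sum
      intro x hx
      exact (not_le.mp (Finset.mem_filter.mp hx).2).le
    have hZ3 : (Z.card : ℝ) ≤ a/4 := by
      have : (Z.card : ℝ) * (a/4) ≤ (a/4) * (a/4) := by nlinarith
      exact le_of_mul_le_mul_right this (by positivity)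
    linarith
  refine ⟨A, hAA'.trans hA'S, by nlinarith, ?_⟩
  -- difference set
  have hrep : ∀ d ∈ A - A, ∃ p : ℤ × ℤ, p.1 ∈ A ∧ p.2 ∈ A ∧ p.1 - p.2 = d := by
    intro d hd
    obtain ⟨x, hx, y, hy, h⟩ := Finset.mem_sub.mp hd
    exact ⟨(x,y), hx, hy, h⟩
  choose! rp hrp1 hrp2 hrp3 using hrep
  set fib : ℤ → Finset (Σ _ : ℤ, ℤ × ℤ) := fun d =>
    (A'.filter (fun y => ¬ ((cod ((rp d).1, y)).card : ℝ) < ε*n ∧ ¬ ((cod ((rp d).2, y)).card : ℝ) < ε*n)).sigma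
      (fun y => cod ((rp d).1, y) ×ˢ cod ((rp d).2, y)) with hfib
  have hfc : ∀ d ∈ A - A, a/2 * ((ε*n) * (ε*n)) ≤ (fib d).card := by
    intro d hd
    set G := A'.filter (fun y => ¬ ((cod ((rp d).1, y)).card : ℝ) < ε*n ∧ ¬ ((cod ((rp d).2, y)).card : ℝ) < ε*n) with hG
    have hGc : a/2 ≤ G.card := by
      have hsub : A' ⊆ G ∪ (bp (rp d).1 ∪ bp (rp d).2) := by
        intro y hy
        simp only [hG, hbp, Finset.mem_union, Finset.mem_filter, hy, true_and]
        tauto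
      have h5 := Finset.card_le_card hsub
      have h6 := Finset.card_union_le G (bp (rp d).1 ∪ bp (rp d).2)
      have h7 := Finset.card_union_le (bp (rp d).1) (bp (rp d).2)
      have h8 : (A'.card : ℝ) ≤ G.card + ((bp (rp d).1).card + (bp (rp d).2).card) := by
        exact_mod_cast h5.trans (h6.trans (by omega))
      have h9 := (Finset.mem_filter.mp (hrp1 d hd)).2
      have h10 := (Finset.mem_filter.mp (hrp2 d hd)).2
      linarith
    have : ((fib d).card : ℝ) = ∑ y ∈ G, ((cod ((rp d).1, y)).card : ℝ) * (cod ((rp d).2, y)).card := by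
      rw [hfib]
      simp only [Finset.card_sigma, Finset.card_product]
      push_cast
      rfl
    rw [this]
    calc a/2 * ((ε*n) * (ε*n)) ≤ G.card * ((ε*n) * (ε*n)) := by gcongr
      _ = ∑ y ∈ G, (ε*n)*(ε*n) := by rw [Finset.sum_const, nsmul_eq_mul]
      _ ≤ _ := by
        apply Finset.sum_le_sum
        intro y hy
        have := (Finset.mem_filter.mp hy).2
        push Not at this
        apply mul_le_mul this.1 this.2 (by positivity) (by positivity)
  have hinj : ∑ d ∈ A - A, (fib d).card ≤ (D ×ˢ D ×ˢ D ×ˢ D).card := by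
    rw [← Finset.card_sigma]
    apply Finset.card_le_card_of_injOn (fun q => ((rp q.1).1 - q.2.2.1, q.2.1 - q.2.2.1, (rp q.1).2 - q.2.2.2, q.2.1 - q.2.2.2))
    · rintro ⟨d, y, b, b'⟩ hq
      simp only [Finset.coe_sigma, Set.mem_sigma_iff, Finset.mem_coe, hfib, Finset.mem_sigma, Finset.mem_product,
        hcod, Finset.mem_filter] at hq
      simp only [Finset.coe_product, Set.mem_prod, Finset.mem_coe]
      exact ⟨hq.2.2.1.2.1, hq.2.2.1.2.2, hq.2.2.2.2.1, hq.2.2.2.2.2⟩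
    · rintro ⟨d, y, b, b'⟩ hq ⟨d2, y2, b2, b2'⟩ hq2 h
      simp only [Finset.coe_sigma, Set.mem_sigma_iff, Finset.mem_coe] at hq hq2
      simp only [Prod.mk.injEq] at h
      have e1 := hrp3 d hq.1
      have e2 := hrp3 d2 hq2.1
      have : d = d2 := by omega
      subst this
      have : b = b2 := by omega
      subst this
      have : y = y2 := by omega
      subst this
      have : b' = b2' := by omega
      subst this
      rfl
  have hfinal : ((A - A).card : ℝ) * (a/2 * ((ε*n) * (ε*n))) ≤ (K*n)^4 := by
    calc ((A - A).card : ℝ) * (a/2 * ((ε*n) * (ε*n))) = ∑ d ∈ A - A, a/2 * ((ε*n) * (ε*n)) := by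
          rw [Finset.sum_const, nsmul_eq_mul]
      _ ≤ ∑ d ∈ A - A, ((fib d).card : ℝ) := Finset.sum_le_sum hfc
      _ ≤ ((D ×ˢ D ×ˢ D ×ˢ D).card : ℝ) := by exact_mod_cast hinj
      _ = (D.card : ℝ)^4 := by simp only [Finset.card_product]; push_cast; ring
      _ ≤ _ := by gcongr
  have h5 : ((A - A).card : ℝ) * (n / (4*K) * ((ε*n) * (ε*n))) ≤ (K*n)^4 := by
    refine le_trans ?_ hfinal
    have hna : n / (4*K) ≤ a/2 := by
      rw [div_le_iff₀ (by positivity)]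
      linarith
    exact mul_le_mul_of_nonneg_left (mul_le_mul_of_nonneg_right hna (by positivity)) (by positivity)
  have h6 : n / (4*K) * ((ε*n) * (ε*n)) = n^3 / (4096 * K^5) := by
    rw [hε]; field_simp; norm_num
  rw [h6] at h5
  have h7 : (K*n)^4 = 4096 * K^9 * n * (n^3 / (4096 * K^5)) := by field_simp
  rw [h7] at h5
  exact le_of_mul_le_mul_right h5 (by positivity)
end

section
open MeasureTheory Set Real
open scoped Pointwise

def PP (μ : ℕ → Measure ℝ) : ℕ → Measure ℝ
  | 0 => Measure.dirac 1
  | j+1 => ((PP μ j).prod (μ j)).map (fun z => z.1 * z.2)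

def ph (P : Measure ℝ) (ξ : ℝ) : ℂ := ∫ p, Complex.exp (Complex.I * ((ξ * p : ℝ):ℂ)) ∂P

structure Hy (μ : ℕ → Measure ℝ) (C : ℝ) : Prop where
  fin : ∀ j, IsFiniteMeasure (μ j)
  supp : ∀ j, μ j (Icc C⁻¹ C)ᶜ = 0
  mass : ∀ j, (μ j).real univ ≤ C

lemma PP_fin {μ : ℕ → Measure ℝ} (h : ∀ j, IsFiniteMeasure (μ j)) (j : ℕ) : IsFiniteMeasure (PP μ j) := by
  induction j with
  | zero => unfold PP; infer_instance
  | succ j ih =>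
    have := h j
    unfold PP
    infer_instance

lemma norm_e (t : ℝ) : ‖Complex.exp (Complex.I * (t:ℂ))‖ = 1 := by
  rw [mul_comm]; exact Complex.norm_exp_ofReal_mul_I t

lemma cont_e (ξ : ℝ) : Continuous (fun p : ℝ => Complex.exp (Complex.I * ((ξ * p : ℝ):ℂ))) := by fun_prop

lemma int_e (P : Measure ℝ) [IsFiniteMeasure P] (ξ : ℝ) :
    Integrable (fun p : ℝ => Complex.exp (Complex.I * ((ξ * p : ℝ):ℂ))) P := by
  apply Integrable.of_bound (cont_e ξ).aestronglyMeasurable 1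
  filter_upwards with p
  rw [norm_e]

lemma PP_mass {μ : ℕ → Measure ℝ} {C : ℝ} (h : Hy μ C) (hC : 1 ≤ C) (j : ℕ) : (PP μ j).real univ ≤ C^j := by
  have := h.fin
  have := PP_fin h.fin
  induction j with
  | zero => simp [PP]
  | succ j ih =>
    unfold PP
    rw [map_measureReal_apply (by fun_prop) MeasurableSet.univ, preimage_univ, ← univ_prod_univ, measureReal_prod_prod, pow_succ]
    exact mul_le_mul ih (h.mass j) (by positivity) (by positivity)

lemma PP_supp {μ : ℕ → Measure ℝ} {C : ℝ} (h : Hy μ C) (hC : 1 ≤ C) (j : ℕ) :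
    ∀ᵐ p ∂(PP μ j), p ∈ Icc (C^j)⁻¹ (C^j) := by
  have := h.fin
  have := PP_fin h.fin
  induction j with
  | zero =>
    unfold PP
    rw [ae_dirac_iff (by exact measurableSet_Icc)]
    simp
  | succ j ih =>
    unfold PP
    rw [ae_map_iff (by fun_prop) (by exact measurableSet_Icc)]
    have h1 : ∀ᵐ z ∂((PP μ j).prod (μ j)), z.1 ∈ Icc (C^j)⁻¹ (C^j) :=
      Measure.quasiMeasurePreserving_fst.ae ih
    have h2 : ∀ᵐ x ∂(μ j), x ∈ Icc C⁻¹ C := by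
      rw [ae_iff]; exact h.supp j
    have h3 : ∀ᵐ z ∂((PP μ j).prod (μ j)), z.2 ∈ Icc C⁻¹ C :=
      Measure.quasiMeasurePreserving_snd.ae h2
    filter_upwards [h1, h3] with z hz1 hz2
    have hC0 : 0 < C := by linarith
    constructor
    · rw [pow_succ, mul_inv]
      exact mul_le_mul hz1.1 hz2.1 (by positivity) (le_trans (by positivity) hz1.1)
    · rw [pow_succ]
      exact mul_le_mul hz1.2 hz2.2 (le_trans (by positivity) hz2.1) (by positivity)

lemma ph_succ {μ : ℕ → Measure ℝ} (h : ∀ j, IsFiniteMeasure (μ j)) (j : ℕ) (ξ : ℝ) :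
    ph (PP μ (j+1)) ξ = ∫ x, ph (PP μ j) (x * ξ) ∂(μ j) := by
  have := PP_fin h
  unfold ph
  rw [show PP μ (j+1) = ((PP μ j).prod (μ j)).map (fun z => z.1 * z.2) from rfl]
  rw [integral_map (by fun_prop) (cont_e ξ).aestronglyMeasurable]
  rw [integral_prod_symm]
  · congr 1
    ext x
    congr 1
    ext p
    congr 3
    ring
  · apply Integrable.of_bound (Continuous.aestronglyMeasurable (by fun_prop)) 1
    filter_upwards with p
    rw [norm_e]

lemma ph_le (P : Measure ℝ) [IsFiniteMeasure P] (ξ : ℝ) : ‖ph P ξ‖ ≤ P.real univ := by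
  unfold ph
  refine (norm_integral_le_of_norm_le_const (C := 1) ?_).trans (by simp)
  filter_upwards with p
  rw [norm_e]

lemma ph_lip (P : Measure ℝ) [IsFiniteMeasure P] (D : ℝ) (hD : P.real univ ≤ D) (hs : ∀ᵐ p ∂P, |p| ≤ D) (hD0 : 0 ≤ D) (ξ ξ' : ℝ) :
    ‖ph P ξ - ph P ξ'‖ ≤ D * D * |ξ - ξ'| := by
  unfold ph
  rw [← integral_sub (int_e P ξ) (int_e P ξ')]
  refine (norm_integral_le_of_norm_le_const (C := D * |ξ - ξ'|) ?_).trans ?_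
  · filter_upwards [hs] with p hp
    have : Complex.exp (Complex.I * ((ξ * p : ℝ):ℂ)) - Complex.exp (Complex.I * ((ξ' * p : ℝ):ℂ))
        = Complex.exp (Complex.I * ((ξ' * p : ℝ):ℂ)) * (Complex.exp (Complex.I * (((ξ - ξ') * p : ℝ):ℂ)) - 1) := by
      rw [mul_sub, ← Complex.exp_add, mul_one]
      congr 2
      push_cast; ring
    rw [this, norm_mul, norm_e, one_mul]
    refine (Real.norm_exp_I_mul_ofReal_sub_one_le).trans ?_
    rw [Real.norm_eq_abs, abs_mul, mul_comm]
    gcongr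
  · have : 0 ≤ |ξ - ξ'| := abs_nonneg _
    calc D * |ξ - ξ'| * P.real univ ≤ D * |ξ - ξ'| * D := by gcongr
      _ = _ := by ring

lemma pi_map_PP {μ : ℕ → Measure ℝ} (h : ∀ j, IsFiniteMeasure (μ j)) (k : ℕ) :
    (Measure.pi (fun i : Fin k => μ i)).map (fun x => ∏ i, x i) = PP μ k := by
  have := PP_fin h
  induction k with
  | zero =>
    have hm : Measurable (fun x : Fin 0 → ℝ => ∏ i, x i) := by fun_prop
    rw [Measure.pi_of_empty, Measure.map_dirac' hm]
    simp [PP]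
  | succ k ih =>
    have hmp := measurePreserving_piFinSuccAbove (fun i : Fin (k+1) => μ i) (Fin.last k)
    rw [show PP μ (k+1) = ((PP μ k).prod (μ k)).map (fun z => z.1 * z.2) from rfl]
    rw [← ih]
    have hm : Measurable (fun x : Fin k → ℝ => ∏ i, x i) := by fun_prop
    have e1 : (Measure.map (fun x : Fin k → ℝ => ∏ i, x i) (Measure.pi (fun i : Fin k => μ i))).prod (μ k)
        = Measure.map (Prod.map (fun x : Fin k → ℝ => ∏ i, x i) id) ((Measure.pi (fun i : Fin k => μ i)).prod (μ k)) := by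
      rw [← Measure.map_prod_map _ _ hm measurable_id, Measure.map_id]
    rw [e1, Measure.map_map (by fun_prop) (by fun_prop)]
    have e2 : (Measure.pi (fun i : Fin k => μ i)).prod (μ k)
        = Measure.map Prod.swap ((μ k).prod (Measure.pi (fun i : Fin k => μ i))) := by
      rw [Measure.prod_swap]
    rw [e2, Measure.map_map (by fun_prop) (by fun_prop)]
    have e3 := hmp.map_eq
    simp only [Fin.succAbove_last, Fin.val_castSucc, Fin.val_last] at e3
    rw [← e3, Measure.map_map (by fun_prop) (by fun_prop)]
    congr 1
    ext x
    simp [Fin.prod_univ_castSucc, MeasurableEquiv.piFinSuccAbove, Fin.init]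
end

section
open MeasureTheory Set Real
open scoped Pointwise

lemma fl_fib (A : Finset ℤ) (C x : ℝ) (hC : 1 ≤ C) (hx : C⁻¹ ≤ x) (t : ℤ) :
    ((A.filter (fun a : ℤ => ⌊x * a⌋ = t)).card : ℝ) ≤ C + 1 := by
  apply int_card_le _ C (by linarith)
  intro a ha b hb
  have h1 := (Finset.mem_filter.mp ha).2
  have h2 := (Finset.mem_filter.mp hb).2
  rw [Int.floor_eq_iff] at h1 h2
  have hC0 : 0 < C := by linarith
  have hx0 : 0 < x := lt_of_lt_of_le (by positivity) hx
  have h3 : x * |(a:ℝ) - b| ≤ 1 := by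
    rw [← abs_of_pos hx0, ← abs_mul, abs_le]
    constructor <;> linarith [h1.1, h1.2, h2.1, h2.2]
  have h4 : C⁻¹ * |(a:ℝ) - b| ≤ 1 := le_trans (by gcongr) h3
  rwa [inv_mul_le_iff₀ hC0, mul_one] at h4

lemma meas_fl (a : ℤ) (T : Set ℤ) : MeasurableSet {x : ℝ | ⌊x * a⌋ ∈ T} := by
  have : Measurable (fun x : ℝ => ⌊x * a⌋) := Int.measurable_floor.comp (by fun_prop)
  exact this (MeasurableSet.of_discrete)

def indi (a : ℤ) (T : Set ℤ) (x : ℝ) : ℝ := {x : ℝ | ⌊x * a⌋ ∈ T}.indicator 1 x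

lemma indi_int (μ : Measure ℝ) (a : ℤ) (T : Set ℤ) : ∫ x, indi a T x ∂μ = μ.real {x : ℝ | ⌊x * a⌋ ∈ T} := by
  unfold indi
  exact integral_indicator_one (meas_fl a T)

lemma indi_integrable (μ : Measure ℝ) [IsFiniteMeasure μ] (a : ℤ) (T : Set ℤ) : Integrable (indi a T) μ :=
  (integrable_const (1:ℝ)).indicator (meas_fl a T)

lemma indi_nonneg (a : ℤ) (T : Set ℤ) (x : ℝ) : 0 ≤ indi a T x := by
  unfold indi
  apply Set.indicator_nonneg; intros; simp

lemma indi_sum (A : Finset ℤ) (T : Set ℤ) [DecidablePred (· ∈ T)] (x : ℝ) :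
    ∑ a ∈ A, indi a T x = ((A.filter (fun a : ℤ => ⌊x * a⌋ ∈ T)).card : ℝ) := by
  rw [Finset.card_filter]
  push_cast
  apply Finset.sum_congr rfl
  intro a _
  unfold indi
  simp [Set.indicator_apply]

lemma M1 (μ : Measure ℝ) [IsFiniteMeasure μ] (C : ℝ) (hC : 1 ≤ C) (hs : ∀ᵐ x ∂μ, x ∈ Icc C⁻¹ C)
    (hm : μ.real univ ≤ C) (S T : Finset ℤ) (β : ℝ)
    (hβ : ∀ a ∈ S, β ≤ μ.real {x : ℝ | ⌊x * a⌋ ∈ (T : Set ℤ)}) : β * S.card ≤ C * (C+1) * T.card := by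
  classical
  calc β * S.card = ∑ a ∈ S, β := by rw [Finset.sum_const, nsmul_eq_mul, mul_comm]
    _ ≤ ∑ a ∈ S, ∫ x, indi a T x ∂μ := by
      apply Finset.sum_le_sum
      intro a ha
      rw [indi_int]; exact hβ a ha
    _ = ∫ x, ∑ a ∈ S, indi a T x ∂μ := by
      rw [integral_finsetSum]
      intro a _; exact indi_integrable μ a T
    _ ≤ ∫ x, (C+1) * T.card ∂μ := by
      apply integral_mono_ae
      · exact integrable_finsetSum _ (fun a _ => indi_integrable μ a T)
      · exact integrable_const _
      · filter_upwards [hs] with x hx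
        rw [indi_sum]
        have : (S.filter (fun a : ℤ => ⌊x * a⌋ ∈ (T : Set ℤ))).card = ∑ t ∈ T, ((S.filter (fun a : ℤ => ⌊x * a⌋ ∈ (T : Set ℤ))).filter (fun a : ℤ => ⌊x * a⌋ = t)).card := by
          apply Finset.card_eq_sum_card_fiberwise
          intro a ha
          have := (Finset.mem_filter.mp (Finset.mem_coe.mp ha)).2
          exact this
        rw [this]
        push_cast
        calc _ ≤ ∑ t ∈ T, (C+1) := Finset.sum_le_sum (fun t _ => fl_fib _ C x hC hx.1 t)
          _ = _ := by rw [Finset.sum_const, nsmul_eq_mul, mul_comm]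
    _ = μ.real univ * ((C+1) * T.card) := by rw [integral_const, smul_eq_mul]
    _ ≤ C * ((C+1) * T.card) := by gcongr
    _ = _ := by ring

lemma avg_exists (μ : Measure ℝ) [IsFiniteMeasure μ] (C q : ℝ) (hC : 1 ≤ C) (hs : ∀ᵐ x ∂μ, x ∈ Icc C⁻¹ C)
    (hm : μ.real univ ≤ C) (F : ℝ → ℝ) (hF : Integrable F μ) (hq : 0 < q) (h : 2 * C * q ≤ ∫ x, F x ∂μ) :
    ∃ x ∈ Icc C⁻¹ C, q ≤ F x := by
  by_contra hcon
  push Not at hcon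
  have : ∫ x, F x ∂μ ≤ ∫ x, q ∂μ := by
    apply integral_mono_ae hF (integrable_const _)
    filter_upwards [hs] with x hx using (hcon x hx).le
  rw [integral_const, smul_eq_mul] at this
  nlinarith

lemma M2 (μ : Measure ℝ) [IsFiniteMeasure μ] (C : ℝ) (hC : 1 ≤ C) (hs : ∀ᵐ x ∂μ, x ∈ Icc C⁻¹ C)
    (hm : μ.real univ ≤ C) (A T : Finset ℤ) (hA : A.Nonempty) (hT : T.Nonempty) (β : ℝ) (hβ0 : 0 < β)
    (hβ : ∀ a ∈ A, β ≤ μ.real {x : ℝ | ⌊x * a⌋ ∈ (T : Set ℤ)}) (ω : ℝ)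
    (hω : ω = β^2 * A.card / (4 * C^2 * (C+1) * T.card)) :
    ∃ x' ∈ Icc C⁻¹ C, ∃ Y0 ⊆ Icc C⁻¹ C, ω ≤ μ.real Y0 ∧
      ∀ x ∈ Y0, ω * A.card ≤ ((A.filter (fun a : ℤ => ∃ a' ∈ A, ⌊x * a⌋ = ⌊x' * a'⌋)).card : ℝ) := by
  classical
  have hC0 : 0 < C := by linarith
  have hA0 : (0:ℝ) < A.card := by exact_mod_cast Finset.card_pos.mpr hA
  have hT0 : (0:ℝ) < T.card := by exact_mod_cast Finset.card_pos.mpr hT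
  have hω0 : 0 < ω := by rw [hω]; positivity
  set f : ℤ → ℝ → ℝ := fun t x => ∑ a ∈ A, indi a {t} x with hf
  have hfi : ∀ t, Integrable (f t) μ := fun t => integrable_finsetSum _ (fun a _ => indi_integrable μ a _)
  have hf0 : ∀ t x, 0 ≤ f t x := fun t x => Finset.sum_nonneg (fun a _ => indi_nonneg a _ x)
  have hfc : ∀ t x, f t x = ((A.filter (fun a : ℤ => ⌊x * a⌋ = t)).card : ℝ) := by
    intro t x
    simp only [hf]
    rw [indi_sum]
    congr 2
  set g : ℤ → ℝ := fun t => ∫ x, f t x ∂μ with hg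
  have hgsum : β * A.card ≤ ∑ t ∈ T, g t := by
    have e : ∑ t ∈ T, g t = ∑ a ∈ A, μ.real {x : ℝ | ⌊x * a⌋ ∈ (T : Set ℤ)} := by
      simp only [hg]
      rw [← integral_finsetSum _ (fun t _ => hfi t)]
      simp only [hf]
      have : ∀ x, ∑ t ∈ T, ∑ a ∈ A, indi a {t} x = ∑ a ∈ A, indi a T x := by
        intro x
        rw [Finset.sum_comm]
        apply Finset.sum_congr rfl
        intro a _
        simp [indi, Set.indicator_apply]
      simp_rw [this]
      rw [integral_finsetSum _ (fun a _ => indi_integrable μ a _)]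
      simp_rw [indi_int]
    rw [e]
    calc β * A.card = ∑ a ∈ A, β := by rw [Finset.sum_const, nsmul_eq_mul, mul_comm]
      _ ≤ _ := Finset.sum_le_sum hβ
  have hcs : (β * A.card)^2 ≤ T.card * ∑ t ∈ T, g t ^ 2 :=
    (pow_le_pow_left₀ (by positivity) hgsum 2).trans sq_sum_le_card_mul_sum_sq
  set q : ℝ := (β * A.card)^2 / (2 * C * T.card) with hq
  have hq0 : 0 < q := by positivity
  obtain ⟨x', hx', hqx⟩ := avg_exists μ C q hC hs hm (fun x => ∑ t ∈ T, g t * f t x)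
    (integrable_finsetSum _ (fun t _ => (hfi t).const_mul _)) hq0 (by
      rw [integral_finsetSum _ (fun t _ => (hfi t).const_mul _)]
      simp_rw [integral_const_mul]
      have : ∑ t ∈ T, g t * ∫ x, f t x ∂μ = ∑ t ∈ T, g t ^ 2 := by
        apply Finset.sum_congr rfl; intro t _; rw [sq]
      rw [this]
      have e : 2 * C * q = (β * A.card)^2 / T.card := by rw [hq]; field_simp
      rw [e, div_le_iff₀ hT0]
      linarith)
  set I' : Set ℤ := {t | ∃ a' ∈ A, t = ⌊x' * a'⌋} with hI'
  set V : ℝ → ℝ := fun x => ∑ a ∈ A, indi a I' x with hV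
  have hVi : Integrable V μ := integrable_finsetSum _ (fun a _ => indi_integrable μ a _)
  have hVc : ∀ x, V x = ((A.filter (fun a : ℤ => ∃ a' ∈ A, ⌊x * a⌋ = ⌊x' * a'⌋)).card : ℝ) := by
    intro x
    simp only [hV]
    rw [indi_sum]
    congr 2
  have hVA : ∀ x, V x ≤ A.card := by
    intro x; rw [hVc]; exact_mod_cast Finset.card_filter_le _ _
  have hVq : q ≤ (C+1) * ∫ x, V x ∂μ := by
    have e : ∑ t ∈ T, g t * f t x' = ∫ x, ∑ t ∈ T, f t x * f t x' ∂μ := by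
      rw [integral_finsetSum _ (fun t _ => (hfi t).mul_const _)]
      simp_rw [integral_mul_const]
      rfl
    rw [e] at hqx
    refine hqx.trans ?_
    rw [← integral_const_mul]
    apply integral_mono (integrable_finsetSum _ (fun t _ => (hfi t).mul_const _)) (hVi.const_mul _)
    intro x
    show ∑ t ∈ T, f t x * f t x' ≤ (C+1) * V x
    have h1 : ∀ t ∈ T, f t x * f t x' ≤ (C+1) * ((((A.filter (fun a : ℤ => ∃ a' ∈ A, ⌊x * a⌋ = ⌊x' * a'⌋))).filter (fun a : ℤ => ⌊x * a⌋ = t)).card : ℝ) := by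
      intro t _
      by_cases h0 : f t x' = 0
      · rw [h0, mul_zero]; positivity
      · have h2 : f t x' ≤ C + 1 := by rw [hfc]; exact fl_fib A C x' hC hx'.1 t
        rw [hfc t x'] at h0
        have : (A.filter (fun a : ℤ => ⌊x' * a⌋ = t)).Nonempty := by
          rw [← Finset.card_pos]
          exact Nat.pos_of_ne_zero (by exact_mod_cast h0)
        obtain ⟨a', ha'⟩ := this
        have ha'' := Finset.mem_filter.mp ha'
        rw [mul_comm]
        apply mul_le_mul h2 _ (hf0 _ _) (by linarith)
        rw [hfc]
        norm_cast
        apply Finset.card_le_card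
        intro a ha
        have hax := Finset.mem_filter.mp ha
        simp only [Finset.mem_filter]
        exact ⟨⟨hax.1, a', ha''.1, by rw [hax.2, ha''.2]⟩, hax.2⟩
    refine (Finset.sum_le_sum h1).trans ?_
    rw [← Finset.mul_sum, hVc]
    gcongr
    norm_cast
    rw [← Finset.card_biUnion]
    · apply Finset.card_le_card
      intro a ha
      obtain ⟨t, _, h2⟩ := Finset.mem_biUnion.mp ha
      exact (Finset.mem_filter.mp h2).1
    · intro t _ t' _ htt
      rw [Function.onFun, Finset.disjoint_left]
      intro a ha ha'
      exact htt ((Finset.mem_filter.mp ha).2.symm.trans (Finset.mem_filter.mp ha').2)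
  have hVm : Measurable V := by
    simp only [hV]
    apply Finset.measurable_sum
    intro a _
    unfold indi
    exact measurable_one.indicator (meas_fl a I')
  set Y0 : Set ℝ := {x | ω * A.card ≤ V x} ∩ Icc C⁻¹ C with hY0
  have hY0m : MeasurableSet Y0 := (measurableSet_le measurable_const hVm).inter measurableSet_Icc
  refine ⟨x', hx', Y0, inter_subset_right, ?_, ?_⟩
  · have h1 : ∫ x, V x ∂μ ≤ ∫ x, (Y0.indicator (fun _ => (A.card:ℝ)) x + ω * A.card) ∂μ := by
      apply integral_mono_ae hVi
      · exact ((integrable_const _).indicator hY0m).add (integrable_const _)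
      · filter_upwards [hs] with x hx
        by_cases h : x ∈ Y0
        · rw [Set.indicator_of_mem h]
          have := hVA x
          have : 0 ≤ ω * A.card := by positivity
          linarith
        · rw [Set.indicator_of_notMem h, zero_add]
          by_contra hcon
          push Not at hcon
          exact h ⟨hcon.le, hx⟩
    rw [integral_add ((integrable_const _).indicator hY0m) (integrable_const _), integral_indicator_const _ hY0m, integral_const,
      smul_eq_mul, smul_eq_mul] at h1
    have h2 : q ≤ (C+1) * (μ.real Y0 * A.card + C * (ω * A.card)) := by
      refine hVq.trans ?_
      gcongr
      refine h1.trans ?_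
      gcongr
    have h3 : q = 2 * (C+1) * C * ω * A.card := by
      rw [hq, hω]; field_simp; norm_num
    rw [h3] at h2
    have h4 : C * ω ≤ μ.real Y0 := by
      have : (C+1) * A.card * (C * ω) ≤ (C+1) * A.card * μ.real Y0 := by nlinarith
      exact le_of_mul_le_mul_left this (by positivity)
    nlinarith
  · intro x hx
    rw [← hVc]; exact hx.1
end

section
open MeasureTheory Set Real
open scoped Pointwise

open Classical in
def Sp (φ : ℝ → ℂ) (h τ L : ℝ) : Finset ℤ :=
  (Finset.Icc ⌈-L⌉ ⌊L⌋).filter (fun a : ℤ => τ ≤ ‖φ (h * a)‖)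

lemma Sp_mem {φ : ℝ → ℂ} {h τ L : ℝ} {a : ℤ} : a ∈ Sp φ h τ L ↔ |(a:ℝ)| ≤ L ∧ τ ≤ ‖φ (h * a)‖ := by
  unfold Sp
  rw [Finset.mem_filter, Finset.mem_Icc, Int.ceil_le, Int.le_floor, abs_le]

lemma Sp_card (φ : ℝ → ℂ) (h τ L : ℝ) (hL : 0 ≤ L) : ((Sp φ h τ L).card : ℝ) ≤ 2 * L + 1 := by
  apply int_card_le _ (2*L) (by linarith)
  intro x hx y hy
  have h1 := (Sp_mem.mp hx).1
  have h2 := (Sp_mem.mp hy).1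
  rw [abs_le] at *
  constructor <;> linarith [h1.1, h1.2, h2.1, h2.2]

lemma mult_step (μ : Measure ℝ) [IsFiniteMeasure μ] (C : ℝ) (hC : 1 ≤ C) (hs : ∀ᵐ x ∂μ, x ∈ Icc C⁻¹ C)
    (hm : μ.real univ ≤ C) (φ : ℝ → ℂ) (D D2 : ℝ) (hD : 0 < D) (hb : ∀ ξ, ‖φ ξ‖ ≤ D)
    (hD2 : 0 ≤ D2)
    (hl : ∀ ξ ξ', ‖φ ξ - φ ξ'‖ ≤ D2 * |ξ - ξ'|) (h τ τ' L L' : ℝ) (hτ0 : 0 ≤ τ') (hh : 0 < h) (hτ : 4 * C * τ' ≤ τ)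
    (hhτ : 4 * C * (D2 * h) ≤ τ) (hL : C * L + 1 ≤ L') (a : ℤ) (haL : |(a:ℝ)| ≤ L)
    (ha : τ ≤ ‖∫ x, φ (x * (h * a)) ∂μ‖) :
    τ / (2 * D) ≤ μ.real {x : ℝ | ⌊x * a⌋ ∈ (Sp φ h τ' L' : Set ℤ)} := by
  have hC0 : 0 < C := by linarith
  set X := {x : ℝ | ⌊x * a⌋ ∈ (Sp φ h τ' L' : Set ℤ)} with hX
  have hXm : MeasurableSet X := meas_fl a _
  have hφc : Continuous φ := by
    have : LipschitzWith (Real.toNNReal D2) φ := by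
      apply LipschitzWith.of_dist_le_mul
      intro x y
      rw [dist_eq_norm, Real.dist_eq, Real.coe_toNNReal _ hD2]
      exact hl x y
    exact this.continuous
  have h1 : ‖∫ x, φ (x * (h * a)) ∂μ‖ ≤ ∫ x, (X.indicator (fun _ => D) x + (τ' + D2 * h)) ∂μ := by
    refine (norm_integral_le_integral_norm _).trans ?_
    apply integral_mono_ae
    · apply Integrable.of_bound (Continuous.aestronglyMeasurable (by fun_prop)) D
      filter_upwards with x
      simpa using hb _
    · exact ((integrable_const _).indicator hXm).add (integrable_const _)
    · filter_upwards [hs] with x hx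
      have h3 : ‖φ (x * (h * a))‖ ≤ ‖φ (h * (⌊x * a⌋ : ℤ))‖ + D2 * h := by
        have h4 := hl (x * (h * a)) (h * (⌊x * a⌋ : ℤ))
        have h5 : |x * (h * a) - h * (⌊x * a⌋ : ℤ)| ≤ h := by
          rw [show x * (h * a) - h * (⌊x * a⌋ : ℤ) = h * (x * a - (⌊x * a⌋ : ℤ)) by ring, abs_mul, abs_of_pos hh]
          have h6 := Int.floor_le (x * a)
          have h7 := Int.lt_floor_add_one (x * a)
          have : |x * a - (⌊x * a⌋ : ℤ)| ≤ 1 := by rw [abs_le]; constructor <;> linarith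
          nlinarith
        have h6 : ‖φ (x * (h * a))‖ ≤ ‖φ (h * (⌊x * a⌋ : ℤ))‖ + ‖φ (x * (h * a)) - φ (h * (⌊x * a⌋ : ℤ))‖ := by
          have := norm_add_le (φ (h * (⌊x * a⌋ : ℤ))) (φ (x * (h * a)) - φ (h * (⌊x * a⌋ : ℤ)))
          simpa using this
        have : D2 * |x * (h * a) - h * (⌊x * a⌋ : ℤ)| ≤ D2 * h := by gcongr
        linarith
      by_cases hxX : x ∈ X
      · rw [Set.indicator_of_mem hxX]
        have := hb (x * (h * a))
        have : 0 ≤ D2 * h := by positivity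
        linarith
      · rw [Set.indicator_of_notMem hxX, zero_add]
        have h8 : ¬ (|((⌊x * a⌋ : ℤ):ℝ)| ≤ L' ∧ τ' ≤ ‖φ (h * (⌊x * a⌋ : ℤ))‖) := by
          intro hcon
          exact hxX (Sp_mem.mpr hcon)
        have h9 : |((⌊x * a⌋ : ℤ):ℝ)| ≤ L' := by
          have h6 := Int.floor_le (x * a)
          have h7 := Int.lt_floor_add_one (x * a)
          have h10 : |x * a| ≤ C * L := by
            rw [abs_mul]
            have hx0 : 0 < x := lt_of_lt_of_le (by positivity) hx.1
            rw [abs_of_pos hx0]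
            exact mul_le_mul hx.2 haL (abs_nonneg _) hC0.le
          rw [abs_le] at h10 ⊢
          constructor <;> linarith [h10.1, h10.2]
        have h11 : ‖φ (h * (⌊x * a⌋ : ℤ))‖ < τ' := by
          by_contra hcon
          exact h8 ⟨h9, not_lt.mp hcon⟩
        linarith
  rw [integral_add ((integrable_const _).indicator hXm) (integrable_const _), integral_indicator_const _ hXm, integral_const,
      smul_eq_mul, smul_eq_mul] at h1
  have h2 : μ.real univ * (τ' + D2 * h) ≤ C * (τ' + D2 * h) := mul_le_mul_of_nonneg_right hm (by positivity)
  rw [div_le_iff₀ (by positivity)]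
  have h5 : C * (τ' + D2 * h) = (4 * C * τ') / 4 + (4 * C * (D2 * h)) / 4 := by ring
  linarith
end

section
open MeasureTheory Set Real
open scoped Pointwise

lemma cs_int (P : Measure ℝ) [IsFiniteMeasure P] (F : ℝ → ℂ) (hF : Continuous F) (B : ℝ) (hB : ∀ p, ‖F p‖ ≤ B) :
    ‖∫ p, F p ∂P‖^2 ≤ P.real univ * ∫ p, ‖F p‖^2 ∂P := by
  have hB0 : 0 ≤ B := (norm_nonneg _).trans (hB 0)
  have i1 : Integrable (fun p => ‖F p‖) P := by
    apply Integrable.of_bound hF.norm.aestronglyMeasurable B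
    filter_upwards with x; simpa using hB x
  have i2 : Integrable (fun p => ‖F p‖^2) P := by
    apply Integrable.of_bound (hF.norm.pow 2).aestronglyMeasurable (B^2)
    filter_upwards with x
    simpa using pow_le_pow_left₀ (norm_nonneg _) (hB x) 2
  set m := P.real univ with hm
  set A := ∫ p, ‖F p‖ ∂P with hA
  set J := ∫ p, ‖F p‖^2 ∂P with hJ
  have h0 : ‖∫ p, F p ∂P‖ ≤ A := norm_integral_le_integral_norm _
  have h1 : ‖∫ p, F p ∂P‖^2 ≤ A^2 := pow_le_pow_left₀ (norm_nonneg _) h0 2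
  refine h1.trans ?_
  have hm0 : 0 ≤ m := measureReal_nonneg
  have h2 : 0 ≤ ∫ p, (m * ‖F p‖ - A)^2 ∂P := integral_nonneg (fun p => sq_nonneg _)
  have h3 : ∫ p, (m * ‖F p‖ - A)^2 ∂P = m^2 * J - 2 * m * A * A + m * A^2 := by
    have : (fun p => (m * ‖F p‖ - A)^2) = (fun p => m^2 * ‖F p‖^2 - (2 * m * A) * ‖F p‖ + A^2) := by
      ext p; ring
    have i3 : Integrable (fun p => m^2 * ‖F p‖^2 - (2 * m * A) * ‖F p‖) P := (i2.const_mul _).sub (i1.const_mul _)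
    rw [this, integral_add i3 (integrable_const _),
      integral_sub (i2.const_mul _) (i1.const_mul _), integral_const_mul, integral_const_mul, integral_const, smul_eq_mul]
  rcases hm0.eq_or_lt with h4 | h4
  · have hz : P = 0 := by
      rw [← Measure.measure_univ_eq_zero]
      have := h4.symm
      rw [hm, measureReal_eq_zero_iff] at this
      exact this
    have : A = 0 := by rw [hA, hz]; simp
    rw [this, ← h4]; simp
  · rw [h3] at h2
    have : 0 ≤ m * (m * J - A^2) := by linarith
    have := nonneg_of_mul_nonneg_right this h4
    linarith

lemma ph_conj (P : Measure ℝ) (ξ : ℝ) : (starRingEnd ℂ) (ph P ξ) = ph P (-ξ) := by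
  unfold ph
  rw [← integral_conj]
  congr 1; ext p
  rw [← Complex.exp_conj]
  congr 1
  simp

lemma add_lem (P : Measure ℝ) [IsFiniteMeasure P] (D : ℝ) (hD : P.real univ ≤ D) (S : Finset ℤ) (h τ : ℝ) (hτ0 : 0 ≤ τ)
    (hS : ∀ a ∈ S, τ ≤ ‖ph P (h * a)‖) :
    τ^2 * (S.card:ℝ)^2 ≤ D * ∑ p ∈ S ×ˢ S, ‖ph P (h * ((p.1 - p.2 : ℤ):ℝ))‖ := by
  have hu : ∀ a : ℤ, ∃ c : ℂ, ‖c‖ ≤ 1 ∧ c * ph P (h * a) = (‖ph P (h * a)‖ : ℂ) := by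
    intro a
    by_cases hz : ph P (h * a) = 0
    · exact ⟨0, by simp, by simp [hz]⟩
    · refine ⟨(‖ph P (h * a)‖ : ℂ) / ph P (h * a), ?_, ?_⟩
      · rw [norm_div]; simp [hz]
      · field_simp
  choose c hc1 hc2 using hu
  set F : ℝ → ℂ := fun p => ∑ a ∈ S, c a * Complex.exp (Complex.I * ((h * a * p : ℝ):ℂ)) with hF
  have hFc : Continuous F := by
    rw [hF]; fun_prop
  have hFb : ∀ p, ‖F p‖ ≤ S.card := by
    intro p
    refine (norm_sum_le _ _).trans ?_
    calc _ ≤ ∑ a ∈ S, (1:ℝ) := by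
          apply Finset.sum_le_sum
          intro a _
          rw [norm_mul, norm_e, mul_one]; exact hc1 a
      _ = S.card := by simp
  have h1 := cs_int P F hFc _ hFb
  have h2 : ∫ p, F p ∂P = ((∑ a ∈ S, ‖ph P (h * a)‖ : ℝ) : ℂ) := by
    rw [hF, integral_finsetSum]
    · rw [Complex.ofReal_sum]
      apply Finset.sum_congr rfl
      intro a _
      rw [integral_const_mul, ← hc2 a]; rfl
    · intro a _
      exact (int_e P (h * a)).const_mul _
  have h3 : τ * S.card ≤ ‖∫ p, F p ∂P‖ := by
    rw [h2, Complex.norm_real, Real.norm_eq_abs]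
    refine le_trans ?_ (le_abs_self _)
    rw [mul_comm, ← nsmul_eq_mul]
    exact Finset.card_nsmul_le_sum _ _ _ hS
  have h4 : ((∫ p, ‖F p‖^2 ∂P : ℝ):ℂ) = ∑ q ∈ S ×ˢ S, c q.1 * (starRingEnd ℂ) (c q.2) * ph P (h * ((q.1 - q.2 : ℤ):ℝ)) := by
    rw [← integral_complex_ofReal]
    have : ∀ p, ((‖F p‖^2 : ℝ):ℂ) = ∑ q ∈ S ×ˢ S, c q.1 * (starRingEnd ℂ) (c q.2) * Complex.exp (Complex.I * ((h * ((q.1 - q.2 : ℤ):ℝ) * p : ℝ):ℂ)) := by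
      intro p
      have e1 : ((‖F p‖^2 : ℝ):ℂ) = F p * (starRingEnd ℂ) (F p) := by
        rw [Complex.mul_conj, Complex.normSq_eq_norm_sq]
      rw [e1, hF]
      simp only [map_sum]
      rw [Finset.sum_mul_sum, ← Finset.sum_product']
      apply Finset.sum_congr rfl
      intro q _
      rw [map_mul, ← Complex.exp_conj]
      rw [show Complex.exp (Complex.I * ((h * ((q.1 - q.2 : ℤ):ℝ) * p : ℝ):ℂ)) = Complex.exp (Complex.I * ((h * q.1 * p : ℝ):ℂ)) * Complex.exp ((starRingEnd ℂ) (Complex.I * ((h * q.2 * p : ℝ):ℂ))) by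
        rw [← Complex.exp_add]; congr 1; simp; ring]
      ring
    simp_rw [this]
    rw [integral_finsetSum]
    · apply Finset.sum_congr rfl
      intro q _
      rw [integral_const_mul]; rfl
    · intro q _
      exact (int_e P _).const_mul _
  have h5 : ∫ p, ‖F p‖^2 ∂P ≤ ∑ q ∈ S ×ˢ S, ‖ph P (h * ((q.1 - q.2 : ℤ):ℝ))‖ := by
    have : ‖((∫ p, ‖F p‖^2 ∂P : ℝ):ℂ)‖ ≤ ∑ q ∈ S ×ˢ S, ‖ph P (h * ((q.1 - q.2 : ℤ):ℝ))‖ := by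
      rw [h4]
      refine (norm_sum_le _ _).trans ?_
      apply Finset.sum_le_sum
      intro q _
      rw [norm_mul, norm_mul, RCLike.norm_conj]
      have := mul_le_one₀ (hc1 q.1) (norm_nonneg _) (hc1 q.2)
      exact mul_le_of_le_one_left (norm_nonneg _) this
    rw [Complex.norm_real] at this
    exact (le_abs_self _).trans this
  calc τ^2 * (S.card:ℝ)^2 = (τ * S.card)^2 := by ring
    _ ≤ ‖∫ p, F p ∂P‖^2 := pow_le_pow_left₀ (by positivity) h3 2
    _ ≤ _ := h1
    _ ≤ D * ∑ q ∈ S ×ˢ S, ‖ph P (h * ((q.1 - q.2 : ℤ):ℝ))‖ := by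
      apply mul_le_mul hD h5 (integral_nonneg (fun _ => sq_nonneg _)) (measureReal_nonneg.trans hD)

/-- many pairs with large difference coefficient -/
lemma add_pairs (P : Measure ℝ) [IsFiniteMeasure P] (D : ℝ) (hD0 : 0 < D) (hD : P.real univ ≤ D) (S : Finset ℤ) (h τ L : ℝ) (hτ0 : 0 ≤ τ)
    (hS : ∀ a ∈ S, τ ≤ ‖ph P (h * a)‖) (hL : ∀ a ∈ S, |(a:ℝ)| ≤ L) :
    τ^2 * (S.card:ℝ)^2 ≤ 2 * D^2 * ((S ×ˢ S).filter (fun p => p.1 - p.2 ∈ Sp (ph P) h (τ^2/(2*D)) (2*L))).card := by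
  have h1 := add_lem P D hD S h τ hτ0 hS
  set G := (S ×ˢ S).filter (fun p => p.1 - p.2 ∈ Sp (ph P) h (τ^2/(2*D)) (2*L)) with hG
  have h2 : ∑ p ∈ S ×ˢ S, ‖ph P (h * ((p.1 - p.2 : ℤ):ℝ))‖ ≤ D * G.card + τ^2/(2*D) * (S.card:ℝ)^2 := by
    calc _ ≤ ∑ p ∈ S ×ˢ S, ((if p.1 - p.2 ∈ Sp (ph P) h (τ^2/(2*D)) (2*L) then D else 0) + τ^2/(2*D)) := by
          apply Finset.sum_le_sum
          intro p hp
          split_ifs with hs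
          · have := (ph_le P (h * ((p.1 - p.2 : ℤ):ℝ))).trans hD
            have : 0 ≤ τ^2/(2*D) := by positivity
            linarith
          · rw [Sp_mem] at hs
            have hp := Finset.mem_product.mp hp
            have e1 : |((p.1 - p.2 : ℤ):ℝ)| ≤ 2 * L := by
              have a1 := hL _ hp.1
              have a2 := hL _ hp.2
              push_cast
              rw [abs_le] at *
              constructor <;> linarith [a1.1, a1.2, a2.1, a2.2]
            rw [zero_add]
            by_contra hcon
            exact hs ⟨e1, (not_le.mp hcon).le⟩
      _ = _ := by
          rw [Finset.sum_add_distrib, ← Finset.sum_filter, Finset.sum_const, Finset.sum_const, Finset.card_product]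
          simp only [nsmul_eq_mul]
          push_cast
          ring
  have h3 := h1.trans (mul_le_mul_of_nonneg_left h2 hD0.le)
  have h4 : D * (D * G.card + τ^2/(2*D) * (S.card:ℝ)^2) = D^2 * G.card + τ^2 * (S.card:ℝ)^2 / 2 := by
    field_simp
  linarith
end

section
open MeasureTheory Set Real
open scoped Pointwise

lemma geo_bd (x y : ℝ) (hx : |x| ≤ 3) (R : ℕ) :
    |x| * ‖∑ j ∈ Finset.range R, Complex.exp (Complex.I * ((y + j * x : ℝ):ℂ))‖ ≤ 4 := by
  set z := Complex.exp (Complex.I * (x:ℂ)) with hz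
  have h1 : ∑ j ∈ Finset.range R, Complex.exp (Complex.I * ((y + j * x : ℝ):ℂ)) = Complex.exp (Complex.I * (y:ℂ)) * ∑ j ∈ Finset.range R, z^j := by
    rw [Finset.mul_sum]
    apply Finset.sum_congr rfl
    intro j _
    rw [hz, ← Complex.exp_nat_mul, ← Complex.exp_add]
    congr 1; push_cast; ring
  rw [h1, norm_mul, norm_e, one_mul]
  have h2 := mul_geom_sum z R
  have h3 : ‖z - 1‖ * ‖∑ j ∈ Finset.range R, z^j‖ ≤ 2 := by
    rw [← norm_mul, h2]
    refine (norm_sub_le _ _).trans ?_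
    rw [norm_pow, hz, norm_e]; norm_num
  have h4 : |x| / 2 ≤ ‖z - 1‖ := by
    rw [hz, Complex.norm_exp_I_mul_ofReal_sub_one]
    have h5 : |x/2| ≤ π/2 := by
      rw [abs_div, abs_two]; linarith [Real.pi_gt_three]
    have h6 := Real.mul_abs_le_abs_sin h5
    rw [Real.norm_eq_abs, abs_mul, abs_two]
    rw [abs_div, abs_two] at h6
    have h7 : 1/2 ≤ 2/π := by
      rw [div_le_div_iff₀ (by norm_num) Real.pi_pos]
      linarith [Real.pi_le_four]
    have : 1/2 * (|x|/2) ≤ 2/π * (|x|/2) := mul_le_mul_of_nonneg_right h7 (by positivity)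
    linarith
  have := mul_le_mul_of_nonneg_right h4 (norm_nonneg (∑ j ∈ Finset.range R, z^j))
  linarith

lemma dyad (R M t K : ℝ) (hR : 0 < R) (hM : 0 < M) (hK : K ≤ R) (htK : t * K ≤ M) (n : ℕ) (hn : 1 ≤ n)
    (ht : t ≤ 2^n * (M/R)) : K ≤ ∑ i ∈ Finset.range n, R * (1/2)^i * (if t ≤ 2^(i+1) * (M/R) then 1 else 0) := by
  have hex : ∃ i, t ≤ 2^(i+1) * (M/R) := ⟨n-1, by rwa [Nat.sub_add_cancel hn]⟩
  classical
  set i := Nat.find hex with hi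
  have h1 : t ≤ 2^(i+1) * (M/R) := Nat.find_spec hex
  have h2 : i < n := by
    have : i ≤ n - 1 := Nat.find_min' hex (by rwa [Nat.sub_add_cancel hn])
    omega
  have h3 : K ≤ R * (1/2)^i := by
    rcases Nat.eq_zero_or_pos i with h0 | h0
    · rw [h0]; simpa using hK
    · have h4 := Nat.find_min hex (m := i - 1) (by omega)
      rw [Nat.sub_add_cancel h0, not_le] at h4
      by_contra hcon
      push Not at hcon
      have h5 : 2^i * (M/R) * (R * (1/2)^i) = M := by
        rw [one_div, inv_pow]; field_simp
      have h6 : 0 < 2^i * (M/R) := by positivity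
      have h7 : 0 < R * (1/2)^i := by positivity
      have : 2^i * (M/R) * (R * (1/2)^i) < t * K := mul_lt_mul'' h4 hcon h6.le h7.le
      linarith
  refine h3.trans ?_
  have := Finset.single_le_sum (f := fun i => R * (1/2)^i * (if t ≤ 2^(i+1) * (M/R) then (1:ℝ) else 0)) (s := Finset.range n)
    (fun i _ => by split_ifs <;> positivity) (Finset.mem_range.mpr h2)
  refine le_trans ?_ this
  simp only [h1, if_true, mul_one]; exact le_rfl

lemma ph_sq (P : Measure ℝ) [IsFiniteMeasure P] (ξ : ℝ) :
    ((‖ph P ξ‖^2 : ℝ):ℂ) = ∫ q, Complex.exp (Complex.I * ((ξ * (q.1 - q.2) : ℝ):ℂ)) ∂(P.prod P) := by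
  have e1 : ((‖ph P ξ‖^2 : ℝ):ℂ) = ph P ξ * (starRingEnd ℂ) (ph P ξ) := by
    rw [Complex.mul_conj, Complex.normSq_eq_norm_sq]
  rw [e1]
  unfold ph
  rw [← integral_conj, ← integral_prod_mul]
  congr 1; ext q
  rw [← Complex.exp_conj, ← Complex.exp_add]
  congr 1
  simp; ring

lemma int_lem (P : Measure ℝ) [IsFiniteMeasure P] (D h Q δ : ℝ) (hD : 0 < D) (hs : ∀ᵐ p ∂P, |p| ≤ D) (hh : 0 < h)
    (hhD : h * (2 * D) ≤ 3) (hδ0 : 0 < δ) (hδ : δ ≤ 1/2) (hQ0 : 0 ≤ Q) (R : ℕ) (hR : 1 ≤ R)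
    (hQ : ∀ s, 4/h/R ≤ s → (P.prod P).real {q : ℝ × ℝ | |q.1 - q.2| ≤ s} ≤ Q * s^δ) (m : ℤ) :
    ∑ j ∈ Finset.range R, ‖ph P (h * ((m + j : ℤ):ℝ))‖^2 ≤ 8 * Q * (4/h)^δ * (R:ℝ)^(1-δ) := by
  have hR0 : (0:ℝ) < R := by exact_mod_cast hR
  set M := 4/h with hM
  have hM0 : 0 < M := by positivity
  obtain ⟨n, hn⟩ := pow_unbounded_of_one_lt (2 * D / (M/R)) (one_lt_two)
  have hn1 : 2 * D ≤ 2^(n+1) * (M/R) := by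
    rw [div_lt_iff₀ (by positivity)] at hn
    have : (2:ℝ)^n * (M/R) ≤ 2^(n+1) * (M/R) := by
      rw [pow_succ]
      have : 0 < (2:ℝ)^n * (M/R) := by positivity
      linarith
    linarith
  have hsup : ∀ᵐ q ∂(P.prod P), |q.1 - q.2| ≤ 2 * D := by
    have h1 : ∀ᵐ q ∂(P.prod P), |q.1| ≤ D := Measure.quasiMeasurePreserving_fst.ae hs
    have h2 : ∀ᵐ q ∂(P.prod P), |q.2| ≤ D := Measure.quasiMeasurePreserving_snd.ae hs
    filter_upwards [h1, h2] with q a b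
    rw [abs_le] at *
    constructor <;> linarith [a.1, a.2, b.1, b.2]
  set Φ : ℝ × ℝ → ℂ := fun q => ∑ j ∈ Finset.range R, Complex.exp (Complex.I * (((h * ((m + j : ℤ):ℝ)) * (q.1 - q.2) : ℝ):ℂ)) with hΦ
  have h1 : ((∑ j ∈ Finset.range R, ‖ph P (h * ((m + j : ℤ):ℝ))‖^2 : ℝ):ℂ) = ∫ q, Φ q ∂(P.prod P) := by
    rw [hΦ, integral_finsetSum]
    · push_cast
      apply Finset.sum_congr rfl
      intro j _
      have := ph_sq P (h * ((m + j : ℤ):ℝ))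
      push_cast at this
      exact this
    · intro j _
      apply Integrable.of_bound (Continuous.aestronglyMeasurable (by fun_prop)) 1
      filter_upwards with q
      rw [norm_e]
  have hms : ∀ s : ℝ, MeasurableSet {q : ℝ × ℝ | |q.1 - q.2| ≤ s} := fun s =>
    (isClosed_le (by fun_prop) (by fun_prop)).measurableSet
  set g : ℕ → ℝ × ℝ → ℝ := fun i q => R * (1/2)^i * {q : ℝ × ℝ | |q.1 - q.2| ≤ 2^(i+1) * (M/R)}.indicator 1 q with hg
  have hgi : ∀ i, Integrable (g i) (P.prod P) := fun i =>
    ((integrable_const (1:ℝ)).indicator (hms _)).const_mul _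
  have h2 : ∑ j ∈ Finset.range R, ‖ph P (h * ((m + j : ℤ):ℝ))‖^2 ≤ ∫ q, ∑ i ∈ Finset.range (n+1), g i q ∂(P.prod P) := by
    have : ‖∫ q, Φ q ∂(P.prod P)‖ ≤ ∫ q, ∑ i ∈ Finset.range (n+1), g i q ∂(P.prod P) := by
      refine (norm_integral_le_integral_norm _).trans ?_
      have hΦb : ∀ q, ‖Φ q‖ ≤ R := by
        intro q
        refine (norm_sum_le _ _).trans ?_
        simp only [norm_e]
        simp
      apply integral_mono_ae
      · apply Integrable.of_bound (Continuous.aestronglyMeasurable (by rw [hΦ]; fun_prop)) (R:ℝ)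
        filter_upwards with q
        simpa using hΦb q
      · exact integrable_finsetSum _ (fun i _ => hgi i)
      · filter_upwards [hsup] with q hq
        have hb := geo_bd (h * (q.1 - q.2)) (h * m * (q.1 - q.2)) (by
          rw [abs_mul, abs_of_pos hh]
          exact (mul_le_mul_of_nonneg_left hq hh.le).trans hhD) R
        have e : ∑ j ∈ Finset.range R, Complex.exp (Complex.I * ((h * m * (q.1 - q.2) + j * (h * (q.1 - q.2)) : ℝ):ℂ)) = Φ q := by
          rw [hΦ]
          apply Finset.sum_congr rfl
          intro j _
          congr 3; push_cast; ring
        rw [e, abs_mul, abs_of_pos hh] at hb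
        have hb2 : |q.1 - q.2| * ‖Φ q‖ ≤ M := by
          rw [hM, le_div_iff₀ hh]; linarith
        have := dyad R M |q.1 - q.2| ‖Φ q‖ hR0 hM0 (hΦb q) hb2 (n+1) (by omega) (hq.trans hn1)
        refine this.trans (le_of_eq ?_)
        apply Finset.sum_congr rfl
        intro i _
        simp only [hg, Set.indicator_apply, Set.mem_ofPred_eq, Pi.one_apply]
    rw [← h1, Complex.norm_real] at this
    exact (le_abs_self _).trans this
  refine h2.trans ?_
  rw [integral_finsetSum _ (fun i _ => hgi i)]
  have h3 : ∀ i, ∫ q, g i q ∂(P.prod P) ≤ (2 * Q * M^δ * (R:ℝ)^(1-δ)) * (3/4:ℝ)^i := by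
    intro i
    rw [hg]
    simp only
    rw [integral_const_mul, integral_indicator_one (hms _)]
    have hs1 : M / R ≤ 2^(i+1) * (M/R) := by
      have : (1:ℝ) ≤ 2^(i+1) := one_le_pow₀ (by norm_num)
      have h0 : 0 < M / R := by positivity
      nlinarith
    have h4 := hQ _ hs1
    have h5 : (R:ℝ) * (1/2)^i * (Q * (2^(i+1) * (M/R))^δ) ≤ (2 * Q * M^δ * (R:ℝ)^(1-δ)) * (3/4:ℝ)^i := by
      have e1 : ((2:ℝ)^(i+1) * (M/R))^δ = ((2:ℝ)^δ)^(i+1) * (M^δ / (R:ℝ)^δ) := by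
        rw [Real.mul_rpow (by positivity) (by positivity), Real.div_rpow hM0.le hR0.le, ← Real.rpow_natCast, ← Real.rpow_mul (by norm_num),
          mul_comm _ δ, Real.rpow_mul (by norm_num), Real.rpow_natCast]
      have e2 : (R:ℝ)^(1-δ) = R / (R:ℝ)^δ := by rw [Real.rpow_sub hR0, Real.rpow_one]
      have e3 : (2:ℝ)^δ ≤ 3/2 := by
        calc (2:ℝ)^δ ≤ 2^(1/2:ℝ) := Real.rpow_le_rpow_of_exponent_le (by norm_num) hδ
          _ ≤ 3/2 := by
            rw [← Real.sqrt_eq_rpow, Real.sqrt_le_left (by norm_num)]; norm_num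
      have e4 : ((2:ℝ)^δ)^(i+1) * (1/2)^i ≤ 2 * (3/4)^i := by
        calc _ ≤ (3/2:ℝ)^(i+1) * (1/2)^i := by gcongr
          _ = 3/2 * ((3/2) * (1/2))^i := by rw [mul_pow]; ring
          _ ≤ 2 * (3/4)^i := by
            rw [show (3/2:ℝ) * (1/2) = 3/4 by norm_num]
            have : (0:ℝ) < (3/4)^i := by positivity
            linarith
      rw [e1, e2]
      have h0 : 0 ≤ Q * M^δ * (R / (R:ℝ)^δ) := by positivity
      have := mul_le_mul_of_nonneg_left e4 h0
      calc _ = Q * M^δ * (R / (R:ℝ)^δ) * (((2:ℝ)^δ)^(i+1) * (1/2)^i) := by ring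
        _ ≤ _ := this
        _ = _ := by ring
    exact (mul_le_mul_of_nonneg_left h4 (by positivity)).trans h5
  calc _ ≤ ∑ i ∈ Finset.range (n+1), (2 * Q * M^δ * (R:ℝ)^(1-δ)) * (3/4:ℝ)^i := Finset.sum_le_sum (fun i _ => h3 i)
    _ = (2 * Q * M^δ * (R:ℝ)^(1-δ)) * ∑ i ∈ Finset.range (n+1), (3/4:ℝ)^i := by rw [Finset.mul_sum]
    _ ≤ (2 * Q * M^δ * (R:ℝ)^(1-δ)) * 4 := by
      apply mul_le_mul_of_nonneg_left _ (by positivity)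
      rw [geom_sum_eq (by norm_num)]
      have : (0:ℝ) < (3/4)^(n+1) := by positivity
      rw [div_le_iff_of_neg (by norm_num)]
      linarith
    _ = _ := by ring
end

section
open MeasureTheory Set Real
open scoped Pointwise

def Fr (μ : ℕ → Measure ℝ) (N V δ : ℝ) : Prop := ∀ j x ℓ, N⁻¹ ≤ ℓ → (μ j).real (Icc x (x+ℓ)) ≤ V * ℓ^δ

lemma prod_bd (P μ : Measure ℝ) [IsFiniteMeasure P] [IsFiniteMeasure μ] (E : Set (ℝ × ℝ)) (hE : MeasurableSet E) (B : ℝ)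
    (hB : 0 ≤ B) (h : ∀ᵐ q ∂P, μ.real (Prod.mk q ⁻¹' E) ≤ B) : (P.prod μ).real E ≤ P.real univ * B := by
  unfold Measure.real
  rw [Measure.prod_apply hE]
  have h1 : ∫⁻ q, μ (Prod.mk q ⁻¹' E) ∂P ≤ ENNReal.ofReal B * P univ := by
    rw [← lintegral_const]
    apply lintegral_mono_ae
    filter_upwards [h] with q hq
    rw [ENNReal.le_ofReal_iff_toReal_le (measure_ne_top _ _) hB]
    exact hq
  have h2 := ENNReal.toReal_mono (ENNReal.mul_ne_top ENNReal.ofReal_ne_top (measure_ne_top _ _)) h1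
  rw [ENNReal.toReal_mul, ENNReal.toReal_ofReal hB, mul_comm] at h2
  exact h2

lemma PP_fr1 {μ : ℕ → Measure ℝ} {C : ℝ} (h : Hy μ C) (hC : 1 ≤ C) {N V δ : ℝ} (hN : 0 < N) (hV : 0 ≤ V)
    (hδ : 0 < δ) (hδ1 : δ ≤ 1) (hF : Fr μ N V δ)
    (j : ℕ) (y ℓ : ℝ) (hℓ : N⁻¹ ≤ ℓ) : (PP μ (j+1)).real (Icc y (y+ℓ)) ≤ C^(2*j) * V * ℓ^δ := by
  have := h.fin
  have := PP_fin h.fin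
  have hC0 : 0 < C := by linarith
  have hℓ0 : 0 < ℓ := lt_of_lt_of_le (by positivity) hℓ
  have hCj : 1 ≤ C^j := one_le_pow₀ hC
  set E := (fun z : ℝ × ℝ => z.1 * z.2) ⁻¹' (Icc y (y+ℓ)) with hE
  have hEm : MeasurableSet E := measurableSet_Icc.preimage (by fun_prop)
  have h1 : (PP μ (j+1)).real (Icc y (y+ℓ)) = ((PP μ j).prod (μ j)).real E := by
    show (((PP μ j).prod (μ j)).map (fun z => z.1 * z.2)).real _ = _
    rw [map_measureReal_apply (by fun_prop) measurableSet_Icc]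
  rw [h1]
  have h2 : ∀ᵐ q ∂(PP μ j), (μ j).real (Prod.mk q ⁻¹' E) ≤ C^j * V * ℓ^δ := by
    filter_upwards [PP_supp h hC j] with q hq
    have hq0 : 0 < q := lt_of_lt_of_le (by positivity) hq.1
    have hsub : Prod.mk q ⁻¹' E ⊆ Icc (y/q) (y/q + C^j * ℓ) := by
      intro x hx
      have hx' : y ≤ q * x ∧ q * x ≤ y + ℓ := hx
      constructor
      · rw [div_le_iff₀ hq0]; linarith
      · have : x ≤ (y + ℓ)/q := by rw [le_div_iff₀ hq0]; linarith
        refine this.trans ?_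
        rw [add_div]
        have : ℓ / q ≤ C^j * ℓ := by
          rw [div_eq_inv_mul]
          apply mul_le_mul_of_nonneg_right _ hℓ0.le
          exact inv_le_of_inv_le₀ (by positivity) hq.1
        linarith
    refine (measureReal_mono hsub).trans ?_
    refine (hF j _ _ (hℓ.trans ?_)).trans ?_
    · nlinarith
    · rw [Real.mul_rpow (by positivity) hℓ0.le]
      have : (C^j)^δ ≤ C^j := by
        calc (C^j)^δ ≤ (C^j)^(1:ℝ) := Real.rpow_le_rpow_of_exponent_le hCj hδ1
          _ = C^j := Real.rpow_one _
      have h0 : 0 ≤ V * ℓ^δ := by positivity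
      nlinarith
  calc _ ≤ (PP μ j).real univ * (C^j * V * ℓ^δ) := prod_bd _ _ E hEm _ (by positivity) h2
    _ ≤ C^j * (C^j * V * ℓ^δ) := mul_le_mul_of_nonneg_right (PP_mass h hC j) (by positivity)
    _ = _ := by ring

lemma PP_fr2 {μ : ℕ → Measure ℝ} {C : ℝ} (h : Hy μ C) (hC : 1 ≤ C) {N V δ W : ℝ} (hN : 0 < N) (hV : 0 ≤ V)
    (hδ : 0 < δ) (hδ1 : δ ≤ 1) (hF : Fr μ N V δ) (hW : 1 ≤ W)
    (j : ℕ) (s : ℝ) (hs : (N * W)⁻¹ ≤ s) :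
    ((PP μ (j+1)).prod (PP μ (j+1))).real {q : ℝ × ℝ | |q.1 - q.2| ≤ s} ≤ (2 * C^(3*j+1) * V * W) * s^δ := by
  have := h.fin
  have := PP_fin h.fin
  have hC0 : 0 < C := by linarith
  have hW0 : 0 < W := by linarith
  have hs0 : 0 < s := lt_of_lt_of_le (by positivity) hs
  set P := PP μ (j+1) with hP
  set ℓ := 2 * W * s with hℓ
  have hℓ1 : N⁻¹ ≤ ℓ := by
    rw [mul_inv, inv_mul_le_iff₀ hN] at hs
    rw [inv_le_iff_one_le_mul₀ hN]
    rw [inv_le_iff_one_le_mul₀ hW0] at hs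
    have : 0 < N * s * W := by positivity
    nlinarith
  have hEm : MeasurableSet {q : ℝ × ℝ | |q.1 - q.2| ≤ s} := (isClosed_le (by fun_prop) (by fun_prop)).measurableSet
  have h2 : ∀ q, P.real (Prod.mk q ⁻¹' {q : ℝ × ℝ | |q.1 - q.2| ≤ s}) ≤ C^(2*j) * V * ℓ^δ := by
    intro q
    refine le_trans (measureReal_mono ?_) (PP_fr1 h hC hN hV hδ hδ1 hF j (q - s) ℓ hℓ1)
    intro x hx
    have hx' : |q - x| ≤ s := hx
    rw [abs_le] at hx'
    have : 2 * s ≤ ℓ := by rw [hℓ]; nlinarith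
    constructor <;> linarith [hx'.1, hx'.2]
  calc _ ≤ P.real univ * (C^(2*j) * V * ℓ^δ) := prod_bd _ _ _ hEm _ (by positivity) (Filter.Eventually.of_forall h2)
    _ ≤ C^(j+1) * (C^(2*j) * V * ℓ^δ) := mul_le_mul_of_nonneg_right (PP_mass h hC (j+1)) (by positivity)
    _ ≤ C^(j+1) * (C^(2*j) * V * (2 * W * s^δ)) := by
        have : ℓ^δ ≤ 2 * W * s^δ := by
          rw [hℓ, Real.mul_rpow (by positivity) hs0.le]
          apply mul_le_mul_of_nonneg_right _ (by positivity)
          calc (2*W)^δ ≤ (2*W)^(1:ℝ) := Real.rpow_le_rpow_of_exponent_le (by linarith) hδ1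
            _ = 2 * W := Real.rpow_one _
        gcongr
    _ = _ := by ring

lemma int_count (P : Measure ℝ) [IsFiniteMeasure P] (D h Q δ L τ : ℝ) (hD : 0 < D) (hs : ∀ᵐ p ∂P, |p| ≤ D) (hh : 0 < h)
    (hh1 : h ≤ 1)
    (hhD : h * (2 * D) ≤ 3) (hδ0 : 0 < δ) (hδ : δ ≤ 1/2) (hQ0 : 0 ≤ Q) (hL : 1 ≤ L)
    (hQ : ∀ s, (2 * h * L)⁻¹ ≤ s → (P.prod P).real {q : ℝ × ℝ | |q.1 - q.2| ≤ s} ≤ Q * s^δ)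
    (hτ : 0 ≤ τ) (A : Finset ℤ) (hA : ∀ a ∈ A, |(a:ℝ)| ≤ L ∧ τ ≤ ‖ph P (h * a)‖) (x : ℤ) (r : ℝ) (hr : 1 ≤ r) :
    τ^2 * (A.filter (fun a : ℤ => |(a:ℝ) - x| ≤ r)).card ≤ 96 * Q / h * r^(1-δ) := by
  have main : ∀ (x : ℤ) (r : ℝ), 1 ≤ r → r ≤ 2 * L → τ^2 * (A.filter (fun a : ℤ => |(a:ℝ) - x| ≤ r)).card ≤ 96 * Q / h * r^(1-δ) := by
    intro x r hr hrL
    set R : ℕ := ⌊2 * r⌋₊ + 1 with hR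
    set m : ℤ := ⌈(x:ℝ) - r⌉ with hm
    have hR3 : (R:ℝ) ≤ 3 * r := by
      have := Nat.floor_le (show 0 ≤ 2 * r by linarith)
      rw [hR]; push_cast; linarith
    have hR0 : (0:ℝ) < R := by rw [hR]; positivity
    have h1 := int_lem P D h Q δ hD hs hh hhD hδ0 hδ hQ0 R (by omega) (by
      intro s hs
      apply hQ s
      refine le_trans ?_ hs
      rw [inv_eq_one_div, div_div, div_le_div_iff₀ (by positivity) (by positivity)]
      have : h * R ≤ h * (6 * L) := mul_le_mul_of_nonneg_left (by linarith) hh.le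
      nlinarith) m
    have h2 : τ^2 * (A.filter (fun a : ℤ => |(a:ℝ) - x| ≤ r)).card ≤ ∑ j ∈ Finset.range R, ‖ph P (h * ((m + j : ℤ):ℝ))‖^2 := by
      have hsub : (A.filter (fun a : ℤ => |(a:ℝ) - x| ≤ r)) ⊆ ((Finset.range R).filter (fun j : ℕ => m + j ∈ A)).image (fun j : ℕ => m + j) := by
        intro a ha
        rw [Finset.mem_filter, abs_le] at ha
        rw [Finset.mem_image]
        have e1 : m ≤ a := by rw [hm, Int.ceil_le]; linarith [ha.2.1]
        refine ⟨(a - m).toNat, ?_, by omega⟩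
        rw [Finset.mem_filter, Finset.mem_range]
        have e2 : m + ((a - m).toNat : ℤ) = a := by omega
        refine ⟨?_, by rw [e2]; exact ha.1⟩
        rw [hR, Nat.lt_succ_iff, Nat.le_floor_iff (by linarith)]
        have e3 : (((a - m).toNat : ℕ):ℝ) = (a:ℝ) - m := by
          have : (((a - m).toNat : ℤ):ℝ) = ((a - m : ℤ):ℝ) := by rw [Int.toNat_of_nonneg (by omega)]
          push_cast at this ⊢
          exact this
        rw [e3]
        have := Int.le_ceil ((x:ℝ) - r)
        linarith [ha.2.2]
      have hcard := (Finset.card_le_card hsub).trans Finset.card_image_le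
      have hcard' : ((A.filter (fun a : ℤ => |(a:ℝ) - x| ≤ r)).card : ℝ) ≤ ((Finset.range R).filter (fun j : ℕ => m + j ∈ A)).card := by exact_mod_cast hcard
      calc _ ≤ τ^2 * ((Finset.range R).filter (fun j : ℕ => m + j ∈ A)).card := mul_le_mul_of_nonneg_left hcard' (by positivity)
        _ = ((Finset.range R).filter (fun j : ℕ => m + j ∈ A)).card • τ^2 := by rw [nsmul_eq_mul, mul_comm]
        _ ≤ ∑ j ∈ (Finset.range R).filter (fun j : ℕ => m + j ∈ A), ‖ph P (h * ((m + j : ℤ):ℝ))‖^2 := by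
          apply Finset.card_nsmul_le_sum
          intro j hj
          exact pow_le_pow_left₀ hτ (hA _ (Finset.mem_filter.mp hj).2).2 2
        _ ≤ _ := Finset.sum_le_sum_of_subset_of_nonneg (Finset.filter_subset _ _) (fun _ _ _ => by positivity)
    refine (h2.trans h1).trans ?_
    have h4 : (4/h)^δ ≤ 4/h := by
      have : 1 ≤ 4/h := by rw [le_div_iff₀ hh]; linarith
      calc (4/h)^δ ≤ (4/h)^(1:ℝ) := Real.rpow_le_rpow_of_exponent_le this (by linarith)
        _ = 4/h := Real.rpow_one _
    have h5 : (R:ℝ)^(1-δ) ≤ 3 * r^(1-δ) := by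
      calc (R:ℝ)^(1-δ) ≤ (3*r)^(1-δ) := Real.rpow_le_rpow hR0.le hR3 (by linarith)
        _ = 3^(1-δ) * r^(1-δ) := Real.mul_rpow (by norm_num) (by linarith)
        _ ≤ 3^(1:ℝ) * r^(1-δ) := by
          apply mul_le_mul_of_nonneg_right _ (by positivity)
          exact Real.rpow_le_rpow_of_exponent_le (by norm_num) (by linarith)
        _ = _ := by rw [Real.rpow_one]
    calc 8 * Q * (4/h)^δ * (R:ℝ)^(1-δ) ≤ 8 * Q * (4/h) * (3 * r^(1-δ)) := by gcongr
      _ = _ := by ring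
  by_cases hrL : r ≤ 2 * L
  · exact main x r hr hrL
  · push Not at hrL
    have hsub : (A.filter (fun a : ℤ => |(a:ℝ) - x| ≤ r)) ⊆ (A.filter (fun a : ℤ => |(a:ℝ) - (0:ℤ)| ≤ 2 * L)) := by
      intro a ha
      have ha := (Finset.mem_filter.mp ha).1
      rw [Finset.mem_filter]
      refine ⟨ha, ?_⟩
      have := (hA a ha).1
      simp; linarith
    have h1 := main 0 (2*L) (by linarith) le_rfl
    have hcard' : ((A.filter (fun a : ℤ => |(a:ℝ) - x| ≤ r)).card : ℝ) ≤ ((A.filter (fun a : ℤ => |(a:ℝ) - (0:ℤ)| ≤ 2 * L))).card := by exact_mod_cast Finset.card_le_card hsub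
    refine (mul_le_mul_of_nonneg_left hcard' (by positivity)).trans (h1.trans ?_)
    apply mul_le_mul_of_nonneg_left _ (by positivity)
    exact Real.rpow_le_rpow (by linarith) hrL.le (by linarith)

lemma sep_exists (μ : Measure ℝ) [IsFiniteMeasure μ] (Y0 : Set ℝ) (σ v ω : ℝ) (hσ : 0 ≤ σ) (hv : 0 < v)
    (hF : ∀ x, μ.real (Icc x (x + 2 * σ)) ≤ v) (hω : ω ≤ μ.real Y0) :
    ∃ Y' : Finset ℝ, (∀ y ∈ Y', y ∈ Y0) ∧ SepBy Y' σ ∧ ω ≤ v * Y'.card := by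
  have key : ∀ n : ℕ, (∃ Y' : Finset ℝ, (∀ y ∈ Y', y ∈ Y0) ∧ SepBy Y' σ ∧ Y'.card = n) ∨
      (∃ Y' : Finset ℝ, (∀ y ∈ Y', y ∈ Y0) ∧ SepBy Y' σ ∧ ω ≤ v * Y'.card) := by
    intro n
    induction n with
    | zero => exact Or.inl ⟨∅, by simp, by intro x hx; simp at hx, rfl⟩
    | succ n ih =>
      rcases ih with ⟨Y', h1, h2, h3⟩ | hR
      · by_cases hex : ∃ y ∈ Y0, (∀ y' ∈ Y', σ ≤ |y - y'|) ∧ y ∉ Y'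
        · left
          obtain ⟨y, hy, hy2, hy3⟩ := hex
          classical
          refine ⟨insert y Y', ?_, ?_, ?_⟩
          · intro z hz
            rcases Finset.mem_insert.mp hz with rfl | hz
            · exact hy
            · exact h1 z hz
          · intro a ha b hb hab
            rcases Finset.mem_insert.mp ha with ha' | ha' <;> rcases Finset.mem_insert.mp hb with hb' | hb'
            · exact absurd (ha'.trans hb'.symm) hab
            · rw [ha']; exact hy2 b hb'
            · rw [hb', abs_sub_comm]; exact hy2 a ha'
            · exact h2 a ha' b hb' hab
          · rw [Finset.card_insert_of_notMem hy3, h3]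
        · right
          push Not at hex
          refine ⟨Y', h1, h2, ?_⟩
          have hsub : Y0 ⊆ ⋃ y ∈ Y', Icc (y - σ) (y - σ + 2 * σ) := by
            intro z hz
            rw [mem_iUnion₂]
            by_cases hc : ∀ y' ∈ Y', σ ≤ |z - y'|
            · have := hex z hz hc
              exact ⟨z, this, by constructor <;> linarith⟩
            · push Not at hc
              obtain ⟨y, hy, hy2⟩ := hc
              rw [abs_lt] at hy2
              exact ⟨y, hy, by constructor <;> linarith [hy2.1, hy2.2]⟩
          calc ω ≤ μ.real Y0 := hω
            _ ≤ μ.real (⋃ y ∈ Y', Icc (y - σ) (y - σ + 2 * σ)) := measureReal_mono hsub (measure_ne_top _ _)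
            _ ≤ ∑ y ∈ Y', μ.real (Icc (y - σ) (y - σ + 2 * σ)) := measureReal_biUnion_finset_le _ _
            _ ≤ ∑ y ∈ Y', v := Finset.sum_le_sum (fun y _ => hF _)
            _ = v * Y'.card := by rw [Finset.sum_const, nsmul_eq_mul, mul_comm]
      · exact Or.inr hR
  obtain ⟨n, hn⟩ := exists_nat_ge (ω / v)
  rcases key n with ⟨Y', h1, h2, h3⟩ | h
  · refine ⟨Y', h1, h2, ?_⟩
    rw [div_le_iff₀ hv] at hn
    rw [h3]; linarith
  · exact h

lemma first_step (μ : Measure ℝ) [IsFiniteMeasure μ] (T : Finset ℤ) (b : ℤ) (ℓ v β : ℝ) (hℓ : 0 < ℓ) (hb : 1 ≤ ℓ * |(b:ℝ)|)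
    (hF : ∀ x, μ.real (Icc x (x + ℓ)) ≤ v) (hβ : β ≤ μ.real {x : ℝ | ⌊x * b⌋ ∈ (T : Set ℤ)}) : β ≤ v * T.card := by
  have hb0 : (b:ℝ) ≠ 0 := by
    rintro h; rw [h] at hb; simp at hb; linarith
  have h1 : ∀ t : ℤ, ∃ y : ℝ, {x : ℝ | ⌊x * b⌋ = t} ⊆ Icc y (y + ℓ) := by
    intro t
    rcases lt_or_gt_of_ne hb0 with h | h
    · rw [abs_of_neg h] at hb
      refine ⟨t/b - ℓ, ?_⟩
      intro x hx
      have hx : ⌊x * b⌋ = t := hx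
      rw [Int.floor_eq_iff] at hx
      constructor
      · have : (t:ℝ)/b ≤ x + ℓ := by
          rw [div_le_iff_of_neg h]
          nlinarith [hx.2]
        linarith
      · have : x ≤ (t:ℝ)/b := by
          rw [le_div_iff_of_neg h]; exact hx.1
        linarith
    · rw [abs_of_pos h] at hb
      refine ⟨t/b, ?_⟩
      intro x hx
      have hx : ⌊x * b⌋ = t := hx
      rw [Int.floor_eq_iff] at hx
      constructor
      · rw [div_le_iff₀ h]; exact hx.1
      · have : x - ℓ ≤ (t:ℝ)/b := by
          rw [le_div_iff₀ h]; nlinarith [hx.2]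
        linarith
  have hsub : {x : ℝ | ⌊x * b⌋ ∈ (T : Set ℤ)} ⊆ ⋃ t ∈ T, {x : ℝ | ⌊x * b⌋ = t} := by
    intro x hx
    rw [mem_iUnion₂]
    exact ⟨⌊x * b⌋, hx, rfl⟩
  calc β ≤ _ := hβ
    _ ≤ μ.real (⋃ t ∈ T, {x : ℝ | ⌊x * b⌋ = t}) := measureReal_mono hsub (measure_ne_top _ _)
    _ ≤ ∑ t ∈ T, μ.real {x : ℝ | ⌊x * b⌋ = t} := measureReal_biUnion_finset_le _ _
    _ ≤ ∑ t ∈ T, v := by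
      apply Finset.sum_le_sum
      intro t _
      obtain ⟨y, hy⟩ := h1 t
      exact (measureReal_mono hy).trans (hF y)
    _ = v * T.card := by rw [Finset.sum_const, nsmul_eq_mul, mul_comm]
end

section
open MeasureTheory Set Real
open scoped Pointwise

def HX (δ κ : ℝ) (C : ℕ) (N : ℝ) : Prop := ∀ (A : Finset ℤ) (Y : Set ℝ), (∀ a ∈ A, |(a:ℝ)| ≤ N^2) → ((A - A).card : ℝ) ≤ N^κ * A.card →
    N^(δ/2) ≤ A.card →
    (∀ (x : ℤ) (r : ℝ), N^(δ/8) ≤ r → r ≤ 2 * N^3 →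
      ((A.filter (fun a : ℤ => |(a:ℝ) - x| ≤ r)).card : ℝ) ≤ N^κ * r^(1-δ)) →
    (∀ y ∈ Y, |y| ≤ C ∧ ∃ B ⊆ A, (A.card : ℝ) ≤ N^κ * B.card ∧ ∀ b ∈ B, ∃ a ∈ A, |y * b - a| ≤ C) →
    (∀ σ ∈ Icc (N^(-(1/2:ℝ))) (N^(-κ)), ∃ Y' : Finset ℝ, (∀ y ∈ Y', y ∈ Y) ∧ SepBy Y' σ ∧
      N^(-κ) * σ^(-δ) ≤ Y'.card) → False

lemma PP_abs {μ : ℕ → Measure ℝ} {C : ℝ} (h : Hy μ C) (hC : 1 ≤ C) (j : ℕ) (D : ℝ) (hD : C^j ≤ D) :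
    ∀ᵐ p ∂(PP μ j), |p| ≤ D := by
  filter_upwards [PP_supp h hC j] with p hp
  have : 0 < (C^j)⁻¹ := by positivity
  rw [abs_of_pos (lt_of_lt_of_le this hp.1)]
  exact hp.2.trans hD

/-- `mult_step` for the product measures -/
lemma mult_PP {μ : ℕ → Measure ℝ} {C : ℝ} (hy : Hy μ C) (hC : 1 ≤ C) (j : ℕ) (D : ℝ) (hD : C^j ≤ D)
    (h τ τ' L L' : ℝ) (hτ0 : 0 ≤ τ') (hh : 0 < h) (hτ : 4 * C * τ' ≤ τ)
    (hhτ : 4 * C * (D * D * h) ≤ τ) (hL : C * L + 1 ≤ L') (a : ℤ) (ha : a ∈ Sp (ph (PP μ (j+1))) h τ L) :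
    τ / (2 * D) ≤ (μ j).real {x : ℝ | ⌊x * a⌋ ∈ (Sp (ph (PP μ j)) h τ' L' : Set ℤ)} := by
  have := hy.fin
  have := PP_fin hy.fin
  have hCj : 1 ≤ C^j := one_le_pow₀ hC
  have hD0 : 0 < D := by linarith
  have hsupp : ∀ᵐ x ∂(μ j), x ∈ Icc C⁻¹ C := by
    rw [ae_iff]; exact hy.supp j
  have hm := (PP_mass hy hC j).trans hD
  rw [Sp_mem] at ha
  apply mult_step (μ j) C hC hsupp (hy.mass j) (ph (PP μ j)) D (D*D) hD0 (fun ξ => (ph_le _ ξ).trans hm) (by positivity)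
    (ph_lip _ D hm (PP_abs hy hC j D hD) hD0.le) h τ τ' L L' hτ0 hh hτ hhτ hL a ha.1
  rw [← ph_succ hy.fin]
  exact ha.2

set_option maxHeartbeats 2000000 in
lemma core (δ κ : ℝ) (hδ : 0 < δ) (hδ1 : δ ≤ 1/2) (C : ℕ) (hC2 : 2 ≤ C) (N : ℝ) (hN : 1 ≤ N) (hX : HX δ κ (C^2) N)
    (u D : ℝ) (hD1 : 1 ≤ D) (huD : 20000 * D^2 * (C:ℝ)^3 ≤ u) (huκ : u^41 ≤ N^κ)
    (μ : ℕ → Measure ℝ) (hy : Hy μ C) (hF : Fr μ N u δ) (j : ℕ) (hj : (C:ℝ)^(3*j+1) ≤ D)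
    (τ τ' L L' : ℝ) (hτ : u⁻¹ ≤ τ) (hτ1 : τ ≤ 1) (hτ'0 : 0 ≤ τ') (hτ' : 8 * C * D * τ' ≤ τ^2)
    (hL : 1 ≤ L) (hLN : 2 * L ≤ N * u^5) (hLN2 : L ≤ N^2) (hLL : 2 * C * L + 1 ≤ L')
    (hm : ((Sp (ph (PP μ j)) (u⁻¹^4) τ' L').card : ℝ) ≤ u * (Sp (ph (PP μ (j+1))) (u⁻¹^4) τ L).card)
    (hn : 3 * u^4 * N^(δ/2) ≤ (Sp (ph (PP μ (j+1))) (u⁻¹^4) τ L).card) : False := by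
  have := hy.fin
  have := PP_fin hy.fin
  have hCr2 : (2:ℝ) ≤ C := by exact_mod_cast hC2
  have hC1 : (1:ℝ) ≤ C := by linarith
  have hC0 : (0:ℝ) < C := by linarith
  have hN0 : 0 < N := by linarith
  have hD0 : 0 < D := by linarith
  have hD2 : D ≤ D^2 := by nlinarith
  have hD21 : 1 ≤ D^2 := one_le_pow₀ hD1
  have hC31 : 1 ≤ (C:ℝ)^3 := one_le_pow₀ hC1
  have hCC2 : (C:ℝ) ≤ (C:ℝ)^2 := by nlinarith
  have hCC3 : (C:ℝ)^2 ≤ (C:ℝ)^3 := pow_le_pow_right₀ hC1 (by norm_num)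
  have hu20 : 20000 ≤ u := by nlinarith
  have hu0 : 0 < u := by linarith
  have hu1 : 1 ≤ u := by linarith
  have hDu : 20000 * D^2 ≤ u := by nlinarith
  have hCu : 20000 * (C:ℝ)^3 ≤ u := by
    have : 20000 * (C:ℝ)^3 * 1 ≤ 20000 * (C:ℝ)^3 * D^2 := mul_le_mul_of_nonneg_left hD21 (by positivity)
    linarith
  set h := u⁻¹^4 with hh
  have hh0 : 0 < h := by positivity
  have hhu : h * u^4 = 1 := by rw [hh, inv_pow]; field_simp
  have hui : u⁻¹ ≤ 1 := inv_le_one_of_one_le₀ hu1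
  have hτ0 : 0 < τ := lt_of_lt_of_le (by positivity) hτ
  have huτ : 1 ≤ u * τ := by rwa [inv_le_iff_one_le_mul₀' hu0] at hτ
  have huτ2 : 1 ≤ u^2 * τ^2 := by rw [← mul_pow]; exact one_le_pow₀ huτ
  have hu4 : u * h ≤ u⁻¹^3 := by
    rw [hh]; apply le_of_eq; field_simp
  have hCD2 : 4 * C * (D * D * h) ≤ u⁻¹^3 := by
    refine le_trans ?_ hu4
    have : 4 * C * (D * D) ≤ u := by nlinarith [mul_nonneg (sq_nonneg D) hC0.le, mul_le_mul_of_nonneg_left (hCC2.trans hCC3) (sq_nonneg D)]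
    nlinarith
  have hτ2 : u⁻¹^3 ≤ τ^2/(2*D) := by
    rw [le_div_iff₀ (by positivity)]
    have e1 : u⁻¹^2 ≤ τ^2 := pow_le_pow_left₀ (by positivity) hτ 2
    have e2 : u⁻¹ * (2*D) ≤ 1 := by
      rw [inv_mul_le_iff₀ hu0]; nlinarith
    calc u⁻¹^3 * (2*D) = u⁻¹^2 * (u⁻¹ * (2*D)) := by ring
      _ ≤ u⁻¹^2 * 1 := by gcongr
      _ ≤ τ^2 := by linarith
  have hτ3 : τ^2/(2*D) ≤ τ := by
    rw [div_le_iff₀ (by positivity)]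
    nlinarith
  have hτ4 : 4 * C * τ' ≤ τ^2/(2*D) := by
    rw [le_div_iff₀ (by positivity)]; linarith
  have hCjD : (C:ℝ)^j ≤ D := (pow_le_pow_right₀ hC1 (by omega)).trans hj
  have hCj1D : (C:ℝ)^(j+1) ≤ D := (pow_le_pow_right₀ hC1 (by omega)).trans hj
  set S' := Sp (ph (PP μ (j+1))) h τ L with hS'
  set S := Sp (ph (PP μ j)) h τ' L' with hS
  set Ds := Sp (ph (PP μ (j+1))) h (τ^2/(2*D)) (2*L) with hDs
  have hsupp : ∀ᵐ x ∂(μ j), x ∈ Icc (C:ℝ)⁻¹ C := by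
    rw [ae_iff]; exact hy.supp j
  -- step 1, 2
  have st1 : ∀ a ∈ S', τ/(2*D) ≤ (μ j).real {x : ℝ | ⌊x * a⌋ ∈ (S : Set ℤ)} := fun a ha =>
    mult_PP hy hC1 j D hCjD h τ τ' L L' hτ'0 hh0 (hτ4.trans hτ3) (hCD2.trans (hτ2.trans hτ3)) (by
      have : 0 ≤ C * L := by positivity
      linarith) a ha
  have st2 : ∀ a ∈ Ds, τ^2/(2*D)/(2*D) ≤ (μ j).real {x : ℝ | ⌊x * a⌋ ∈ (S : Set ℤ)} := fun a ha =>
    mult_PP hy hC1 j D hCjD h _ τ' (2*L) L' hτ'0 hh0 hτ4 (hCD2.trans hτ2) (by linarith) a ha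
  obtain ⟨n, hn'⟩ : ∃ n : ℝ, n = (S'.card : ℝ) := ⟨_, rfl⟩
  rw [← hn'] at hn hm
  have hn0 : 0 < n := lt_of_lt_of_le (by positivity) hn
  have hS'ne : S'.Nonempty := by
    rw [hn'] at hn0; rw [← Finset.card_pos]; exact_mod_cast hn0
  -- step 3
  have st3 : (Ds.card:ℝ) ≤ u^4 * n := by
    have e1 := M1 (μ j) C hC1 hsupp (hy.mass j) Ds S _ st2
    have e2 : τ^2/(2*D)/(2*D) * Ds.card = τ^2 * Ds.card / (4*D^2) := by field_simp; ring
    rw [e2, div_le_iff₀ (by positivity)] at e1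
    have e3 : (C:ℝ) * (C+1) * (4*D^2) ≤ u := by nlinarith [mul_le_mul_of_nonneg_left hCC3 (sq_nonneg D), mul_le_mul_of_nonneg_left hCC2 (sq_nonneg D)]
    have e4 : τ^2 * Ds.card ≤ u * (u * n) := by
      calc τ^2 * Ds.card ≤ C * (C+1) * S.card * (4*D^2) := e1
        _ = (C * (C+1) * (4*D^2)) * S.card := by ring
        _ ≤ u * (u * n) := mul_le_mul e3 hm (by positivity) hu0.le
    calc (Ds.card:ℝ) = 1 * Ds.card := by ring
      _ ≤ (u^2 * τ^2) * Ds.card := by gcongr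
      _ = u^2 * (τ^2 * Ds.card) := by ring
      _ ≤ u^2 * (u * (u * n)) := by gcongr
      _ = _ := by ring
  -- step 4
  have st4 : n^2 ≤ u^4 * ((S' ×ˢ S').filter (fun p => p.1 - p.2 ∈ Ds)).card := by
    have e1 := add_pairs (PP μ (j+1)) D hD0 ((PP_mass hy hC1 (j+1)).trans hCj1D) S' h τ L hτ0.le (fun a ha => (Sp_mem.mp ha).2) (fun a ha => (Sp_mem.mp ha).1)
    rw [← hn'] at e1
    set G := (S' ×ˢ S').filter (fun p => p.1 - p.2 ∈ Ds) with hG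
    have hG0 : (0:ℝ) ≤ G.card := by positivity
    calc n^2 = 1 * n^2 := by ring
      _ ≤ (u^2 * τ^2) * n^2 := by gcongr
      _ = u^2 * (τ^2 * n^2) := by ring
      _ ≤ u^2 * (2 * D^2 * G.card) := by gcongr
      _ ≤ u^2 * (u * G.card) := by
        have : 2 * D^2 ≤ u := by linarith
        gcongr
      _ = u^3 * G.card := by ring
      _ ≤ u^4 * G.card := by
        have : u^3 ≤ u^4 := pow_le_pow_right₀ hu1 (by norm_num)
        gcongr
  rw [hn'] at st3 st4
  obtain ⟨A, hAS, hA1, hA2⟩ := bsg S' Ds hS'ne (u^4) (one_le_pow₀ hu1) st3 st4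
  rw [← hn'] at hA1 hA2
  have hA1' : n ≤ 3 * u^4 * A.card := hA1
  have hApos : (0:ℝ) < A.card := by
    by_contra hcon
    push Not at hcon
    have : 3 * u^4 * A.card ≤ 0 := mul_nonpos_of_nonneg_of_nonpos (by positivity) hcon
    linarith
  have hAne : A.Nonempty := by rw [← Finset.card_pos]; exact_mod_cast hApos
  have hA3 : ((A - A).card:ℝ) ≤ u^41 * A.card := by
    calc ((A - A).card:ℝ) ≤ 4096 * (u^4)^9 * n := hA2
      _ ≤ 4096 * (u^4)^9 * (3 * u^4 * A.card) := by gcongr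
      _ = 12288 * (u^40 * A.card) := by ring
      _ ≤ u * (u^40 * A.card) := by
        have : 12288 ≤ u := by linarith
        gcongr
      _ = _ := by ring
  have huk : ∀ i : ℕ, i ≤ 41 → u^i ≤ N^κ := fun i hi => (pow_le_pow_right₀ hu1 hi).trans huκ
  -- step 6
  have hSne : S.Nonempty := by
    by_contra hcon
    rw [Finset.not_nonempty_iff_eq_empty] at hcon
    obtain ⟨a, ha⟩ := hS'ne
    have := st1 a ha
    rw [hcon] at this
    simp at this
    have h0 : 0 < τ/(2*D) := by positivity
    linarith
  have hS0 : (0:ℝ) < S.card := by exact_mod_cast Finset.card_pos.mpr hSne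
  obtain ⟨x', hx', Y0, hY0, hY1, hY2⟩ := M2 (μ j) C hC1 hsupp (hy.mass j) A S hAne hSne (τ/(2*D)) (by positivity)
    (fun a ha => st1 a (hAS ha)) _ rfl
  set ω := (τ/(2*D))^2 * A.card / (4 * (C:ℝ)^2 * (C+1) * S.card) with hω
  have hω1 : u⁻¹^8 ≤ ω := by
    rw [hω, inv_pow, inv_eq_one_div, div_le_div_iff₀ (by positivity) (by positivity), one_mul]
    have e3 : 48 * D^2 * ((C:ℝ)^2 * (C+1)) ≤ u := by nlinarith [mul_le_mul_of_nonneg_left hCC3 (sq_nonneg D)]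
    have e5 : S.card ≤ u * (3 * u^4 * A.card) := hm.trans (by gcongr)
    have e6 : 4 * (C:ℝ)^2 * (C+1) * S.card * (4*D^2) ≤ u^6 * A.card := by
      calc 4 * (C:ℝ)^2 * (C+1) * S.card * (4*D^2) ≤ 4 * (C:ℝ)^2 * (C+1) * (u * (3 * u^4 * A.card)) * (4*D^2) := by gcongr
        _ = (48 * D^2 * ((C:ℝ)^2 * (C+1))) * (u^5 * A.card) := by ring
        _ ≤ u * (u^5 * A.card) := by gcongr
        _ = _ := by ring
    have e7 : (τ/(2*D))^2 * A.card * u^8 = (u^2 * τ^2) * (u^6 * A.card) / (4*D^2) := by field_simp; ring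
    rw [e7, le_div_iff₀ (by positivity)]
    refine e6.trans ?_
    exact le_mul_of_one_le_left (by positivity) huτ2
  have hω0 : 0 < ω := lt_of_lt_of_le (by positivity) hω1
  have huω : 1 ≤ u^8 * ω := by
    rw [inv_pow, inv_le_iff_one_le_mul₀' (by positivity)] at hω1
    exact hω1
  have hx'0 : 0 < x' := lt_of_lt_of_le (by positivity) hx'.1
  have hx'i : 1/x' ≤ C := by
    rw [div_le_iff₀ hx'0]
    have := hx'.1
    rw [inv_le_iff_one_le_mul₀' hC0] at this
    exact this
  refine hX A {y | ∃ x ∈ Y0, y = x / x'} ?_ ?_ ?_ ?_ ?_ ?_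
  · intro a ha
    exact ((Sp_mem.mp (hAS ha)).1).trans hLN2
  · exact hA3.trans (mul_le_mul_of_nonneg_right huκ hApos.le)
  · have : 3 * u^4 * N^(δ/2) ≤ 3 * u^4 * A.card := hn.trans hA1'
    exact le_of_mul_le_mul_left this (by positivity)
  · intro x r hr _
    have hr1 : 1 ≤ r := le_trans (Real.one_le_rpow hN (by positivity)) hr
    have e1 := int_count (PP μ (j+1)) D h (2 * (C:ℝ)^(3*j+1) * u * u) δ L τ hD0 (PP_abs hy hC1 (j+1) D hCj1D) hh0
      (by rw [hh]; exact pow_le_one₀ (by positivity) hui)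
      (by
        have e1 : u ≤ u^4 := by simpa using pow_le_pow_right₀ hu1 (show 1 ≤ 4 by norm_num)
        have e2 : h * u ≤ 1 := (mul_le_mul_of_nonneg_left e1 hh0.le).trans_eq hhu
        have e3 : h * (2 * D) ≤ h * u := mul_le_mul_of_nonneg_left (by linarith) hh0.le
        linarith) hδ hδ1 (by positivity) hL
      (by
        intro s hs
        apply PP_fr2 hy hC1 hN0 hu0.le hδ (by linarith) hF hu1 j s
        refine le_trans ?_ hs
        apply inv_anti₀ (by positivity)
        calc 2 * h * L = h * (2 * L) := by ring
          _ ≤ h * (N * u^5) := by gcongr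
          _ = N * u * (h * u^4) := by ring
          _ = N * u := by rw [hhu, mul_one])
      hτ0.le A (fun a ha => Sp_mem.mp (hAS ha)) x r hr1
    have hc0 : (0:ℝ) ≤ ((A.filter (fun a : ℤ => |(a:ℝ) - x| ≤ r)).card : ℝ) := by positivity
    generalize ((A.filter (fun a : ℤ => |(a:ℝ) - x| ≤ r)).card : ℝ) = c at e1 hc0 ⊢
    have hr0 : 0 < r^(1-δ) := by positivity
    have hhi : 1/h = u^4 := by rw [div_eq_iff hh0.ne']; linarith
    calc c = 1 * c := by ring
      _ ≤ (u^2 * τ^2) * c := by gcongr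
      _ = u^2 * (τ^2 * c) := by ring
      _ ≤ u^2 * (96 * (2 * (C:ℝ)^(3*j+1) * u * u) / h * r^(1-δ)) := by gcongr
      _ = (192 * (C:ℝ)^(3*j+1)) * (u^4 * (1/h) * r^(1-δ)) := by ring
      _ = (192 * (C:ℝ)^(3*j+1)) * (u^8 * r^(1-δ)) := by rw [hhi]; ring
      _ ≤ u * (u^8 * r^(1-δ)) := by
        have : 192 * (C:ℝ)^(3*j+1) ≤ u := by linarith
        gcongr
      _ = u^9 * r^(1-δ) := by ring
      _ ≤ N^κ * r^(1-δ) := by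
        have := huk 9 (by norm_num)
        gcongr
  · rintro y ⟨x, hx, rfl⟩
    have hx2 := hY0 hx
    have hx0 : 0 < x := lt_of_lt_of_le (by positivity) hx2.1
    constructor
    · rw [abs_of_pos (by positivity)]
      push_cast
      calc x / x' = x * (1/x') := by ring
        _ ≤ C * C := mul_le_mul hx2.2 hx'i (by positivity) hC0.le
        _ = _ := by ring
    · refine ⟨A.filter (fun a : ℤ => ∃ a' ∈ A, ⌊x * a⌋ = ⌊x' * a'⌋), Finset.filter_subset _ _, ?_, ?_⟩
      · have e1 := hY2 x hx
        have hb0 : (0:ℝ) ≤ ((A.filter (fun a : ℤ => ∃ a' ∈ A, ⌊x * a⌋ = ⌊x' * a'⌋)).card : ℝ) := by positivity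
        generalize ((A.filter (fun a : ℤ => ∃ a' ∈ A, ⌊x * a⌋ = ⌊x' * a'⌋)).card : ℝ) = b at e1 hb0 ⊢
        calc (A.card:ℝ) = 1 * A.card := by ring
          _ ≤ (u^8 * ω) * A.card := by gcongr
          _ = u^8 * (ω * A.card) := by ring
          _ ≤ u^8 * b := by gcongr
          _ ≤ N^κ * b := by
            have := huk 8 (by norm_num)
            gcongr
      · intro b hb
        obtain ⟨_, a', ha', he⟩ := Finset.mem_filter.mp hb
        refine ⟨a', ha', ?_⟩
        have f1 := Int.floor_le (x * b)
        have f2 := Int.lt_floor_add_one (x * b)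
        have f3 := Int.floor_le (x' * a')
        have f4 := Int.lt_floor_add_one (x' * a')
        rw [he] at f1 f2
        have f5 : |x * b - x' * a'| ≤ 1 := by rw [abs_le]; constructor <;> linarith
        have f6 : x / x' * b - a' = (x * b - x' * a') * (1/x') := by field_simp
        rw [f6, abs_mul, abs_of_pos (show 0 < 1/x' by positivity)]
        push_cast
        calc |x * b - x' * a'| * (1/x') ≤ 1 * C := mul_le_mul f5 hx'i (by positivity) (by norm_num)
          _ ≤ _ := by linarith
  · intro σ hσ
    have hσ0 : 0 < σ := lt_of_lt_of_le (by positivity) hσ.1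
    have hσN : N⁻¹ ≤ σ := by
      refine le_trans ?_ hσ.1
      rw [← Real.rpow_neg_one]
      exact Real.rpow_le_rpow_of_exponent_le hN (by norm_num)
    have hσN2 : N⁻¹ ≤ 2 * (C * σ) := by
      have : 1 * σ ≤ C * σ := mul_le_mul_of_nonneg_right hC1 hσ0.le
      linarith
    obtain ⟨Y', hY'1, hY'2, hY'3⟩ := sep_exists (μ j) Y0 (C * σ) (u * (2 * (C * σ))^δ) ω (by positivity) (by positivity)
      (fun x => hF j x _ hσN2) hY1
    classical
    refine ⟨Y'.image (fun x => x / x'), ?_, ?_, ?_⟩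
    · intro y hy
      obtain ⟨x, hx, rfl⟩ := Finset.mem_image.mp hy
      exact ⟨x, hY'1 x hx, rfl⟩
    · intro a ha b hb hab
      obtain ⟨x, hx, rfl⟩ := Finset.mem_image.mp ha
      obtain ⟨z, hz, rfl⟩ := Finset.mem_image.mp hb
      have hxz : x ≠ z := fun e => hab (by rw [e])
      have := hY'2 x hx z hz hxz
      rw [← sub_div, abs_div, abs_of_pos hx'0, le_div_iff₀ hx'0]
      refine le_trans ?_ this
      rw [mul_comm]
      exact mul_le_mul_of_nonneg_right hx'.2 hσ0.le
    · rw [Finset.card_image_of_injective _ (fun a b hab => by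
        have hab : a / x' = b / x' := hab
        field_simp at hab; exact hab)]
      have e1 : (2 * (C * σ))^δ ≤ u * σ^δ := by
        rw [← mul_assoc, Real.mul_rpow (by positivity) hσ0.le]
        apply mul_le_mul_of_nonneg_right _ (by positivity)
        calc (2 * (C:ℝ))^δ ≤ (2 * (C:ℝ))^(1:ℝ) := Real.rpow_le_rpow_of_exponent_le (by linarith) (by linarith)
          _ = 2 * C := Real.rpow_one _
          _ ≤ u := by linarith
      have hσδ : 0 < σ^δ := by positivity
      have e2 : 1 ≤ N^κ * (σ^δ * Y'.card) := by
        calc 1 ≤ u^8 * ω := huω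
          _ ≤ u^8 * (u * (2 * (C * σ))^δ * Y'.card) := by gcongr
          _ ≤ u^8 * (u * (u * σ^δ) * Y'.card) := by gcongr
          _ = u^10 * (σ^δ * Y'.card) := by ring
          _ ≤ N^κ * (σ^δ * Y'.card) := by
            have := huk 10 (by norm_num)
            gcongr
      rw [Real.rpow_neg hN0.le, Real.rpow_neg hσ0.le, ← mul_inv, inv_le_iff_one_le_mul₀' (by positivity)]
      linarith
end

section
open MeasureTheory Set Real
open scoped Pointwise

set_option maxHeartbeats 6000000 in
theorem mainN (δ : ℝ) (hδ : 0 < δ) (hδ1 : δ ≤ 1/2) : ∃ (k : ℕ) (ε : ℝ), 0 < ε ∧ ε ≤ 1 ∧ ∀ C : ℕ, 2 ≤ C →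
    ∀ᶠ N : ℝ in Filter.atTop, ∀ μ : ℕ → Measure ℝ, Hy μ C → Fr μ N (N^(2*ε)) δ → ∀ ξ : ℝ, |ξ| = N →
    ‖ph (PP μ k) ξ‖ ≤ N^(-ε) := by
  obtain ⟨κ, hκ, hX⟩ := thmX δ hδ (by linarith)
  obtain ⟨e, he0, he1, he2⟩ : ∃ e : ℝ, 0 < e ∧ e ≤ κ/41 ∧ e ≤ δ/16 :=
    ⟨min (κ/41) (δ/16), by positivity, min_le_left _ _, min_le_right _ _⟩
  obtain ⟨q, hq⟩ := exists_nat_ge (1/e)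
  set k := q + 8 with hk
  set ε := e / 3^(k+1) with hε
  have hε0 : 0 < ε := by positivity
  have h3k : (9:ℝ) ≤ 3^(k+1) := by
    calc (9:ℝ) = 3^2 := by norm_num
      _ ≤ 3^(k+1) := pow_le_pow_right₀ (by norm_num) (by omega)
  have hεe : ε * 3^(k+1) = e := by rw [hε]; field_simp
  have hε9 : 9 * ε ≤ e := by
    have := mul_le_mul_of_nonneg_left h3k hε0.le
    linarith
  refine ⟨k, ε, hε0, by linarith, ?_⟩
  intro C hC2
  set D : ℝ := (C:ℝ)^(3*k+1) with hD
  filter_upwards [hX (C^2) (Nat.one_le_pow _ _ (by omega)), ev_pow (20000 * D^2 * (C:ℝ)^3) e he0, ev_pow (8 * C * D) ε hε0,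
    ev_pow (4 * (2*C+2)^k) e he0, Filter.eventually_ge_atTop (2:ℝ)] with N hXN hN1 hN2 hN3 hN4
  intro μ hy hF ξ hξ
  by_contra hcon
  push Not at hcon
  have := hy.fin
  have := PP_fin hy.fin
  have hCr2 : (2:ℝ) ≤ C := by exact_mod_cast hC2
  have hC1 : (1:ℝ) ≤ C := by linarith
  have hC0 : (0:ℝ) < C := by linarith
  have hN0 : 0 < N := by linarith
  have hNone : 1 ≤ N := by linarith
  have hD1 : 1 ≤ D := one_le_pow₀ hC1
  have hD0 : 0 < D := by linarith
  set u := N^e with hu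
  have hD21 : 1 ≤ D^2 := one_le_pow₀ hD1
  have hC31 : (C:ℝ) ≤ (C:ℝ)^3 := by
    simpa using pow_le_pow_right₀ hC1 (show 1 ≤ 3 by norm_num)
  have hCDu : 20000 * (C * (D * D)) ≤ u := by
    have : D^2 * C ≤ D^2 * (C:ℝ)^3 := mul_le_mul_of_nonneg_left hC31 (by positivity)
    have h2 : C * (D * D) = D^2 * C := by ring
    rw [h2]
    linarith
  have hCD1 : 1 ≤ C * D := one_le_mul_of_one_le_of_one_le hC1 hD1
  have hCD2 : C ≤ C * D := le_mul_of_one_le_right hC0.le hD1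
  have hDD : 1 ≤ D * D := one_le_mul_of_one_le_of_one_le hD1 hD1
  have hDD2 : D ≤ D * D := le_mul_of_one_le_left hD0.le hD1
  have hCDD : D * D ≤ C * (D * D) := le_mul_of_one_le_left (by positivity) hC1
  have hu20 : 20000 ≤ u := by linarith
  have hu0 : 0 < u := by linarith
  have hu1 : 1 ≤ u := by linarith
  have hupow : ∀ i : ℕ, u^i = N^(e * i) := by
    intro i; rw [hu, Real.rpow_mul hN0.le, Real.rpow_natCast]
  set h := u⁻¹^4 with hh
  have hh0 : 0 < h := by positivity
  have hhu : h * u^4 = 1 := by rw [hh, inv_pow]; field_simp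
  have hNε : 0 < N^ε := by positivity
  -- thresholds
  obtain ⟨τ, hτ⟩ : ∃ τ : ℕ → ℝ, τ = fun i => N^(-(ε * 3^(k-i+1))) := ⟨_, rfl⟩
  obtain ⟨Lf, hLf⟩ : ∃ Lf : ℕ → ℝ, Lf = fun i => (2*(C:ℝ)+2)^(k-i) * (2 * N * u^4) := ⟨_, rfl⟩
  have hτ0 : ∀ i, 0 < τ i := by intro i; rw [hτ]; positivity
  have hτu : ∀ i, u⁻¹ ≤ τ i := by
    intro i
    rw [hτ, hu, ← Real.rpow_neg hN0.le]
    apply Real.rpow_le_rpow_of_exponent_le hNone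
    rw [neg_le_neg_iff, ← hεe]
    have : (3:ℝ)^(k-i+1) ≤ 3^(k+1) := pow_le_pow_right₀ (by norm_num) (by omega)
    exact mul_le_mul_of_nonneg_left this hε0.le
  have hτε : ∀ i, τ i ≤ N^(-(ε*3)) := by
    intro i
    rw [hτ]
    apply Real.rpow_le_rpow_of_exponent_le hNone
    rw [neg_le_neg_iff]
    have : (3:ℝ)^1 ≤ 3^(k-i+1) := pow_le_pow_right₀ (by norm_num) (by omega)
    exact mul_le_mul_of_nonneg_left (by linarith) hε0.le
  have hNε1 : 1 ≤ N^ε := Real.one_le_rpow hNone hε0.le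
  have hN3ε : N^(-(ε*3)) = ((N^ε)^3)⁻¹ := by
    rw [Real.rpow_neg hN0.le, Real.rpow_mul hN0.le]
    norm_cast
  have hτ1 : ∀ i, τ i ≤ 1 := by
    intro i
    refine (hτε i).trans ?_
    apply Real.rpow_le_one_of_one_le_of_nonpos hNone
    linarith
  have hτs : ∀ i, i + 1 ≤ k → 8 * C * D * τ i ≤ (τ (i+1))^2 := by
    intro i hi
    have e1 : τ i = (τ (i+1))^3 := by
      rw [hτ]
      simp only
      rw [show k - i + 1 = (k - (i+1) + 1) + 1 by omega, ← Real.rpow_natCast (N^(-(ε*3^(k-(i+1)+1)))) 3,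
        ← Real.rpow_mul hN0.le]
      congr 1
      rw [pow_succ (3:ℝ) (k-(i+1)+1)]
      push_cast; ring
    rw [e1]
    have e2 : 8 * C * D * τ (i+1) ≤ 1 := by
      calc 8 * C * D * τ (i+1) ≤ N^ε * ((N^ε)^3)⁻¹ := mul_le_mul hN2 (hN3ε ▸ hτε (i+1)) (hτ0 _).le hNε.le
        _ ≤ 1 := by
          rw [mul_inv_le_iff₀ (by positivity), one_mul]
          simpa using pow_le_pow_right₀ hNε1 (show 1 ≤ 3 by norm_num)
    calc 8 * C * D * (τ (i+1))^3 = (8 * C * D * τ (i+1)) * (τ (i+1))^2 := by ring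
      _ ≤ 1 * (τ (i+1))^2 := by gcongr
      _ = _ := by ring
  have hc1 : 1 ≤ 2*(C:ℝ)+2 := by linarith
  have hNu4 : 1 ≤ N * u^4 := by
    exact one_le_mul_of_one_le_of_one_le hNone (one_le_pow₀ (n := 4) hu1)
  have hL1 : ∀ i, 2 * N * u^4 ≤ Lf i := by
    intro i
    rw [hLf]
    exact le_mul_of_one_le_left (by positivity) (one_le_pow₀ hc1)
  have hLs : ∀ i, i + 1 ≤ k → 2 * C * Lf (i+1) + 1 ≤ Lf i := by
    intro i hi
    have e1 : Lf i = (2*(C:ℝ)+2) * Lf (i+1) := by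
      rw [hLf]
      simp only
      rw [show k - i = (k - (i+1)) + 1 by omega, pow_succ]
      ring
    rw [e1]
    have := hL1 (i+1)
    linarith
  have hLN : ∀ i, 2 * Lf i ≤ N * u^5 := by
    intro i
    rw [hLf]
    simp only
    have : (2*(C:ℝ)+2)^(k-i) ≤ (2*(C:ℝ)+2)^k := pow_le_pow_right₀ hc1 (by omega)
    calc 2 * ((2*(C:ℝ)+2)^(k-i) * (2 * N * u^4)) ≤ 2 * ((2*(C:ℝ)+2)^k * (2 * N * u^4)) := by gcongr
      _ = (4 * (2*C+2)^k) * (N * u^4) := by ring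
      _ ≤ u * (N * u^4) := by gcongr
      _ = _ := by ring
  have hLN2 : ∀ i, Lf i ≤ N^2 := by
    intro i
    have e1 : u^5 ≤ N := by
      rw [hupow]
      calc N^(e * (5:ℕ)) ≤ N^(1:ℝ) := Real.rpow_le_rpow_of_exponent_le hNone (by push_cast; linarith)
        _ = N := Real.rpow_one _
    have := hLN i
    have h2 : N * u^5 ≤ N * N := by gcongr
    have h3 : 0 < Lf i := lt_of_lt_of_le (by positivity) (hL1 i)
    rw [pow_two]
    linarith
  have hFu : Fr μ N u δ := by
    intro j x ℓ hℓ
    refine (hF j x ℓ hℓ).trans ?_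
    have hℓ0 : 0 < ℓ := lt_of_lt_of_le (by positivity) hℓ
    apply mul_le_mul_of_nonneg_right _ (by positivity)
    exact Real.rpow_le_rpow_of_exponent_le hNone (by linarith)
  have hCDh : 4 * C * (D * D * h) ≤ u⁻¹ := by
    have e1 : u * h ≤ u⁻¹ := by
      have : u * h = u⁻¹^3 := by rw [hh]; field_simp
      rw [this]
      have := pow_le_pow_of_le_one (by positivity) (inv_le_one_of_one_le₀ hu1) (show 1 ≤ 3 by norm_num)
      simpa using this
    refine le_trans ?_ e1
    have : 4 * C * (D * D) ≤ u := by linarith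
    calc 4 * C * (D * D * h) = 4 * C * (D * D) * h := by ring
      _ ≤ u * h := by gcongr
  have hCkD : ∀ i, i ≤ k → (C:ℝ)^(3*i+1) ≤ D := fun i hi => pow_le_pow_right₀ hC1 (by omega)
  have hCkD' : ∀ i, i ≤ k → (C:ℝ)^i ≤ D := fun i hi => pow_le_pow_right₀ hC1 (by omega)
  obtain ⟨m, hm⟩ : ∃ m : ℕ → ℝ, m = fun i => ((Sp (ph (PP μ i)) h (τ i) (Lf i)).card : ℝ) := ⟨_, rfl⟩
  -- the starting frequency
  set b : ℤ := ⌊ξ * u^4⌋ with hb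
  have hb1 := Int.floor_le (ξ * u^4)
  have hb2 := Int.lt_floor_add_one (ξ * u^4)
  rw [← hb] at hb1 hb2
  have hbd : |ξ * u^4 - b| ≤ 1 := by rw [abs_le]; constructor <;> linarith
  have hξu : |ξ * u^4| = N * u^4 := by rw [abs_mul, hξ, abs_of_pos (by positivity : 0 < u^4)]
  have hbu : |(b:ℝ)| ≤ N * u^4 + 1 := by
    have := abs_sub_abs_le_abs_sub (b:ℝ) (ξ * u^4)
    rw [abs_sub_comm (b:ℝ)] at this
    linarith
  have hbl : N * u^4 - 1 ≤ |(b:ℝ)| := by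
    have := abs_sub_abs_le_abs_sub (ξ * u^4) (b:ℝ)
    linarith
  have hbS : b ∈ Sp (ph (PP μ k)) h (τ k) (Lf k) := by
    rw [Sp_mem]
    constructor
    · have := hL1 k
      linarith
    · have e1 := ph_lip (PP μ k) D ((PP_mass hy hC1 k).trans (hCkD' k le_rfl)) (PP_abs hy hC1 k D (hCkD' k le_rfl)) hD0.le ξ (h * b)
      have e2 : |ξ - h * b| ≤ h := by
        have : ξ - h * b = h * (ξ * u^4 - b) := by
          calc ξ - h * b = (h * u^4) * ξ - h * b := by rw [hhu, one_mul]
            _ = _ := by ring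
        rw [this, abs_mul, abs_of_pos hh0]
        exact mul_le_of_le_one_right hh0.le hbd
      have e3 : D * D * |ξ - h * b| ≤ D * D * h := by gcongr
      have e4 : D * D * h ≤ u⁻¹ := by
        have : 1 * (D * D * h) ≤ (4 * C) * (D * D * h) := mul_le_mul_of_nonneg_right (by linarith) (by positivity)
        linarith
      have e5 := hτu k
      have e6 : 2 * τ k ≤ N^(-ε) := by
        calc 2 * τ k ≤ (8 * C * D) * N^(-(ε*3)) := by
              apply mul_le_mul _ (hτε k) (hτ0 k).le (by positivity)
              linarith
          _ ≤ N^ε * N^(-(ε*3)) := by gcongr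
          _ = N^(ε + -(ε*3)) := (Real.rpow_add hN0 _ _).symm
          _ ≤ N^(-ε) := Real.rpow_le_rpow_of_exponent_le hNone (by linarith)
      have e7 : ‖ph (PP μ k) ξ‖ ≤ ‖ph (PP μ k) (h * b)‖ + ‖ph (PP μ k) ξ - ph (PP μ k) (h * b)‖ := by
        have := norm_add_le (ph (PP μ k) (h * b)) (ph (PP μ k) ξ - ph (PP μ k) (h * b))
        simpa using this
      linarith
  have hfirst : 3 * u^4 * N^(δ/2) ≤ m (k-1) := by
    have hkk : (k - 1) + 1 = k := by omega
    have e1 := mult_PP hy hC1 (k-1) D (hCkD' _ (by omega)) h (τ k) (τ (k-1)) (Lf k) (Lf (k-1)) (hτ0 _).le hh0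
      (by
        have t1 := hτs (k-1) (by omega)
        rw [hkk] at t1
        have t2 : (τ k)^2 ≤ τ k := by
          rw [pow_two]
          exact mul_le_of_le_one_left (hτ0 k).le (hτ1 k)
        have t3 : 4 * C * τ (k-1) ≤ 8 * C * D * τ (k-1) := by
          apply mul_le_mul_of_nonneg_right _ (hτ0 _).le
          linarith
        linarith)
      (hCDh.trans (hτu k))
      (by
        have t1 := hLs (k-1) (by omega)
        rw [hkk] at t1
        have : 0 ≤ C * Lf k := mul_nonneg hC0.le (le_trans (by positivity) (hL1 k))
        linarith) b (by rw [hkk]; exact hbS)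
    have e2 := first_step (μ (k-1)) _ b N⁻¹ (u * N⁻¹^δ) _ (by positivity)
      (by
        rw [← div_eq_inv_mul, le_div_iff₀ hN0, one_mul]
        have : 2 ≤ u^4 := by
          have := pow_le_pow_right₀ hu1 (show 1 ≤ 4 by norm_num)
          simp at this
          linarith
        have : N * 2 ≤ N * u^4 := by gcongr
        linarith) (fun x => hFu (k-1) x _ le_rfl) e1
    have e3 : m (k-1) = ((Sp (ph (PP μ (k-1))) h (τ (k-1)) (Lf (k-1))).card : ℝ) := by rw [hm]
    rw [← e3, div_le_iff₀ (by positivity)] at e2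
    have e4 : u⁻¹ ≤ u * N⁻¹^δ * m (k-1) * (2 * D) := (hτu k).trans e2
    have hNδ : N⁻¹^δ * N^δ = 1 := by
      rw [← Real.mul_rpow (by positivity) hN0.le, inv_mul_cancel₀ hN0.ne', Real.one_rpow]
    have hm0 : 0 ≤ m (k-1) := by rw [hm]; positivity
    have e5 : N^δ ≤ u^3 * m (k-1) := by
      calc N^δ = u * u⁻¹ * N^δ := by rw [mul_inv_cancel₀ hu0.ne', one_mul]
        _ ≤ u * (u * N⁻¹^δ * m (k-1) * (2 * D)) * N^δ := by gcongr
        _ = u^2 * m (k-1) * (2 * D) * (N⁻¹^δ * N^δ) := by ring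
        _ = u^2 * m (k-1) * (2 * D) := by rw [hNδ, mul_one]
        _ ≤ u^2 * m (k-1) * u := by
          have : 2 * D ≤ u := by linarith
          gcongr
        _ = _ := by ring
    have e6 : u^8 ≤ N^(δ/2) := by
      rw [hupow]
      exact Real.rpow_le_rpow_of_exponent_le hNone (by push_cast; linarith)
    have e7 : N^δ = N^(δ/2) * N^(δ/2) := by rw [← Real.rpow_add hN0]; congr 1; ring
    have e8 : u^3 * (3 * u^4 * N^(δ/2)) ≤ u^3 * m (k-1) := by
      calc u^3 * (3 * u^4 * N^(δ/2)) = 3 * u^7 * N^(δ/2) := by ring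
        _ ≤ u * u^7 * N^(δ/2) := by
          have : 3 ≤ u := by linarith
          gcongr
        _ = u^8 * N^(δ/2) := by ring
        _ ≤ N^(δ/2) * N^(δ/2) := by gcongr
        _ ≤ _ := e7 ▸ e5
    exact le_of_mul_le_mul_left e8 (by positivity)
  have hm1 : 1 ≤ m (k-1) := by
    have : 1 ≤ N^(δ/2) := Real.one_le_rpow hNone (by positivity)
    have h2 : 1 ≤ u^4 := one_le_pow₀ hu1
    have : 1 ≤ u^4 * N^(δ/2) := one_le_mul_of_one_le_of_one_le h2 this
    linarith
  have key : ∀ i, i ≤ k - 1 → u^i * m (k-1) ≤ m (k-1-i) := by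
    intro i
    induction i with
    | zero => intro _; simp
    | succ i ih =>
      intro hi
      have ih := ih (by omega)
      by_contra hlt
      push Not at hlt
      set j := k - 1 - (i+1) with hj
      have hj1 : k - 1 - i = j + 1 := by omega
      rw [hj1] at ih
      have hle : m j ≤ u * m (j+1) := by
        calc m j ≤ u^(i+1) * m (k-1) := hlt.le
          _ = u * (u^i * m (k-1)) := by ring
          _ ≤ u * m (j+1) := by gcongr
      have hbig : 3 * u^4 * N^(δ/2) ≤ m (j+1) := by
        refine hfirst.trans (le_trans ?_ ih)
        exact le_mul_of_one_le_left (by linarith) (one_le_pow₀ hu1)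
      rw [hm] at hle hbig
      exact core δ κ hδ hδ1 C hC2 N hNone hXN u D hD1 hN1
        (by
          rw [hupow]
          exact Real.rpow_le_rpow_of_exponent_le hNone (by push_cast; linarith))
        μ hy hFu j (hCkD j (by omega)) (τ (j+1)) (τ j) (Lf (j+1)) (Lf j) (hτu _) (hτ1 _) (hτ0 _).le (hτs j (by omega))
        (by have := hL1 (j+1); linarith) (hLN _) (hLN2 _) (hLs j (by omega)) hle hbig
  have hend := key (k-1) le_rfl
  rw [Nat.sub_self] at hend
  have hm0 : m 0 ≤ 2 * Lf 0 + 1 := by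
    rw [hm]
    exact Sp_card _ _ _ _ (le_trans (by positivity) (hL1 0))
  have hm0' : m 0 ≤ N * u^6 := by
    have t1 := hLN 0
    have t2 : 1 ≤ N * u^5 := by
      exact one_le_mul_of_one_le_of_one_le hNone (one_le_pow₀ (n := 5) hu1)
    calc m 0 ≤ 2 * (N * u^5) := by linarith
      _ ≤ u * (N * u^5) := by
        have : 2 ≤ u := by linarith
        gcongr
      _ = _ := by ring
  have hk1 : k - 1 = (q + 1) + 6 := by omega
  have hfin : u^(q+1) * u^6 ≤ N * u^6 := by
    rw [← pow_add, ← hk1]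
    have : 0 ≤ u^(k-1) := by positivity
    calc u^(k-1) = u^(k-1) * 1 := by ring
      _ ≤ u^(k-1) * m (k-1) := by gcongr
      _ ≤ _ := hend.trans hm0'
  have hfin2 : u^(q+1) ≤ N := le_of_mul_le_mul_right hfin (by positivity)
  rw [hupow] at hfin2
  have : N < N^(e * ((q+1:ℕ):ℝ)) := by
    calc N = N^(1:ℝ) := (Real.rpow_one _).symm
      _ < _ := by
        apply Real.rpow_lt_rpow_of_exponent_lt (by linarith)
        push_cast
        rw [div_le_iff₀ he0] at hq
        have : e * ((q:ℝ)+1) = q * e + e := by ring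
        linarith
  linarith
end

section
open MeasureTheory Set Real
open scoped Pointwise

lemma fr_one (ν : Measure ℝ) [IsFiniteMeasure ν] (C A H ε δ δ₀ : ℝ) (hC : 0 < C) (hA : 1 ≤ A) (hCA : C ≤ A)
    (hCA' : C⁻¹ ≤ A) (hH : 1 ≤ H) (hε : 0 < ε) (hδ : 0 < δ) (hδ1 : δ ≤ 1/2) (hδ₀ : 2*δ ≤ δ₀)
    (hm : ν univ ≤ ENNReal.ofReal C) (N : ℝ) (hN : N = 2 * π * H) (hNA : 7 * A^3 ≤ N^ε)
    (hyp : ∀ σ ∈ Icc (C * H⁻¹) (C⁻¹ * H^(-ε)), (ν.prod ν) {p : ℝ × ℝ | |p.1 - p.2| ≤ σ} ≤ ENNReal.ofReal (C * σ^δ₀))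
    (x ℓ : ℝ) (hℓ : N⁻¹ ≤ ℓ) : ν.real (Icc x (x+ℓ)) ≤ N^(2*ε) * ℓ^δ := by
  have hπ : 2 * π ≤ 7 := by have := Real.pi_lt_d2; linarith
  have hπ3 := Real.pi_gt_three
  have hH0 : 0 < H := by linarith
  have hA0 : 0 < A := by linarith
  have hN0 : 0 < N := by rw [hN]; positivity
  have hHN : H ≤ N := by rw [hN]; exact le_mul_of_one_le_left hH0.le (by linarith)
  have hN1 : 1 ≤ N := by linarith
  have hℓ0 : 0 < ℓ := lt_of_lt_of_le (by positivity) hℓ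
  obtain ⟨σ, hσ⟩ : ∃ σ, σ = 7 * A * ℓ := ⟨_, rfl⟩
  have hσ0 : 0 < σ := by rw [hσ]; positivity
  have hσℓ : ℓ ≤ σ := by rw [hσ]; exact le_mul_of_one_le_left hℓ0.le (by linarith)
  have hσH : C * H⁻¹ ≤ σ := by
    have h1 : H⁻¹ ≤ 7 * ℓ := by
      calc H⁻¹ = (2 * π) * N⁻¹ := by rw [hN]; field_simp
        _ ≤ 7 * ℓ := mul_le_mul hπ hℓ (by positivity) (by norm_num)
    calc C * H⁻¹ ≤ A * (7 * ℓ) := mul_le_mul hCA h1 (by positivity) hA0.le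
      _ = σ := by rw [hσ]; ring
  have hNe : N^(2*ε) = N^ε * N^ε := by rw [← Real.rpow_add hN0]; congr 1; ring
  have hNε0 : 0 < N^ε := by positivity
  have hA31 : 1 ≤ A^3 := one_le_pow₀ hA
  have hA21 : 1 ≤ A^2 := one_le_pow₀ hA
  have hNε1 : 1 ≤ N^ε := by linarith
  by_cases hc : σ ≤ 1 ∧ σ ≤ C⁻¹ * H^(-ε)
  · have h1 := hyp σ ⟨hσH, hc.2⟩
    have h2 : ν (Icc x (x+ℓ)) * ν (Icc x (x+ℓ)) ≤ (ν.prod ν) {p : ℝ × ℝ | |p.1 - p.2| ≤ σ} := by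
      rw [← Measure.prod_prod]
      apply measure_mono
      rintro ⟨a, b⟩ ⟨⟨h1, h2⟩, h3, h4⟩
      simp only at h1 h2 h3 h4
      show |a - b| ≤ σ
      rw [abs_le]; constructor <;> linarith
    have h3 : ν.real (Icc x (x+ℓ)) * ν.real (Icc x (x+ℓ)) ≤ C * σ^δ₀ := by
      have := ENNReal.toReal_mono ENNReal.ofReal_ne_top (h2.trans h1)
      rw [ENNReal.toReal_mul, ENNReal.toReal_ofReal (by positivity)] at this
      exact this
    have h4 : σ^δ₀ ≤ 7 * A * (ℓ^δ * ℓ^δ) := by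
      calc σ^δ₀ ≤ σ^(2*δ) := Real.rpow_le_rpow_of_exponent_ge hσ0 hc.1 hδ₀
        _ = (7 * A)^(2*δ) * ℓ^(2*δ) := by rw [hσ, Real.mul_rpow (by positivity) hℓ0.le]
        _ ≤ (7 * A)^(1:ℝ) * ℓ^(2*δ) := by
          gcongr
          · linarith
          · linarith
        _ = 7 * A * (ℓ^δ * ℓ^δ) := by
          rw [Real.rpow_one, ← Real.rpow_add hℓ0]; congr 2; ring
    have h5 : C * (7 * A) ≤ N^(2*ε) * N^(2*ε) := by
      have t1 : C * (7 * A) ≤ 7 * A^3 := by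
        calc C * (7 * A) ≤ A * (7 * A) := by gcongr
          _ = 7 * A^2 := by ring
          _ ≤ 7 * A^3 := by gcongr; norm_num
      have t2 : N^ε ≤ N^(2*ε) := Real.rpow_le_rpow_of_exponent_le hN1 (by linarith)
      have t3 : N^(2*ε) ≤ N^(2*ε) * N^(2*ε) := le_mul_of_one_le_left (by positivity) (by linarith)
      linarith
    have h6 : ν.real (Icc x (x+ℓ)) * ν.real (Icc x (x+ℓ)) ≤ (N^(2*ε) * ℓ^δ) * (N^(2*ε) * ℓ^δ) := by
      calc _ ≤ C * σ^δ₀ := h3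
        _ ≤ C * (7 * A * (ℓ^δ * ℓ^δ)) := by gcongr
        _ = C * (7 * A) * (ℓ^δ * ℓ^δ) := by ring
        _ ≤ (N^(2*ε) * N^(2*ε)) * (ℓ^δ * ℓ^δ) := by gcongr
        _ = _ := by ring
    exact (mul_self_le_mul_self_iff measureReal_nonneg (by positivity)).2 h6
  · have h1 : A⁻¹ * (N^ε)⁻¹ ≤ σ := by
      rw [not_and_or] at hc
      rcases hc with hc | hc
      · push Not at hc
        refine le_trans ?_ hc.le
        exact mul_le_one₀ (inv_le_one_of_one_le₀ hA) (by positivity) (inv_le_one_of_one_le₀ hNε1)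
      · push Not at hc
        refine le_trans ?_ hc.le
        rw [Real.rpow_neg hH0.le]
        have : H^ε ≤ N^ε := Real.rpow_le_rpow hH0.le hHN hε.le
        gcongr
    have h2 : (7 * A^2 * N^ε)⁻¹ ≤ ℓ := by
      have : ℓ = (7 * A)⁻¹ * σ := by rw [hσ]; field_simp
      rw [this]
      calc (7 * A^2 * N^ε)⁻¹ = (7 * A)⁻¹ * (A⁻¹ * (N^ε)⁻¹) := by field_simp
        _ ≤ _ := by gcongr
    have hB : 1 ≤ 7 * A^2 * N^ε := one_le_mul_of_one_le_of_one_le (by linarith) hNε1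
    have h3 : (7 * A^2 * N^ε)⁻¹ ≤ ℓ^δ := by
      calc (7 * A^2 * N^ε)⁻¹ = (7 * A^2 * N^ε)⁻¹^(1:ℝ) := (Real.rpow_one _).symm
        _ ≤ (7 * A^2 * N^ε)⁻¹^δ := Real.rpow_le_rpow_of_exponent_ge (by positivity) (inv_le_one_of_one_le₀ hB) (by linarith)
        _ ≤ ℓ^δ := Real.rpow_le_rpow (by positivity) h2 hδ.le
    have h4 : ν.real (Icc x (x+ℓ)) ≤ A := by
      have h5 := ENNReal.toReal_mono ENNReal.ofReal_ne_top ((measure_mono (subset_univ (Icc x (x+ℓ)))).trans hm)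
      rw [ENNReal.toReal_ofReal hC.le] at h5
      exact h5.trans hCA
    refine h4.trans ?_
    calc A = (7 * A^3) * (7 * A^2)⁻¹ := by field_simp
      _ ≤ N^ε * (7 * A^2)⁻¹ := by gcongr
      _ = N^(2*ε) * (7 * A^2 * N^ε)⁻¹ := by rw [hNe]; field_simp
      _ ≤ _ := by gcongr

theorem final (δ₀ : ℝ) (hδ₀ : 0 < δ₀) :
    ∃ (k : ℕ) (ε₂ : ℝ), 0 < ε₂ ∧ ∀ C₀ : ℝ, 0 < C₀ → ∃ C₁ > (0 : ℝ),
      ∀ (μ : Fin k → Measure ℝ) [∀ j, IsFiniteMeasure (μ j)],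
        (∀ j, μ j (Set.Icc C₀⁻¹ C₀)ᶜ = 0) →
        (∀ j, μ j Set.univ ≤ ENNReal.ofReal C₀) →
        ∀ η : ℝ, 1 ≤ |η| →
        (∀ σ ∈ Set.Icc (C₀ * |η|⁻¹) (C₀⁻¹ * |η| ^ (-ε₂)), ∀ j,
          ((μ j).prod (μ j)) {p : ℝ × ℝ | |p.1 - p.2| ≤ σ} ≤ ENNReal.ofReal (C₀ * σ ^ δ₀)) →
        ‖∫ x : Fin k → ℝ, Complex.exp (Complex.I * ((2 * π * η * ∏ j, x j : ℝ) : ℂ))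
            ∂(Measure.pi μ)‖ ≤ C₁ * |η| ^ (-ε₂) := by
  obtain ⟨δ, hδ, hδ1, hδ2⟩ : ∃ δ : ℝ, 0 < δ ∧ δ ≤ 1/2 ∧ 2*δ ≤ δ₀ :=
    ⟨min (δ₀/2) (1/2), by positivity, min_le_right _ _, by have := min_le_left (δ₀/2) (1/2); linarith⟩
  obtain ⟨k, ε, hε, -, hmain⟩ := mainN δ hδ hδ1
  refine ⟨k, ε, hε, fun C₀ hC₀ => ?_⟩
  obtain ⟨C, hC⟩ := exists_nat_ge (max 2 (max C₀ C₀⁻¹))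
  have hC2 : (2:ℝ) ≤ C := (le_max_left _ _).trans hC
  have hCC : C₀ ≤ C := (le_max_left _ _).trans ((le_max_right _ _).trans hC)
  have hCC' : C₀⁻¹ ≤ C := (le_max_right _ _).trans ((le_max_right _ _).trans hC)
  have hC1 : (1:ℝ) ≤ C := by linarith
  have hev := (hmain C (by exact_mod_cast hC2)).and (ev_pow (7 * (C:ℝ)^3) ε hε)
  obtain ⟨N₀, hN₀⟩ := Filter.eventually_atTop.1 hev
  obtain ⟨M, hM1, hM2⟩ : ∃ M : ℝ, 1 ≤ M ∧ N₀ ≤ M := ⟨max 1 N₀, le_max_left _ _, le_max_right _ _⟩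
  have hCk : (1:ℝ) ≤ (C:ℝ)^k := one_le_pow₀ hC1
  have hMε : 1 ≤ M^ε := Real.one_le_rpow hM1 hε.le
  refine ⟨(C:ℝ)^k * M^ε, by positivity, ?_⟩
  intro μ _ hsupp hmass η hη hyp
  have hη0 : 0 < |η| := by linarith
  obtain ⟨μ', hμ'⟩ : ∃ μ' : ℕ → Measure ℝ, μ' = fun j => if h : j < k then μ ⟨j, h⟩ else 0 := ⟨_, rfl⟩
  have hlt : ∀ j (h : j < k), μ' j = μ ⟨j, h⟩ := by intro j h; rw [hμ']; simp [h]
  have hge : ∀ j, ¬ (j < k) → μ' j = 0 := by intro j h; rw [hμ']; simp [h]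
  have hfin : (fun i : Fin k => μ' i) = μ := by funext i; exact hlt i i.2
  have hy : Hy μ' C := by
    refine ⟨fun j => ?_, fun j => ?_, fun j => ?_⟩
    · by_cases h : j < k
      · rw [hlt j h]; infer_instance
      · rw [hge j h]; infer_instance
    · by_cases h : j < k
      · rw [hlt j h]
        refine measure_mono_null ?_ (hsupp ⟨j, h⟩)
        apply compl_subset_compl.2
        apply Icc_subset_Icc _ hCC
        exact inv_anti₀ hC₀ hCC
      · rw [hge j h]; simp
    · by_cases h : j < k
      · rw [hlt j h]
        have h5 := ENNReal.toReal_mono ENNReal.ofReal_ne_top (hmass ⟨j, h⟩)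
        rw [ENNReal.toReal_ofReal hC₀.le] at h5
        exact h5.trans hCC
      · rw [hge j h]; simp
  have := PP_fin hy.fin
  have hphEq : ∫ x : Fin k → ℝ, Complex.exp (Complex.I * ((2 * π * η * ∏ j, x j : ℝ) : ℂ)) ∂(Measure.pi μ)
      = ph (PP μ' k) (2 * π * η) := by
    rw [ph, ← pi_map_PP hy.fin k, integral_map (by fun_prop) (cont_e _).aestronglyMeasurable, hfin]
  rw [hphEq]
  obtain ⟨N, hN⟩ : ∃ N, N = 2 * π * |η| := ⟨_, rfl⟩
  have hπ3 := Real.pi_gt_three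
  have hηN : |η| ≤ N := by rw [hN]; exact le_mul_of_one_le_left hη0.le (by linarith)
  by_cases hc : N₀ ≤ N
  · obtain ⟨h1, h2⟩ := hN₀ N hc
    have hF : Fr μ' N (N^(2*ε)) δ := by
      intro j x ℓ hℓ
      by_cases h : j < k
      · rw [hlt j h]
        exact fr_one (μ ⟨j, h⟩) C₀ C |η| ε δ δ₀ hC₀ hC1 hCC hCC' hη hε hδ hδ1 hδ2 (hmass _) N hN h2
          (fun σ hσ => hyp σ hσ _) x ℓ hℓ
      · rw [hge j h]
        have : 0 < ℓ := lt_of_lt_of_le (by have : 0 < N := by linarith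
                                           positivity) hℓ
        simp only [Measure.real, Measure.coe_zero, Pi.zero_apply, ENNReal.toReal_zero]
        have : 0 < N := by linarith
        positivity
    have h3 := h1 μ' hy hF (2 * π * η) (by rw [hN, abs_mul, abs_of_pos (by positivity : 0 < 2 * π)])
    refine h3.trans ?_
    have h4 : N^(-ε) ≤ |η|^(-ε) := Real.rpow_le_rpow_of_nonpos hη0 hηN (by linarith)
    refine h4.trans ?_
    exact le_mul_of_one_le_left (by positivity) (one_le_mul_of_one_le_of_one_le hCk hMε)
  · push Not at hc
    refine ((ph_le _ _).trans (PP_mass hy hC1 k)).trans ?_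
    rw [mul_assoc, Real.rpow_neg hη0.le]
    apply le_mul_of_one_le_right (by positivity)
    rw [← div_eq_mul_inv, one_le_div₀ (by positivity)]
    exact Real.rpow_le_rpow hη0.le (by linarith) hε.le
end

/-- **Decay of multiplicative convolutions (Bourgain's sum–product bound), measure form.**
For every `δ₀ > 0` there are `k ∈ ℕ` and `ε₂ > 0` depending only on `δ₀` such that for every
`C₀ > 0` there is `C₁ > 0` depending only on `C₀, δ₀` with the following property.  If
`μ₁, …, μ_k` are finite Borel measures on `ℝ` supported in `[C₀⁻¹, C₀]` with total mass
`≤ C₀`, `η ∈ ℝ` with `|η| ≥ 1`, and for all `σ ∈ [C₀|η|⁻¹, C₀⁻¹|η|^{-ε₂}]` and all `j`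
one has `(μ_j × μ_j){(x,y) : |x-y| ≤ σ} ≤ C₀ σ^{δ₀}`, then
`|∫ exp(2πiη x₁⋯x_k) dμ₁(x₁)⋯dμ_k(x_k)| ≤ C₁ |η|^{-ε₂}`. -/
theorem mult_conv_decay_measures (δ₀ : ℝ) (hδ₀ : 0 < δ₀) :
    ∃ (k : ℕ) (ε₂ : ℝ), 0 < ε₂ ∧ ∀ C₀ : ℝ, 0 < C₀ → ∃ C₁ > (0 : ℝ),
      ∀ (μ : Fin k → Measure ℝ) [∀ j, IsFiniteMeasure (μ j)],
        (∀ j, μ j (Set.Icc C₀⁻¹ C₀)ᶜ = 0) →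
        (∀ j, μ j Set.univ ≤ ENNReal.ofReal C₀) →
        ∀ η : ℝ, 1 ≤ |η| →
        (∀ σ ∈ Set.Icc (C₀ * |η|⁻¹) (C₀⁻¹ * |η| ^ (-ε₂)), ∀ j,
          ((μ j).prod (μ j)) {p : ℝ × ℝ | |p.1 - p.2| ≤ σ} ≤ ENNReal.ofReal (C₀ * σ ^ δ₀)) →
        ‖∫ x : Fin k → ℝ, Complex.exp (Complex.I * ((2 * π * η * ∏ j, x j : ℝ) : ℂ))
            ∂(Measure.pi μ)‖ ≤ C₁ * |η| ^ (-ε₂) := by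
  exact final δ₀ hδ₀

end
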